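/- arXiv:1603.00207 — 8 statements merged into one kernel-verified Lean document; each statement's English description precedes it below -/
import Mathlib

section
/- For almost every α > 0 (with respect to Lebesgue measure) and every starting point x = (x₁, x₂) ∈ [0,1)², there exists a constant C = C(α) such that for every axis-parallel rectangle S ⊆ [0,1)² and every T > 0 one has |∫₀^T χ_S({x₁+t}, {x₂+αt}) dt − T·λ(S)| ≤ C; that is, the discrepancy sup over axis-parallel rectangles of this quantity is O(1). -/
open MeasureTheory

/-- The distributional error `Δ_T(S, α, x)` of the continuous irrational rotation
with slope `α` and starting point `(x₁, x₂)` for the set `S ⊆ [0,1)²`. -/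
noncomputable def rotDelta (S : Set (ℝ × ℝ)) (α x₁ x₂ T : ℝ) : ℝ :=
  (∫ t in (0:ℝ)..T,
    Set.indicator S (fun _ => (1:ℝ)) (Int.fract (x₁ + t), Int.fract (x₂ + α * t))) -
    T * (volume S).toReal


lemma aux_int : ∫⁻ y : UnitAddCircle, ‖y‖ₑ ^ (-(2/3) : ℝ) ≠ ⊤ := by
  have h0 : IntervalIntegrable (fun x : ℝ => |x| ^ (-(2/3) : ℝ)) volume 0 (1/2) := by
    refine (intervalIntegral.intervalIntegrable_rpow' (r := -(2/3)) (by norm_num)).congr ?_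
    intro x hx
    rw [Set.uIoc_of_le (by norm_num)] at hx
    simp only [abs_of_pos hx.1]
  have h1 : IntervalIntegrable (fun x : ℝ => |x| ^ (-(2/3) : ℝ)) volume (-(1/2)) 0 := by
    rw [IntervalIntegrable.iff_comp_neg]
    simpa using h0.symm
  have h2 := h1.trans h0
  rw [intervalIntegrable_iff_integrableOn_Ioc_of_le (by norm_num)] at h2
  have h3 := h2.2
  rw [hasFiniteIntegral_iff_enorm] at h3
  rw [← UnitAddCircle.lintegral_preimage (-(1/2))]
  have e : (-(1/2) : ℝ) + 1 = 1/2 := by norm_num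
  rw [e]
  refine ne_of_lt (lt_of_le_of_lt (le_of_eq ?_) h3)
  have hz : ∀ᵐ x : ℝ ∂(volume.restrict (Set.Ioc (-(1/2)) (1/2 : ℝ))), x ≠ 0 :=
    ae_restrict_of_ae (by simp [ae_iff])
  have hm := ae_restrict_mem (μ := volume) (measurableSet_Ioc (a := (-(1/2) : ℝ)) (b := 1/2))
  apply lintegral_congr_ae
  filter_upwards [hz, hm] with x hx hxm
  have hn : ‖(x : UnitAddCircle)‖ = |x| := by
    rw [AddCircle.norm_coe_eq_abs_iff (p := 1) (by norm_num)]
    rw [abs_le, abs_one]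
    exact ⟨hxm.1.le, hxm.2⟩
  rw [← ofReal_norm, hn, ← ofReal_norm, Real.norm_of_nonneg (by positivity),
    ENNReal.ofReal_rpow_of_pos (abs_pos.2 hx)]

lemma aux_ae_circle : ∀ᵐ y : UnitAddCircle,
    ∑' k : ℕ, ENNReal.ofReal (((k : ℝ) + 1) ^ (-(4/3) : ℝ)) *
      ‖((k + 1 : ℕ) : ℤ) • y‖ₑ ^ (-(2/3) : ℝ) ≠ ⊤ := by
  have hmeas : Measurable (fun y : UnitAddCircle => ‖y‖ₑ ^ (-(2/3) : ℝ)) := by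
    fun_prop
  have hmp : ∀ k : ℕ, MeasurePreserving (fun y : UnitAddCircle => ((k + 1 : ℕ) : ℤ) • y)
      volume volume := fun k => Measure.measurePreserving_zsmul volume (by positivity)
  have hmk : ∀ k : ℕ, Measurable (fun y : UnitAddCircle =>
      ENNReal.ofReal (((k : ℝ) + 1) ^ (-(4/3) : ℝ)) *
      ‖((k + 1 : ℕ) : ℤ) • y‖ₑ ^ (-(2/3) : ℝ)) := fun k =>
    (hmeas.comp (hmp k).measurable).const_mul _
  have hs : ∑' k : ℕ, ENNReal.ofReal (((k : ℝ) + 1) ^ (-(4/3) : ℝ)) ≠ ⊤ := by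
    have : Summable (fun k : ℕ => ((k : ℝ) + 1) ^ (-(4/3) : ℝ)) := by
      have := (summable_nat_add_iff 1).2
        (Real.summable_nat_rpow (p := -(4/3)) |>.2 (by norm_num))
      simpa using this
    exact this.tsum_ofReal_ne_top
  have := ae_lt_top (Measurable.tsum hmk) (μ := (volume : Measure UnitAddCircle)) (by
    rw [lintegral_tsum (fun k => (hmk k).aemeasurable)]
    have : ∀ k : ℕ, ∫⁻ y : UnitAddCircle, ENNReal.ofReal (((k : ℝ) + 1) ^ (-(4/3) : ℝ)) *
      ‖((k + 1 : ℕ) : ℤ) • y‖ₑ ^ (-(2/3) : ℝ) =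
        ENNReal.ofReal (((k : ℝ) + 1) ^ (-(4/3) : ℝ)) *
          ∫⁻ y : UnitAddCircle, ‖y‖ₑ ^ (-(2/3) : ℝ) := by
      intro k
      rw [← (hmp k).lintegral_comp hmeas]
      exact lintegral_const_mul _ (hmeas.comp (hmp k).measurable)
    simp_rw [this]
    rw [ENNReal.tsum_mul_right]
    exact ENNReal.mul_ne_top hs aux_int)
  filter_upwards [this] with y hy using hy.ne

lemma aux_ae_real : ∀ᵐ α : ℝ,
    ∑' k : ℕ, ENNReal.ofReal (((k : ℝ) + 1) ^ (-(4/3) : ℝ)) *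
      ‖((k + 1 : ℕ) : ℤ) • (α : UnitAddCircle)‖ₑ ^ (-(2/3) : ℝ) ≠ ⊤ := by
  have h : ∀ n : ℤ, ∀ᵐ α : ℝ ∂(volume.restrict (Set.Ioc (n : ℝ) (n + 1))),
    ∑' k : ℕ, ENNReal.ofReal (((k : ℝ) + 1) ^ (-(4/3) : ℝ)) *
      ‖((k + 1 : ℕ) : ℤ) • (α : UnitAddCircle)‖ₑ ^ (-(2/3) : ℝ) ≠ ⊤ := fun n =>
    (UnitAddCircle.measurePreserving_mk (n : ℝ)).quasiMeasurePreserving.ae aux_ae_circle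
  have h2 := (ae_restrict_iUnion_iff (μ := volume) (fun n : ℤ => Set.Ioc (n : ℝ) (n + 1)) _).2 h
  rwa [iUnion_Ioc_intCast, Measure.restrict_univ] at h2

/-- summability of small denominators -/
lemma aux_summable : ∀ᵐ α : ℝ, (∀ k : ℕ, Real.sin (Real.pi * (k + 1) * α) ≠ 0) ∧
    Summable (fun k : ℕ => 1 / ((k : ℝ) + 1) ^ 2 * |Real.sin (Real.pi * (k + 1) * α)|⁻¹) := by
  filter_upwards [aux_ae_real] with α hα
  have hsin : ∀ k : ℕ, 2 * ‖((k + 1 : ℕ) : ℤ) • (α : UnitAddCircle)‖ ≤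
      |Real.sin (Real.pi * (k + 1) * α)| := by
    intro k
    rw [← AddCircle.coe_zsmul, UnitAddCircle.norm_eq]
    have e : (((k + 1 : ℕ) : ℤ) • α : ℝ) = (k + 1) * α := by simp
    rw [e]
    set x := ((k : ℝ) + 1) * α
    have h1 : |Real.pi * (x - round x)| ≤ Real.pi / 2 := by
      rw [abs_mul, abs_of_pos Real.pi_pos]
      have := abs_sub_round x
      nlinarith [Real.pi_pos]
    have h2 := Real.mul_abs_le_abs_sin h1
    have h3 : Real.pi * (x - round x) = Real.pi * (k + 1) * α - round x * Real.pi := by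
      simp only [x]; ring
    rw [abs_mul, abs_of_pos Real.pi_pos] at h2
    rw [h3, Real.sin_sub_int_mul_pi, abs_mul] at h2
    rw [abs_zpow, abs_neg, abs_one, one_zpow, one_mul] at h2
    have : 2 / Real.pi * (Real.pi * |x - round x|) = 2 * |x - round x| := by
      field_simp
    linarith
  have hpos : ∀ k : ℕ, 0 < ‖((k + 1 : ℕ) : ℤ) • (α : UnitAddCircle)‖ := by
    intro k
    have := ENNReal.ne_top_of_tsum_ne_top hα k
    by_contra hc
    have h0 : ‖((k + 1 : ℕ) : ℤ) • (α : UnitAddCircle)‖ = 0 :=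
      le_antisymm (not_lt.1 hc) (norm_nonneg _)
    apply this
    rw [← ofReal_norm, h0, ENNReal.ofReal_zero, ENNReal.zero_rpow_of_neg (by norm_num)]
    apply ENNReal.mul_top
    rw [ENNReal.ofReal_ne_zero_iff]
    positivity
  refine ⟨fun k h => ?_, ?_⟩
  · have := hsin k
    rw [h, abs_zero] at this
    linarith [hpos k]
  · set g : ℕ → ℝ := fun k => ((k : ℝ) + 1) ^ (-(4/3) : ℝ) *
      ‖((k + 1 : ℕ) : ℤ) • (α : UnitAddCircle)‖ ^ (-(2/3) : ℝ) with hg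
    have hgs : Summable g := by
      have := ENNReal.summable_toReal hα
      refine this.congr fun k => ?_
      rw [ENNReal.toReal_mul, ENNReal.toReal_ofReal (by positivity), ← ENNReal.toReal_rpow,
        toReal_enorm]
    have hg0 : ∀ k, 0 ≤ g k := fun k => by positivity
    have hg2 : Summable (fun k => g k ^ (3/2 : ℝ)) := by
      refine Summable.of_norm_bounded_eventually_nat hgs ?_
      filter_upwards [hgs.tendsto_atTop_zero.eventually_le_const zero_lt_one] with k hk
      rw [Real.norm_of_nonneg (Real.rpow_nonneg (hg0 k) _)]
      calc g k ^ (3/2 : ℝ) ≤ g k ^ (1 : ℝ) :=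
            Real.rpow_le_rpow_of_exponent_ge' (hg0 k) hk (by norm_num) (by norm_num)
        _ = g k := Real.rpow_one _
    refine Summable.of_nonneg_of_le (fun k => by positivity) (fun k => ?_) hg2
    have hk := hpos k
    have e : g k ^ (3/2 : ℝ) = 1 / ((k : ℝ) + 1) ^ 2 *
        ‖((k + 1 : ℕ) : ℤ) • (α : UnitAddCircle)‖⁻¹ := by
      simp only [hg]
      rw [Real.mul_rpow (by positivity) (by positivity), ← Real.rpow_mul (by positivity),
        ← Real.rpow_mul (by positivity)]
      norm_num
      rw [Real.rpow_neg_one]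
      exact Or.inl rfl
    rw [e]
    gcongr
    linarith [hsin k]

lemma aux_dirichlet (φ θ : ℝ) (h : Real.sin θ ≠ 0) (N : ℕ) :
    |∑ n ∈ Finset.range N, Real.cos (φ + 2 * n * θ)| ≤ |Real.sin θ|⁻¹ := by
  have key : 2 * Real.sin θ * ∑ n ∈ Finset.range N, Real.cos (φ + 2 * n * θ) =
      Real.sin (φ + 2 * N * θ - θ) - Real.sin (φ - θ) := by
    induction N with
    | zero => simp
    | succ N ih =>
      rw [Finset.sum_range_succ, mul_add, ih]
      have : φ + 2 * ((N + 1 : ℕ) : ℝ) * θ - θ = (φ + 2 * N * θ) + θ := by push_cast; ring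
      rw [this, Real.sin_add (φ + 2 * N * θ) θ, Real.sin_sub (φ + 2 * N * θ) θ]
      ring
  have hb : |2 * Real.sin θ * ∑ n ∈ Finset.range N, Real.cos (φ + 2 * n * θ)| ≤ 2 := by
    rw [key]
    have h1 := Real.abs_sin_le_one (φ + 2 * N * θ - θ)
    have h2 := Real.abs_sin_le_one (φ - θ)
    exact (abs_sub _ _).trans (by linarith)
  rw [abs_mul, abs_mul, abs_two] at hb
  have hp : 0 < |Real.sin θ| := abs_pos.2 h
  rw [← one_div, le_div_iff₀ hp]
  linarith

/-- periodized second Bernoulli polynomial -/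
noncomputable def bTwo (y : ℝ) : ℝ := Int.fract y ^ 2 - Int.fract y + 6⁻¹

lemma bTwo_hasSum (y : ℝ) : HasSum (fun k : ℕ => 1 / ((k : ℝ) + 1) ^ 2 *
    Real.cos (2 * Real.pi * (k + 1) * y)) (Real.pi ^ 2 * bTwo y) := by
  have h := hasSum_one_div_nat_pow_mul_cos (k := 1) one_ne_zero
    (x := Int.fract y) ⟨Int.fract_nonneg y, (Int.fract_lt_one y).le⟩
  have e := bernoulliFun_two (Int.fract y)
  rw [bernoulliFun] at e
  simp only [mul_one] at h
  rw [e] at h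
  rw [← hasSum_nat_add_iff' 1] at h
  convert! h using 1
  · funext k
    have : 2 * Real.pi * ((k + 1 : ℕ) : ℝ) * Int.fract y =
        2 * Real.pi * (k + 1) * y - (((k + 1 : ℕ) : ℤ) * ⌊y⌋ : ℤ) * (2 * Real.pi) := by
      rw [← Int.self_sub_floor]; push_cast; ring
    rw [this, Real.cos_sub_int_mul_two_pi]
    push_cast
    rfl
  · rw [bTwo]
    norm_num [Nat.factorial]
    left
    ring

lemma bTwo_sum_bound : ∀ᵐ α : ℝ, ∃ C : ℝ, ∀ (y : ℝ) (N : ℕ),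
    |∑ n ∈ Finset.range N, bTwo (y + n * α)| ≤ C := by
  filter_upwards [aux_summable] with α hα
  obtain ⟨hne, hs⟩ := hα
  refine ⟨(∑' k : ℕ, 1 / ((k : ℝ) + 1) ^ 2 * |Real.sin (Real.pi * (k + 1) * α)|⁻¹) /
    Real.pi ^ 2, fun y N => ?_⟩
  have h := hasSum_sum (s := Finset.range N) (fun n _ => bTwo_hasSum (y + n * α))
  rw [← Finset.mul_sum] at h
  have hb := h.norm_le_of_bounded hs.hasSum (fun k => by
    rw [← Finset.mul_sum, norm_mul, Real.norm_of_nonneg (by positivity)]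
    gcongr
    have := aux_dirichlet (2 * Real.pi * (k + 1) * y) (Real.pi * (k + 1) * α) (hne k) N
    rw [Real.norm_eq_abs]
    convert! this using 4
    ring)
  rw [Real.norm_eq_abs, abs_mul, abs_of_pos (by positivity)] at hb
  rw [le_div_iff₀ (by positivity)]
  linarith

lemma bTwo_continuous : Continuous bTwo := by
  have := ContinuousOn.comp_fract'' (f := fun x : ℝ => x ^ 2 - x + 6⁻¹)
    (by fun_prop) (by norm_num)
  exact this

lemma bTwo_hasDerivAt (y : ℝ) (hy : y ∉ Set.range ((↑) : ℤ → ℝ)) :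
    HasDerivAt bTwo (2 * (Int.fract y - 1/2)) y := by
  have h1 : HasDerivAt (fun x : ℝ => (x - ⌊y⌋) ^ 2 - (x - ⌊y⌋) + 6⁻¹)
      (2 * (Int.fract y - 1/2)) y := by
    have hd : HasDerivAt (fun x : ℝ => x - ⌊y⌋) 1 y := (hasDerivAt_id y).sub_const _
    have := ((hd.pow 2).sub hd).add_const (6⁻¹ : ℝ)
    convert! this using 1
    rw [Int.self_sub_floor]; norm_num; ring
  refine h1.congr_of_eventuallyEq ?_
  have hlt : (⌊y⌋ : ℝ) < y := lt_of_le_of_ne (Int.floor_le y) (fun h => hy ⟨_, h⟩)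
  filter_upwards [Ioo_mem_nhds hlt (Int.lt_floor_add_one y)] with x hx
  have : ⌊x⌋ = ⌊y⌋ := Int.floor_eq_iff.2 ⟨hx.1.le, hx.2⟩
  rw [bTwo, ← Int.self_sub_floor, this]

lemma aux_ii {f : ℝ → ℝ} (hf : Measurable f) (hb : ∀ x, |f x| ≤ 1) (a b : ℝ) :
    IntervalIntegrable f volume a b := by
  refine (intervalIntegrable_const (c := (1 : ℝ))).mono_fun hf.aestronglyMeasurable ?_
  exact Filter.Eventually.of_forall fun x => by simpa using hb x

lemma aux_fract_bd (y : ℝ) : |Int.fract y - 1/2| ≤ 1 := by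
  rw [abs_le]; constructor <;> linarith [Int.fract_nonneg y, Int.fract_lt_one y]

lemma int_fract (p q : ℝ) : ∫ y in p..q, (Int.fract y - 1/2) = (bTwo q - bTwo p) / 2 := by
  have := integral_eq_of_hasDerivAt_off_countable bTwo (fun y => 2 * (Int.fract y - 1/2))
    (a := p) (b := q) (Set.countable_range ((↑) : ℤ → ℝ)) bTwo_continuous.continuousOn
    (fun x hx => bTwo_hasDerivAt x hx.2)
    ((aux_ii (measurable_fract.sub_const _) aux_fract_bd p q).const_mul 2)
  rw [intervalIntegral.integral_const_mul] at this
  linarith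

lemma int_fract_lin (α : ℝ) (hα : 0 < α) (c a b : ℝ) :
    ∫ s in a..b, (Int.fract (c + α * s) - 1/2) =
      (bTwo (c + α * b) - bTwo (c + α * a)) / (2 * α) := by
  rw [intervalIntegral.integral_comp_add_mul (fun y => Int.fract y - 1/2) hα.ne', int_fract,
    smul_eq_mul]
  field_simp

lemma aux_indicator (v₁ v₂ y : ℝ) (h0 : 0 ≤ v₁) (h1 : v₁ ≤ v₂) (h2 : v₂ ≤ 1) :
    Set.indicator (Set.Ico v₁ v₂) (fun _ => (1:ℝ)) (Int.fract y) =
      (v₂ - v₁) + ((Int.fract (y - v₂) - 1/2) - (Int.fract (y - v₁) - 1/2)) := by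
  have key : ∀ v : ℝ, 0 ≤ v → v ≤ 1 → Int.fract (y - v) =
      if v ≤ Int.fract y then Int.fract y - v else Int.fract y - v + 1 := by
    intro v hv0 hv1
    have := Int.fract_nonneg y
    have := Int.fract_lt_one y
    split_ifs with h
    · rw [Int.fract_eq_iff]
      refine ⟨by linarith, by linarith, ⌊y⌋, ?_⟩
      rw [← Int.self_sub_floor]; ring
    · rw [Int.fract_eq_iff]
      refine ⟨by linarith, by linarith, ⌊y⌋ - 1, ?_⟩
      rw [← Int.self_sub_floor]; push_cast; ring
  rw [key v₁ h0 (h1.trans h2), key v₂ (h0.trans h1) h2]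
  by_cases ha : v₁ ≤ Int.fract y <;> by_cases hb : v₂ ≤ Int.fract y
  · rw [Set.indicator_of_notMem (fun h => not_lt.2 hb h.2), if_pos ha, if_pos hb]; ring
  · rw [Set.indicator_of_mem (Set.mem_Ico.2 ⟨ha, not_le.1 hb⟩), if_pos ha, if_neg hb]; ring
  · exact absurd (h1.trans hb) ha
  · rw [Set.indicator_of_notMem (fun h => ha h.1), if_neg ha, if_neg hb]; ring

lemma aux_inner (α : ℝ) (hα : 0 < α) (w u₁ u₂ v₁ v₂ : ℝ)
    (h0 : 0 ≤ v₁) (h1 : v₁ ≤ v₂) (h2 : v₂ ≤ 1) :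
    ∫ s in u₁..u₂, Set.indicator (Set.Ico v₁ v₂) (fun _ => (1:ℝ)) (Int.fract (w + α * s)) =
      (u₂ - u₁) * (v₂ - v₁) + ((bTwo (w - v₂ + α * u₂) - bTwo (w - v₂ + α * u₁)) -
        (bTwo (w - v₁ + α * u₂) - bTwo (w - v₁ + α * u₁))) / (2 * α) := by
  have hi : ∀ v : ℝ, IntervalIntegrable (fun s => Int.fract (w - v + α * s) - 1/2)
      volume u₁ u₂ := fun v => aux_ii (by fun_prop) (fun x => aux_fract_bd _) _ _
  have e : ∀ s : ℝ, Set.indicator (Set.Ico v₁ v₂) (fun _ => (1:ℝ)) (Int.fract (w + α * s)) =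
      (v₂ - v₁) + ((Int.fract (w - v₂ + α * s) - 1/2) - (Int.fract (w - v₁ + α * s) - 1/2)) := by
    intro s
    rw [aux_indicator v₁ v₂ _ h0 h1 h2]
    congr 4 <;> ring_nf
  simp_rw [e]
  rw [intervalIntegral.integral_add intervalIntegrable_const ((hi v₂).sub (hi v₁)),
    intervalIntegral.integral_sub (hi v₂) (hi v₁), int_fract_lin α hα, int_fract_lin α hα,
    intervalIntegral.integral_const, smul_eq_mul]
  ring

lemma aux_period (α z u₁ u₂ v₁ v₂ : ℝ) (hu0 : 0 ≤ u₁) (hu1 : u₁ ≤ u₂) (hu2 : u₂ ≤ 1) (n : ℕ) :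
    ∫ s in (n : ℝ)..((n + 1 : ℕ) : ℝ), Set.indicator (Set.Ico u₁ u₂ ×ˢ Set.Ico v₁ v₂)
      (fun _ => (1:ℝ)) (Int.fract s, Int.fract (z + α * s)) =
    ∫ s in u₁..u₂, Set.indicator (Set.Ico v₁ v₂) (fun _ => (1:ℝ))
      (Int.fract (z + n * α + α * s)) := by
  have h := intervalIntegral.integral_comp_add_left (a := 0) (b := 1)
    (fun s : ℝ => Set.indicator (Set.Ico u₁ u₂ ×ˢ Set.Ico v₁ v₂)
      (fun _ => (1:ℝ)) (Int.fract s, Int.fract (z + α * s))) (n : ℝ)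
  rw [add_zero] at h
  push_cast
  rw [← h, intervalIntegral.integral_of_le zero_le_one, intervalIntegral.integral_of_le hu1,
    ← integral_Ico_eq_integral_Ioc, ← integral_Ico_eq_integral_Ioc]
  have hsub : Set.Ico u₁ u₂ = Set.Ico (0:ℝ) 1 ∩ Set.Ico u₁ u₂ := by
    rw [Set.inter_eq_right.2]
    exact Set.Ico_subset_Ico hu0 hu2
  conv_rhs => rw [hsub]
  rw [← setIntegral_indicator measurableSet_Ico]
  refine setIntegral_congr_fun measurableSet_Ico fun s hs => ?_
  have e1 : Int.fract ((n : ℝ) + s) = s := by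
    rw [Int.fract_natCast_add, Int.fract_eq_self]; exact hs
  have e2 : z + α * (n + s) = z + n * α + α * s := by ring
  simp only [e1, e2, Set.indicator, Set.mem_prod]
  split_ifs <;> tauto

theorem statement8 :
    ∀ᵐ α : ℝ ∂volume, 0 < α →
      ∃ C : ℝ, ∀ x₁ x₂ : ℝ, x₁ ∈ Set.Ico (0:ℝ) 1 → x₂ ∈ Set.Ico (0:ℝ) 1 →
        ∀ u₁ u₂ v₁ v₂ : ℝ, 0 ≤ u₁ → u₁ ≤ u₂ → u₂ ≤ 1 →
          0 ≤ v₁ → v₁ ≤ v₂ → v₂ ≤ 1 →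
          ∀ T : ℝ, 0 < T →
            |rotDelta (Set.Ico u₁ u₂ ×ˢ Set.Ico v₁ v₂) α x₁ x₂ T| ≤ C := by
  filter_upwards [bTwo_sum_bound] with α hC hα
  obtain ⟨C, hC⟩ := hC
  refine ⟨4 * C / (2 * α) + 4, ?_⟩
  intro x₁ x₂ hx₁ _ u₁ u₂ v₁ v₂ hu0 hu1 hu2 hv0 hv1 hv2 T hT
  set z := x₂ - α * x₁ with hz
  set G : ℝ → ℝ := fun s => Set.indicator (Set.Ico u₁ u₂ ×ˢ Set.Ico v₁ v₂)
      (fun _ => (1:ℝ)) (Int.fract s, Int.fract (z + α * s)) with hG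
  have hGm : Measurable G := by
    have h1 : Measurable (fun s : ℝ => (Int.fract s, Int.fract (z + α * s))) := by fun_prop
    exact (measurable_const.indicator (measurableSet_Ico.prod measurableSet_Ico)).comp h1
  have hGb : ∀ s, |G s| ≤ 1 := by
    intro s
    simp only [hG, Set.indicator]
    split_ifs <;> simp
  have hGi : ∀ a b, IntervalIntegrable G volume a b := aux_ii hGm hGb
  have hGn : ∀ a b, |∫ s in a..b, G s| ≤ |b - a| := by
    intro a b
    have := intervalIntegral.norm_integral_le_of_norm_le_const (a := a) (b := b) (C := 1)
      (f := G) (fun x _ => hGb x)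
    simpa using this
  have hvol : (volume (Set.Ico u₁ u₂ ×ˢ Set.Ico v₁ v₂)).toReal = (u₂ - u₁) * (v₂ - v₁) := by
    rw [Measure.volume_eq_prod, Measure.prod_prod, Real.volume_Ico, Real.volume_Ico,
      ENNReal.toReal_mul, ENNReal.toReal_ofReal (by linarith), ENNReal.toReal_ofReal (by linarith)]
  have hshift : (∫ t in (0:ℝ)..T, Set.indicator (Set.Ico u₁ u₂ ×ˢ Set.Ico v₁ v₂)
      (fun _ => (1:ℝ)) (Int.fract (x₁ + t), Int.fract (x₂ + α * t))) =
      ∫ s in x₁..(x₁ + T), G s := by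
    have h := intervalIntegral.integral_comp_add_left (a := 0) (b := T) G x₁
    rw [add_zero] at h
    rw [← h]
    congr 1
    funext t
    simp only [hG]
    congr 3
    rw [hz]; ring
  rw [rotDelta, hvol, hshift]
  set N := ⌊T⌋₊
  have hN1 : (N : ℝ) ≤ T := Nat.floor_le hT.le
  have hN2 : T < N + 1 := Nat.lt_floor_add_one T
  have hsplit : ∫ s in x₁..(x₁ + T), G s =
      (∫ s in (0:ℝ)..N, G s) - (∫ s in (0:ℝ)..x₁, G s) + ∫ s in (N:ℝ)..(x₁ + T), G s := by
    have e1 := intervalIntegral.integral_add_adjacent_intervals (hGi 0 x₁) (hGi x₁ (x₁ + T))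
    have e2 := intervalIntegral.integral_add_adjacent_intervals (hGi 0 N) (hGi N (x₁ + T))
    linarith
  have hB : ∀ c : ℝ, |∑ n ∈ Finset.range N, bTwo (z + n * α - c)| ≤ C := by
    intro c
    have := hC (z - c) N
    convert! this using 4
    ring
  have hmain : ∫ s in (0:ℝ)..N, G s = N * ((u₂ - u₁) * (v₂ - v₁)) +
      (((∑ n ∈ Finset.range N, bTwo (z + n * α - (v₂ - α * u₂)))
      - ∑ n ∈ Finset.range N, bTwo (z + n * α - (v₂ - α * u₁)))
      - ((∑ n ∈ Finset.range N, bTwo (z + n * α - (v₁ - α * u₂)))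
      - ∑ n ∈ Finset.range N, bTwo (z + n * α - (v₁ - α * u₁)))) / (2 * α) := by
    have h := intervalIntegral.sum_integral_adjacent_intervals (f := G) (μ := volume)
      (a := fun n : ℕ => (n : ℝ)) (n := N) (fun k _ => hGi _ _)
    simp only [Nat.cast_zero] at h
    rw [← h]
    have h2 : ∀ n : ℕ, ∫ s in (n : ℝ)..((n + 1 : ℕ) : ℝ), G s = (u₂ - u₁) * (v₂ - v₁) +
        ((bTwo (z + n * α - (v₂ - α * u₂)) - bTwo (z + n * α - (v₂ - α * u₁))) -
        (bTwo (z + n * α - (v₁ - α * u₂)) - bTwo (z + n * α - (v₁ - α * u₁)))) / (2 * α) := by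
      intro n
      rw [aux_period α z u₁ u₂ v₁ v₂ hu0 hu1 hu2 n, aux_inner α hα _ _ _ _ _ hv0 hv1 hv2]
      simp only [sub_sub_eq_add_sub, add_sub_right_comm]
    rw [Finset.sum_congr rfl fun n _ => h2 n, Finset.sum_add_distrib, ← Finset.sum_div]
    simp only [Finset.sum_sub_distrib, Finset.sum_const, Finset.card_range, nsmul_eq_mul]
  rw [hsplit, hmain]
  have b1 := abs_le.1 (hB (v₂ - α * u₂))
  have b2 := abs_le.1 (hB (v₂ - α * u₁))
  have b3 := abs_le.1 (hB (v₁ - α * u₂))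
  have b4 := abs_le.1 (hB (v₁ - α * u₁))
  set A := (((∑ n ∈ Finset.range N, bTwo (z + n * α - (v₂ - α * u₂)))
      - ∑ n ∈ Finset.range N, bTwo (z + n * α - (v₂ - α * u₁)))
      - ((∑ n ∈ Finset.range N, bTwo (z + n * α - (v₁ - α * u₂)))
      - ∑ n ∈ Finset.range N, bTwo (z + n * α - (v₁ - α * u₁)))) with hA
  have hAb : |A / (2 * α)| ≤ 4 * C / (2 * α) := by
    rw [abs_div, abs_of_pos (by positivity : 0 < 2 * α)]
    gcongr
    rw [abs_le]
    constructor <;> linarith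
  have c1 := hGn 0 x₁
  have c2 := hGn N (x₁ + T)
  rw [abs_of_nonneg (by linarith [hx₁.1] : 0 ≤ x₁ - 0)] at c1
  rw [abs_of_nonneg (by linarith [hx₁.1] : 0 ≤ x₁ + T - N)] at c2
  have hl0 : 0 ≤ (u₂ - u₁) * (v₂ - v₁) := mul_nonneg (by linarith) (by linarith)
  have hl1 : (u₂ - u₁) * (v₂ - v₁) ≤ 1 := mul_le_one₀ (by linarith) (by linarith) (by linarith)
  have hl2 : 0 ≤ (T - N) * ((u₂ - u₁) * (v₂ - v₁)) := mul_nonneg (by linarith) hl0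
  have hl3 : (T - N) * ((u₂ - u₁) * (v₂ - v₁)) ≤ 1 := mul_le_one₀ (by linarith) hl0 hl1
  have d1 := abs_le.1 c1
  have d2 := abs_le.1 c2
  have d3 := abs_le.1 hAb
  have hx := hx₁.2
  rw [abs_le]
  constructor <;> linarith
end

section
/- For almost every α > 0 (with respect to Lebesgue measure) and every starting point x = (x₁, x₂) ∈ [0,1)², there exists a constant C = C(α) such that for every disc S contained in [0,1)² and every T > 0 one has |∫₀^T χ_S({x₁+t}, {x₂+αt}) dt − T·λ(S)| ≤ C; that is, the discrepancy sup over discs of this quantity is O(1). -/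
open MeasureTheory

/-- The closed Euclidean disc with center `c` and radius `r`. -/
def closedDisc (c : ℝ × ℝ) (r : ℝ) : Set (ℝ × ℝ) :=
  {y : ℝ × ℝ | (y.1 - c.1) ^ 2 + (y.2 - c.2) ^ 2 ≤ r ^ 2}


lemma lintegral_fin : ∫⁻ θ : UnitAddCircle, ENNReal.ofReal (‖fourier 1 θ - 1‖ ^ (-(4/5) : ℝ)) < ⊤ := by
  rw [← UnitAddCircle.lintegral_preimage (-(1/2))]
  have hI : IntegrableOn (fun x : ℝ => |x| ^ (-(4/5):ℝ)) (Set.Ioc (-(1/2)) (-(1/2)+1)) := by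
    have h1 : IntervalIntegrable (fun x : ℝ => |x| ^ (-(4/5):ℝ)) volume 0 (1/2) := by
      refine (intervalIntegral.intervalIntegrable_rpow' (r := -(4/5)) (by norm_num)).congr ?_
      intro x hx
      rw [Set.uIoc_of_le (by norm_num)] at hx
      simp [abs_of_pos hx.1]
    have h2 : IntervalIntegrable (fun x : ℝ => |x| ^ (-(4/5):ℝ)) volume (-(1/2)) 0 := by
      have := ((IntervalIntegrable.iff_comp_neg (by simp)).mp h1).symm
      simpa using this
    have h3 := h2.trans h1
    rw [intervalIntegrable_iff_integrableOn_Ioc_of_le (by norm_num)] at h3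
    have e : (-(1/2) + 1 : ℝ) = 1/2 := by norm_num
    rw [e]; exact h3
  refine lt_of_le_of_lt ?_ hI.2
  refine setLIntegral_mono_ae' measurableSet_Ioc ?_
  filter_upwards with x hx
  rw [Real.enorm_eq_ofReal (by positivity)]
  apply ENNReal.ofReal_le_ofReal
  by_cases hx0 : x = 0
  · subst hx0; simp
  have hx' : |x| ≤ 1/2 := abs_le.mpr ⟨hx.1.le, by linarith [hx.2]⟩
  apply Real.rpow_le_rpow_of_nonpos (by positivity) _ (by norm_num)
  rw [fourier_coe_apply]
  have e : (2 * (Real.pi:ℂ) * Complex.I * ((1:ℤ):ℂ) * (x:ℂ) / ((1:ℝ):ℂ)) = Complex.I * ((2 * Real.pi * x : ℝ) : ℂ) := by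
    push_cast; ring
  rw [e, Complex.norm_exp_I_mul_ofReal_sub_one]
  have := Real.mul_abs_le_abs_sin (x := Real.pi * x) (by
    rw [abs_mul, abs_of_pos Real.pi_pos]; nlinarith [Real.pi_pos])
  rw [abs_mul, abs_of_pos Real.pi_pos] at this
  rw [Real.norm_eq_abs, abs_mul]
  have e2 : 2 * Real.pi * x / 2 = Real.pi * x := by ring
  have e3 : 2 / Real.pi * (Real.pi * |x|) = 2 * |x| := by field_simp
  rw [e2]; rw [e3] at this
  norm_num
  linarith [abs_nonneg x]

lemma ae_circle : ∀ᵐ θ : UnitAddCircle,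
    Summable (fun n : ℤ => (|(n:ℝ)| ^ (-(3/2) : ℝ) / ‖fourier n θ - 1‖)) := by
  set F : UnitAddCircle → ENNReal := fun θ => ENNReal.ofReal (‖fourier 1 θ - 1‖ ^ (-(4/5) : ℝ)) with hF
  have hFm : Measurable F := by
    apply ENNReal.measurable_ofReal.comp
    have : Measurable fun θ : UnitAddCircle => ‖fourier 1 θ - 1‖ := by
      apply Continuous.measurable
      fun_prop
    exact this.pow_const _
  have hFn : ∀ n : ℤ, n ≠ 0 → ∫⁻ θ, F (n • θ) = ∫⁻ θ, F θ := by
    intro n hn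
    exact (Measure.measurePreserving_zsmul volume hn).lintegral_comp hFm
  have hmz : ∀ n : ℤ, Measurable (fun θ : UnitAddCircle => n • θ) := fun n =>
    (continuous_zsmul n).measurable
  have hsum : ∫⁻ θ, ∑' n : ℤ, ENNReal.ofReal (|(n:ℝ)| ^ (-(6/5) : ℝ)) * F (n • θ) ≠ ⊤ := by
    have hmm : ∀ n : ℤ, Measurable (fun θ => ENNReal.ofReal (|(n:ℝ)| ^ (-(6/5) : ℝ)) * F (n • θ)) :=
      fun n => (hFm.comp (hmz n)).const_mul _
    rw [lintegral_tsum (fun n => (hmm n).aemeasurable)]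
    have : ∀ n : ℤ, ∫⁻ θ, ENNReal.ofReal (|(n:ℝ)| ^ (-(6/5) : ℝ)) * F (n • θ) =
        ENNReal.ofReal (|(n:ℝ)| ^ (-(6/5) : ℝ)) * ∫⁻ θ, F θ := by
      intro n
      have hm1 : Measurable (fun θ => F (n • θ)) := hFm.comp (hmz n)
      rw [lintegral_const_mul _ hm1]
      by_cases hn : n = 0
      · subst hn; simp [Real.zero_rpow]
      · rw [hFn n hn]
    simp_rw [this]
    rw [ENNReal.tsum_mul_right]
    refine ENNReal.mul_ne_top ?_ lintegral_fin.ne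
    rw [← ENNReal.ofReal_tsum_of_nonneg (fun n => by positivity)
      (Real.summable_abs_int_rpow (by norm_num))]
    exact ENNReal.ofReal_ne_top
  have hae := ae_lt_top (Measurable.tsum (fun n : ℤ => ((hFm.comp (hmz n)).const_mul (ENNReal.ofReal (|(n:ℝ)| ^ (-(6/5) : ℝ)))))) hsum
  filter_upwards [hae] with θ hθ
  have hs : Summable (fun n : ℤ => (|(n:ℝ)| ^ (-(3/2) : ℝ) / ‖fourier n θ - 1‖) ^ (4/5 : ℝ)) := by
    have h1 := ENNReal.summable_toReal hθ.ne
    refine h1.congr ?_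
    intro n
    have e1 : (fourier 1 (n • θ) : ℂ) = fourier n θ := by
      simp [fourier_apply]
    simp only [hF, Function.comp, e1]
    rw [ENNReal.toReal_mul, ENNReal.toReal_ofReal (by positivity), ENNReal.toReal_ofReal (by positivity),
      Real.div_rpow (by positivity) (by positivity), ← Real.rpow_mul (by positivity),
      Real.rpow_neg (norm_nonneg _) (4/5), div_eq_mul_inv]
    norm_num
    simp only [div_eq_mul_inv]
  refine Summable.of_norm_bounded_eventually hs ?_
  have ht := hs.tendsto_cofinite_zero
  filter_upwards [ht.eventually (gt_mem_nhds (zero_lt_one))] with n hn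
  set a := (|(n:ℝ)| ^ (-(3/2) : ℝ) / ‖fourier n θ - 1‖)
  have ha : 0 ≤ a := by positivity
  rw [Real.norm_of_nonneg ha]
  have ha1 : a ≤ 1 := by
    by_contra h
    push Not at h
    exact absurd hn (not_lt.mpr (Real.one_le_rpow h.le (by norm_num)))
  exact Real.self_le_rpow_of_le_one ha ha1 (by norm_num)

lemma ae_real : ∀ᵐ α : ℝ,
    Summable (fun n : ℤ => (|(n:ℝ)| ^ (-(3/2) : ℝ) / ‖fourier n (α : UnitAddCircle) - 1‖)) := by
  have h : ∀ k : ℤ, ∀ᵐ α : ℝ ∂(volume.restrict (Set.Ioc (k:ℝ) (k+1))),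
      Summable (fun n : ℤ => (|(n:ℝ)| ^ (-(3/2) : ℝ) / ‖fourier n (α : UnitAddCircle) - 1‖)) := by
    intro k
    exact (UnitAddCircle.measurePreserving_mk (k:ℝ)).quasiMeasurePreserving.ae ae_circle
  have h2 := (ae_restrict_iUnion_iff (μ := volume) (fun k : ℤ => Set.Ioc (k:ℝ) (k+1))
    (fun α : ℝ => Summable (fun n : ℤ => (|(n:ℝ)| ^ (-(3/2) : ℝ) / ‖fourier n (α : UnitAddCircle) - 1‖)))).mpr h
  rwa [iUnion_Ioc_intCast, Measure.restrict_univ] at h2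

lemma four_bound (f : ℝ → ℂ) (hf : Integrable f) (w : ℝ) (hw : w ≠ 0) (δ : ℝ) (hδ : δ = 1 / (2 * w)) :
    ‖FourierTransform.fourier f w‖ ≤ 1/4 * ∫ y, ‖f (y + δ) + f (y - δ) - 2 * f y‖ := by
  have key : ∀ g : ℝ → ℂ, FourierTransform.fourier (fun y => g (y + δ)) w = - FourierTransform.fourier g w := by
    intro g
    rw [Real.fourier_real_eq_integral_exp_smul, Real.fourier_real_eq_integral_exp_smul]
    rw [← integral_add_right_eq_self (fun v => Complex.exp (↑(-2 * Real.pi * v * w) * Complex.I) • g v) δ,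
      ← integral_neg]
    congr 1
    ext v
    have : ((-2 * Real.pi * (v + δ) * w : ℝ) : ℂ) * Complex.I =
        ((-2 * Real.pi * v * w : ℝ) : ℂ) * Complex.I - Real.pi * Complex.I := by
      have : -2 * Real.pi * (v + δ) * w = -2 * Real.pi * v * w - Real.pi := by
        rw [hδ]; field_simp; ring
      rw [this]; push_cast; ring
    rw [this, Complex.exp_sub, Complex.exp_pi_mul_I]
    simp only [smul_eq_mul]
    ring
  have k1 := key f
  have k2 := key (fun y => f (y - δ))
  simp only [add_sub_cancel_right] at k2
  have i1 : Integrable (fun y => f (y + δ)) := hf.comp_add_right δ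
  have i2 : Integrable (fun y => f (y - δ)) := hf.comp_sub_right δ
  have k3 : FourierTransform.fourier (fun y => f (y + δ) + f (y - δ) - 2 * f y) w = -4 * FourierTransform.fourier f w := by
    have e : (fun v : ℝ => f v) = f := rfl
    have k2' : FourierTransform.fourier (fun y => f (y - δ)) w = - FourierTransform.fourier f w := by
      rw [← neg_eq_iff_eq_neg, ← k2]
    rw [Real.fourier_real_eq_integral_exp_smul] at k1 k2' ⊢
    have hi : ∀ g : ℝ → ℂ, Integrable g → Integrable (fun v => Complex.exp (↑(-2 * Real.pi * v * w) * Complex.I) • g v) := by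
      intro g hg
      refine (integrable_norm_iff ?_).mp ?_
      · exact AEStronglyMeasurable.smul
          (Continuous.aestronglyMeasurable (f := fun v : ℝ => Complex.exp (↑(-2 * Real.pi * v * w) * Complex.I)) (by fun_prop)) hg.1
      · simp only [norm_smul, Complex.norm_exp_ofReal_mul_I, one_mul]
        exact hg.norm
    calc _ = ∫ v, ((Complex.exp (↑(-2 * Real.pi * v * w) * Complex.I) • f (v + δ)
            + Complex.exp (↑(-2 * Real.pi * v * w) * Complex.I) • f (v - δ))
            - 2 * (Complex.exp (↑(-2 * Real.pi * v * w) * Complex.I) • f v)) := by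
          congr 1; ext v; simp only [smul_eq_mul]; ring
      _ = _ := by
          have hii : Integrable (fun v => Complex.exp (↑(-2 * Real.pi * v * w) * Complex.I) • f (v + δ)
            + Complex.exp (↑(-2 * Real.pi * v * w) * Complex.I) • f (v - δ)) := (hi _ i1).add (hi _ i2)
          rw [integral_sub hii ((hi _ hf).const_mul _),
            integral_add (hi _ i1) (hi _ i2), k1, k2', integral_const_mul,
            ← Real.fourier_real_eq_integral_exp_smul]
          ring
  have k4 : ‖FourierTransform.fourier (fun y => f (y + δ) + f (y - δ) - 2 * f y) w‖ ≤
      ∫ y, ‖f (y + δ) + f (y - δ) - 2 * f y‖ := by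
    rw [Real.fourier_real_eq_integral_exp_smul]
    refine (norm_integral_le_integral_norm _).trans_eq ?_
    simp only [norm_smul, Complex.norm_exp_ofReal_mul_I, one_mul]
  rw [k3, norm_mul] at k4
  norm_num at k4 ⊢
  linarith

lemma pt_bound (R δ y : ℝ) (hR : 0 ≤ R) (hδ : 0 < δ) :
    √(R^2 - (y+δ)^2) + √(R^2 - (y-δ)^2) - 2 * √(R^2 - y^2) ≤
      (4 * √(R*δ)) * ((Set.Icc (R-δ) (R+δ)).indicator (fun _ => 1) y +
        (Set.Icc (-R-δ) (-R+δ)).indicator (fun _ => 1) y) := by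
  have hrhs : 0 ≤ (4 * √(R*δ)) * ((Set.Icc (R-δ) (R+δ)).indicator (fun _ => (1:ℝ)) y +
        (Set.Icc (-R-δ) (-R+δ)).indicator (fun _ => (1:ℝ)) y) := by
    apply mul_nonneg (by positivity)
    apply add_nonneg <;> exact Set.indicator_nonneg (fun _ _ => zero_le_one) _
  by_cases h1 : |y| ≤ R - δ
  · refine le_trans ?_ hrhs
    obtain ⟨h1a, h1b⟩ := abs_le.mp h1
    have p1 : 0 ≤ R^2 - (y+δ)^2 := by nlinarith
    have p2 : 0 ≤ R^2 - (y-δ)^2 := by nlinarith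
    have p3 : 0 ≤ R^2 - y^2 := by nlinarith
    have s1 := Real.sq_sqrt p1
    have s2 := Real.sq_sqrt p2
    have s3 := Real.sq_sqrt p3
    have : √(R^2 - (y+δ)^2) + √(R^2 - (y-δ)^2) ≤ 2 * √(R^2 - y^2) := by
      apply le_of_sq_le_sq _ (by positivity)
      nlinarith [sq_nonneg (√(R^2 - (y+δ)^2) - √(R^2 - (y-δ)^2)), sq_nonneg δ]
    linarith
  by_cases h2 : |y| ≤ R + δ
  · have hind : (1:ℝ) ≤ ((Set.Icc (R-δ) (R+δ)).indicator (fun _ => (1:ℝ)) y +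
        (Set.Icc (-R-δ) (-R+δ)).indicator (fun _ => (1:ℝ)) y) := by
      have n1 : 0 ≤ (Set.Icc (R-δ) (R+δ)).indicator (fun _ => (1:ℝ)) y := Set.indicator_nonneg (fun _ _ => zero_le_one) _
      have n2 : 0 ≤ (Set.Icc (-R-δ) (-R+δ)).indicator (fun _ => (1:ℝ)) y := Set.indicator_nonneg (fun _ _ => zero_le_one) _
      rcases le_total 0 y with hy | hy
      · rw [abs_of_nonneg hy] at h1 h2
        rw [Set.indicator_of_mem (show y ∈ Set.Icc (R-δ) (R+δ) from ⟨by linarith, h2⟩)]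
        linarith
      · rw [abs_of_nonpos hy] at h1 h2
        rw [Set.indicator_of_mem (show y ∈ Set.Icc (-R-δ) (-R+δ) from ⟨by linarith, by linarith⟩)]
        linarith
    have hm : ∀ z : ℝ, R - 2 * δ ≤ |z| → √(R^2 - z^2) ≤ 2 * √(R*δ) := by
      intro z hz
      have : 2 * √(R*δ) = √(4 * (R * δ)) := by
        rw [Real.sqrt_mul (by norm_num) (R * δ), show (4:ℝ) = 2^2 by norm_num, Real.sqrt_sq (by norm_num)]
      rw [this]
      apply Real.sqrt_le_sqrt
      rw [← sq_abs z]
      rcases le_total (2*δ) R with h | h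
      · nlinarith [abs_nonneg z, sq_nonneg δ]
      · nlinarith [abs_nonneg z]
    push Not at h1
    have a1 := hm (y + δ) (by
      have := abs_sub_abs_le_abs_sub y (-δ)
      rw [sub_neg_eq_add, abs_neg, abs_of_pos hδ] at this; linarith)
    have a2 := hm (y - δ) (by
      have := abs_sub_abs_le_abs_sub y δ
      rw [abs_of_pos hδ] at this; linarith)
    have : (4 * √(R*δ)) * 1 ≤ (4 * √(R*δ)) * ((Set.Icc (R-δ) (R+δ)).indicator (fun _ => (1:ℝ)) y +
        (Set.Icc (-R-δ) (-R+δ)).indicator (fun _ => (1:ℝ)) y) :=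
      mul_le_mul_of_nonneg_left hind (by positivity)
    linarith [Real.sqrt_nonneg (R^2 - y^2)]
  · refine le_trans ?_ hrhs
    push Not at h2
    have hz : ∀ z : ℝ, R ≤ |z| → √(R^2 - z^2) = 0 := by
      intro z hz
      apply Real.sqrt_eq_zero_of_nonpos
      rw [← sq_abs z]; nlinarith
    rw [hz (y+δ), hz (y-δ), zero_add]
    · linarith [Real.sqrt_nonneg (R^2 - y^2)]
    · have := abs_sub_abs_le_abs_sub y δ
      rw [abs_of_pos hδ] at this; linarith
    · have := abs_sub_abs_le_abs_sub y (-δ)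
      rw [sub_neg_eq_add, abs_neg, abs_of_pos hδ] at this; linarith

lemma q_supp (R : ℝ) : HasCompactSupport (fun y : ℝ => √(R^2 - y^2)) := by
  apply HasCompactSupport.intro (isCompact_Icc (a := -|R|) (b := |R|))
  intro y hy
  apply Real.sqrt_eq_zero_of_nonpos
  rw [Set.mem_Icc, ← abs_le, not_le] at hy
  have := sq_lt_sq.mpr hy
  linarith

lemma q_int (R : ℝ) : Integrable (fun y : ℝ => √(R^2 - y^2)) :=
  Continuous.integrable_of_hasCompactSupport (by fun_prop) (q_supp R)

lemma int_bound (R δ : ℝ) (hR : 0 ≤ R) (hδ : 0 < δ) :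
    ∫ y, |√(R^2 - (y+δ)^2) + √(R^2 - (y-δ)^2) - 2 * √(R^2 - y^2)| ≤ 32 * √(R*δ) * δ := by
  have i0 := q_int R
  have i1 := i0.comp_add_right δ
  have i2 := i0.comp_sub_right δ
  have id : Integrable (fun y => √(R^2 - (y+δ)^2) + √(R^2 - (y-δ)^2) - 2 * √(R^2 - y^2)) :=
    (i1.add i2).sub (i0.const_mul 2)
  have j1 : Integrable ((Set.Icc (R-δ) (R+δ)).indicator (fun _ => (1:ℝ))) :=
    (integrable_indicator_iff measurableSet_Icc).mpr (integrableOn_const (by simp) (by simp))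
  have j2 : Integrable ((Set.Icc (-R-δ) (-R+δ)).indicator (fun _ => (1:ℝ))) :=
    (integrable_indicator_iff measurableSet_Icc).mpr (integrableOn_const (by simp) (by simp))
  have i12 : Integrable (fun y => √(R^2 - (y+δ)^2) + √(R^2 - (y-δ)^2)) := i1.add i2
  have j12 : Integrable (fun y => (Set.Icc (R-δ) (R+δ)).indicator (fun _ => (1:ℝ)) y +
        (Set.Icc (-R-δ) (-R+δ)).indicator (fun _ => (1:ℝ)) y) := j1.add j2
  have hd0 : ∫ y, (√(R^2 - (y+δ)^2) + √(R^2 - (y-δ)^2) - 2 * √(R^2 - y^2)) = 0 := by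
    rw [integral_sub i12 (i0.const_mul 2), integral_add i1 i2, integral_const_mul,
      integral_add_right_eq_self (fun y => √(R^2 - y^2)) δ,
      integral_sub_right_eq_self (fun y => √(R^2 - y^2)) δ]
    ring
  calc _ ≤ ∫ y, ((8 * √(R*δ)) * ((Set.Icc (R-δ) (R+δ)).indicator (fun _ => 1) y +
        (Set.Icc (-R-δ) (-R+δ)).indicator (fun _ => 1) y) -
        (√(R^2 - (y+δ)^2) + √(R^2 - (y-δ)^2) - 2 * √(R^2 - y^2))) := by
        apply integral_mono id.abs ((j12.const_mul _).sub id)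
        intro y
        have h := pt_bound R δ y hR hδ
        have hrhs : 0 ≤ (4 * √(R*δ)) * ((Set.Icc (R-δ) (R+δ)).indicator (fun _ => (1:ℝ)) y +
            (Set.Icc (-R-δ) (-R+δ)).indicator (fun _ => (1:ℝ)) y) := by
          apply mul_nonneg (by positivity)
          apply add_nonneg <;> exact Set.indicator_nonneg (fun _ _ => zero_le_one) _
        simp only [Pi.sub_apply, Pi.add_apply]
        rw [abs_le]
        constructor <;> linarith
    _ = _ := by
        rw [integral_sub (j12.const_mul _) id, hd0, integral_const_mul,
          integral_add j1 j2, integral_indicator measurableSet_Icc, integral_indicator measurableSet_Icc]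
        simp only [integral_const, smul_eq_mul, mul_one, measureReal_restrict_apply_univ, Real.volume_real_Icc]
        rw [max_eq_left (by linarith), max_eq_left (by linarith)]
        ring

lemma four_disc (A R b : ℝ) (hA : 0 ≤ A) (hR : 0 ≤ R) (n : ℤ) :
    ‖FourierTransform.fourier (fun y : ℝ => ((A * √(R^2 - (y-b)^2) : ℝ) : ℂ)) (n:ℝ)‖ * (if n = 0 then 0 else 1)
      ≤ 8 * A * √R * |(n:ℝ)| ^ (-(3/2) : ℝ) := by
  by_cases hn : n = 0
  · simp only [hn, if_true, mul_zero]; positivity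
  rw [if_neg hn, mul_one]
  have hn' : (n:ℝ) ≠ 0 := by exact_mod_cast hn
  have hint : Integrable (fun y : ℝ => ((A * √(R^2 - (y-b)^2) : ℝ) : ℂ)) :=
    (((q_int R).comp_sub_right b).const_mul A).ofReal
  have h1 := four_bound _ hint n hn' _ rfl
  set δ : ℝ := 1 / (2 * n) with hδ
  have hδ0 : 0 < |δ| := by rw [hδ]; positivity
  have h2 := int_bound R |δ| hR hδ0
  have h3 : ∫ y, ‖((A * √(R^2 - (y + δ -b)^2) : ℝ) : ℂ) + ((A * √(R^2 - (y - δ -b)^2) : ℝ) : ℂ) -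
      2 * ((A * √(R^2 - (y -b)^2) : ℝ) : ℂ)‖ =
      A * ∫ y, |√(R^2 - (y+|δ|)^2) + √(R^2 - (y-|δ|)^2) - 2 * √(R^2 - y^2)| := by
    rw [← integral_const_mul, ← integral_sub_right_eq_self
      (fun y => A * |√(R^2 - (y+|δ|)^2) + √(R^2 - (y-|δ|)^2) - 2 * √(R^2 - y^2)|) b]
    congr 1
    ext y
    have : ((A * √(R^2 - (y + δ -b)^2) : ℝ) : ℂ) + ((A * √(R^2 - (y - δ -b)^2) : ℝ) : ℂ) -
      2 * ((A * √(R^2 - (y -b)^2) : ℝ) : ℂ) = ((A * (√(R^2 - (y + δ -b)^2) + √(R^2 - (y - δ -b)^2) -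
      2 * √(R^2 - (y -b)^2)) : ℝ) : ℂ) := by push_cast; ring
    rw [this, Complex.norm_real, Real.norm_eq_abs, abs_mul, abs_of_nonneg hA]
    congr 2
    rcases abs_cases δ with ⟨h, -⟩ | ⟨h, -⟩ <;> rw [h]
    · rw [show y + δ - b = y - b + δ by ring, show y - δ - b = y - b - δ by ring]
    · rw [show y + δ - b = y - b - -δ by ring, show y - δ - b = y - b + -δ by ring]; ring
  rw [h3] at h1
  have h4 : √(R * |δ|) * |δ| ≤ √R * |(n:ℝ)| ^ (-(3/2) : ℝ) := by
    rw [Real.sqrt_mul hR, mul_assoc]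
    apply mul_le_mul_of_nonneg_left _ (by positivity)
    have hle : |δ| ≤ |(n:ℝ)|⁻¹ := by
      rw [hδ, abs_div, abs_mul, abs_one, one_div, mul_inv]
      have : 0 ≤ |(n:ℝ)|⁻¹ := by positivity
      norm_num; linarith
    have e : |(n:ℝ)| ^ (-(3/2) : ℝ) = √(|(n:ℝ)|⁻¹) * |(n:ℝ)|⁻¹ := by
      rw [Real.sqrt_eq_rpow, show (-(3/2) : ℝ) = (-(1/2)) + (-1) by norm_num,
        Real.rpow_add (by positivity), Real.rpow_neg_one, Real.inv_rpow (by positivity), ← Real.rpow_neg (by positivity)]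
    rw [e]
    gcongr
  calc _ ≤ _ := h1
    _ ≤ 1/4 * (A * (32 * √(R*|δ|) * |δ|)) := by gcongr
    _ = 8 * A * (√(R*|δ|) * |δ|) := by ring
    _ ≤ 8 * A * (√R * |(n:ℝ)| ^ (-(3/2) : ℝ)) := by gcongr
    _ = _ := by ring

lemma disc_meas (c : ℝ × ℝ) (r : ℝ) : MeasurableSet (closedDisc c r) := by
  have : IsClosed (closedDisc c r) := by
    unfold closedDisc
    exact isClosed_le (by fun_prop) (by fun_prop)
  exact this.measurableSet

/-- Chord length of the disc along lines of slope `α`. -/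
noncomputable def chord (α : ℝ) (c : ℝ × ℝ) (r y : ℝ) : ℝ :=
  2 / (1 + α^2) * √((r * √(1 + α^2))^2 - (y - (c.2 - α * c.1))^2)

lemma chord_nonneg (α : ℝ) (c : ℝ × ℝ) (r y : ℝ) : 0 ≤ chord α c r y := by
  unfold chord; positivity

lemma vol_chord (α : ℝ) (c : ℝ × ℝ) (r y : ℝ) :
    volume {u : ℝ | (u, y + α * u) ∈ closedDisc c r} = ENNReal.ofReal (chord α c r y) := by
  have hK : 0 < 1 + α^2 := by positivity
  set K := 1 + α^2 with hKdef
  set s := y - (c.2 - α * c.1) with hs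
  have hR : (r * √K)^2 = K * r^2 := by
    rw [mul_pow, Real.sq_sqrt hK.le]; ring
  have hmem : ∀ u : ℝ, (u, y + α * u) ∈ closedDisc c r ↔ (K * (u - c.1) + α * s)^2 ≤ K * r^2 - s^2 := by
    intro u
    have e : K * ((u - c.1)^2 + (y + α * u - c.2)^2) = (K * (u - c.1) + α * s)^2 + s^2 := by
      rw [hKdef, hs]; ring
    show (u - c.1)^2 + (y + α * u - c.2)^2 ≤ r^2 ↔ _
    rw [← mul_le_mul_iff_right₀ hK, e]
    constructor <;> intro h <;> linarith
  unfold chord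
  rw [← hKdef, ← hs, hR]
  by_cases hd : 0 ≤ K * r^2 - s^2
  · have hset : {u : ℝ | (u, y + α * u) ∈ closedDisc c r} =
        Set.Icc (c.1 - α * s / K - √(K * r^2 - s^2) / K) (c.1 - α * s / K + √(K * r^2 - s^2) / K) := by
      ext u
      rw [Set.mem_setOf_eq, hmem, Real.sq_le hd, Set.mem_Icc]
      have e1 : c.1 - α * s / K - √(K * r^2 - s^2) / K = (K * c.1 - α * s - √(K * r^2 - s^2)) / K := by
        field_simp
      have e2 : c.1 - α * s / K + √(K * r^2 - s^2) / K = (K * c.1 - α * s + √(K * r^2 - s^2)) / K := by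
        field_simp
      rw [e1, e2, div_le_iff₀ hK, le_div_iff₀ hK]
      constructor <;> rintro ⟨h1, h2⟩ <;> constructor <;> linarith
    rw [hset, Real.volume_Icc]
    congr 1
    ring
  · have hset : {u : ℝ | (u, y + α * u) ∈ closedDisc c r} = ∅ := by
      ext u
      rw [Set.mem_setOf_eq, hmem]
      simp only [Set.mem_empty_iff_false, iff_false]
      intro h
      exact hd ((sq_nonneg _).trans h)
    rw [hset, Real.sqrt_eq_zero_of_nonpos (by linarith)]
    simp

lemma chord_supp (α : ℝ) (c : ℝ × ℝ) (r : ℝ) : HasCompactSupport (chord α c r) := by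
  apply HasCompactSupport.intro (isCompact_Icc
    (a := c.2 - α * c.1 - |r * √(1 + α^2)|) (b := c.2 - α * c.1 + |r * √(1 + α^2)|))
  intro y hy
  unfold chord
  rw [Real.sqrt_eq_zero_of_nonpos, mul_zero]
  have : ¬ |y - (c.2 - α * c.1)| ≤ |r * √(1 + α^2)| := by
    intro h
    apply hy
    rw [abs_le] at h
    constructor <;> linarith [h.1, h.2]
  have := sq_lt_sq.mpr (not_le.mp this)
  linarith

lemma chord_cont (α : ℝ) (c : ℝ × ℝ) (r : ℝ) : Continuous (chord α c r) := by
  unfold chord; fun_prop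

lemma vol_disc (α : ℝ) (c : ℝ × ℝ) (r : ℝ) :
    (volume (closedDisc c r)).toReal = ∫ y, chord α c r y := by
  have hsh : MeasurePreserving (fun p : ℝ × ℝ => (p.1, p.2 + α * p.1)) (volume.prod volume) (volume.prod volume) := by
    refine MeasurePreserving.skew_product (g := fun a b => b + α * a) (MeasurePreserving.id volume) (by
      unfold Function.uncurry; fun_prop) ?_
    filter_upwards with a
    exact map_add_right_eq_self volume (α * a)
  have h1 : volume (closedDisc c r) = ∫⁻ y, ENNReal.ofReal (chord α c r y) := by
    rw [Measure.volume_eq_prod, ← hsh.measure_preimage (disc_meas c r).nullMeasurableSet,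
      Measure.prod_apply_symm (hsh.measurable (disc_meas c r))]
    congr 1
    ext y
    rw [← vol_chord]
    rfl
  rw [h1, integral_eq_lintegral_of_nonneg_ae (Filter.Eventually.of_forall (chord_nonneg α c r))
    (chord_cont α c r).aestronglyMeasurable]

lemma slice_meas (α : ℝ) (c : ℝ × ℝ) (r y : ℝ) :
    MeasurableSet {u : ℝ | (u, y + α * u) ∈ closedDisc c r} := by
  have : Measurable (fun u : ℝ => (u, y + α * u)) := by fun_prop
  exact this (disc_meas c r)

lemma slice_ind (α : ℝ) (c : ℝ × ℝ) (r y : ℝ) :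
    (fun u : ℝ => (closedDisc c r).indicator (fun _ => (1:ℝ)) (u, y + α * u)) =
      {u : ℝ | (u, y + α * u) ∈ closedDisc c r}.indicator (fun _ => (1:ℝ)) := by
  ext u
  simp [Set.indicator]

lemma slice_int (α : ℝ) (c : ℝ × ℝ) (r y : ℝ)
    (hsub : closedDisc c r ⊆ Set.Ico (0:ℝ) 1 ×ˢ Set.Ico (0:ℝ) 1) :
    ∫ u in Set.Ico (0:ℝ) 1, (closedDisc c r).indicator (fun _ => (1:ℝ)) (u, y + α * u) = chord α c r y := by
  rw [setIntegral_eq_integral_of_forall_compl_eq_zero, slice_ind,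
    integral_indicator (slice_meas α c r y)]
  · simp [measureReal_def, vol_chord, chord_nonneg]
  · intro u hu
    apply Set.indicator_of_notMem
    intro h
    exact hu (hsub h).1

lemma chord_summable (α : ℝ) (c : ℝ × ℝ) (r y : ℝ) : Summable (fun n : ℤ => chord α c r (y + n)) := by
  apply summable_of_finite_support
  have h := (chord_supp α c r)
  obtain ⟨M, hM⟩ := h.isCompact.isBounded.exists_norm_le
  refine (Set.finite_Icc (⌈-M - y⌉) (⌊M - y⌋)).subset ?_
  intro n hn
  have := hM (y + n) (subset_tsupport _ hn)
  rw [Real.norm_eq_abs, abs_le] at this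
  rw [Set.mem_Icc, Int.ceil_le, Int.le_floor]
  constructor <;> linarith [this.1, this.2]

lemma one_step (α : ℝ) (c : ℝ × ℝ) (r y : ℝ)
    (hsub : closedDisc c r ⊆ Set.Ico (0:ℝ) 1 ×ˢ Set.Ico (0:ℝ) 1) :
    ∫ u in (0:ℝ)..1, (closedDisc c r).indicator (fun _ => (1:ℝ)) (Int.fract u, Int.fract (y + α * u))
      = ∑' n : ℤ, chord α c r (y + n) := by
  rw [intervalIntegral.integral_of_le zero_le_one, integral_Ioc_eq_integral_Ioo, ← integral_Ico_eq_integral_Ioo]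
  have h1 : ∀ n : ℤ, Integrable (fun u : ℝ => (closedDisc c r).indicator (fun _ => (1:ℝ)) (u, (y + n) + α * u))
      (volume.restrict (Set.Ico (0:ℝ) 1)) := by
    intro n
    rw [slice_ind]
    exact (integrable_const (1:ℝ)).indicator (slice_meas α c r (y+n))
  have h2 := integral_tsum_of_summable_integral_norm h1 (by
    refine (chord_summable α c r y).congr ?_
    intro n
    rw [← slice_int α c r (y+n) hsub]
    congr 1
    ext u
    rw [Real.norm_of_nonneg]
    exact Set.indicator_nonneg (fun _ _ => zero_le_one) _)
  simp_rw [slice_int α c r _ hsub] at h2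
  rw [h2]
  apply setIntegral_congr_fun measurableSet_Ico
  intro u hu
  have hfu : Int.fract u = u := Int.fract_eq_self.mpr hu
  simp only [hfu]
  rw [tsum_eq_single (-⌊y + α * u⌋)]
  · congr 2
    rw [Int.fract]; push_cast; ring
  · intro n hn
    apply Set.indicator_of_notMem
    intro h
    apply hn
    have := (hsub h).2
    simp only [Set.mem_Ico] at this
    have : ⌊y + α * u⌋ = -n := by
      rw [Int.floor_eq_iff]; push_cast; constructor <;> linarith [this.1, this.2]
    omega

lemma birk (α : ℝ) (hirr : Irrational α)
    (hs : Summable (fun n : ℤ => (|(n:ℝ)| ^ (-(3/2) : ℝ) / ‖fourier n (α : UnitAddCircle) - 1‖)))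
    (c : ℝ × ℝ) (r : ℝ) (hr : 0 ≤ r) (hr1 : r ≤ 1) (y : ℝ) (N : ℕ) :
    |∑ j ∈ Finset.range N, (∑' n : ℤ, chord α c r ((y + j * α) + n)) - N * (volume (closedDisc c r)).toReal|
      ≤ ∑' n : ℤ, 32 * √(√(1 + α^2)) * (|(n:ℝ)| ^ (-(3/2) : ℝ) / ‖fourier n (α : UnitAddCircle) - 1‖) := by
  set f : ℝ → ℂ := fun y => ((chord α c r y : ℝ) : ℂ) with hf
  set a : ℤ → ℂ := fun n => FourierTransform.fourier f (n:ℝ) with ha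
  have hA : 2 / (1 + α^2) ≤ 2 := by
    apply div_le_self (by norm_num); nlinarith [sq_nonneg α]
  have hab : ∀ n : ℤ, n ≠ 0 → ‖a n‖ ≤ 16 * √(√(1 + α^2)) * |(n:ℝ)| ^ (-(3/2) : ℝ) := by
    intro n hn
    have h := four_disc (2 / (1 + α^2)) (r * √(1 + α^2)) (c.2 - α * c.1) (by positivity) (by positivity) n
    rw [if_neg hn, mul_one] at h
    refine h.trans ?_
    have h2 : √(r * √(1 + α^2)) ≤ √(√(1 + α^2)) := by
      apply Real.sqrt_le_sqrt
      exact mul_le_of_le_one_left (by positivity) hr1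
    have h3 : 8 * (2 / (1 + α^2)) * √(r * √(1 + α^2)) ≤ 16 * √(√(1 + α^2)) := by
      calc _ ≤ 8 * 2 * √(√(1 + α^2)) := by gcongr
        _ = _ := by ring
    gcongr
  have hsa : Summable a := by
    have hsr : Summable (fun n : ℤ => 16 * √(√(1 + α^2)) * |(n:ℝ)| ^ (-(3/2) : ℝ)) :=
      (Real.summable_abs_int_rpow (by norm_num)).mul_left _
    refine Summable.of_norm_bounded_eventually hsr ?_
    filter_upwards [(Set.finite_singleton (0:ℤ)).compl_mem_cofinite] with n hn
    exact hab n hn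
  have hfc : Continuous f := Complex.continuous_ofReal.comp (chord_cont α c r)
  have hfs : HasCompactSupport f := (chord_supp α c r).comp_left (g := fun x : ℝ => (x : ℂ)) (by simp)
  have hO : f =O[Filter.cocompact ℝ] (fun x => |x| ^ (-(2:ℝ))) := by
    have := hasCompactSupport_iff_eventuallyEq.mp hfs
    rw [Filter.coclosedCompact_eq_cocompact] at this
    exact this.trans_isBigO (Asymptotics.isBigO_zero _ _)
  have hpoi : ∀ x : ℝ, HasSum (fun n : ℤ => a n * fourier n (x : UnitAddCircle))
      ((∑' n : ℤ, chord α c r (x + n) : ℝ) : ℂ) := by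
    intro x
    have h := Real.tsum_eq_tsum_fourier_of_rpow_decay_of_summable hfc (by norm_num) hO hsa x
    have h' : ((∑' n : ℤ, chord α c r (x + n) : ℝ) : ℂ) = ∑' n : ℤ, f (x + n) := by
      rw [Complex.ofReal_tsum]
    rw [h', h]
    apply Summable.hasSum
    refine Summable.of_norm_bounded hsa.norm ?_
    intro n
    rw [norm_mul, fourier_apply, Circle.norm_coe, mul_one]
  have ha0 : a 0 = (((volume (closedDisc c r)).toReal : ℝ) : ℂ) := by
    rw [vol_disc α c r, ha]
    simp only [Int.cast_zero]
    rw [Real.fourier_real_eq_integral_exp_smul]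
    simp [hf]
    exact integral_ofReal
  have hH := (hasSum_sum (s := Finset.range N) (fun j _ => hpoi (y + j * α))).sub
    (hasSum_ite_eq (0:ℤ) ((N:ℂ) * a 0))
  have hcast : ((∑ j ∈ Finset.range N, (∑' n : ℤ, chord α c r ((y + j * α) + n)) - N * (volume (closedDisc c r)).toReal : ℝ) : ℂ)
      = (∑ j ∈ Finset.range N, ((∑' n : ℤ, chord α c r ((y + j * α) + n) : ℝ) : ℂ)) - (N:ℂ) * a 0 := by
    rw [ha0]; push_cast; rfl
  rw [← Real.norm_eq_abs, ← Complex.norm_real, hcast, ← hH.tsum_eq]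
  refine tsum_of_norm_bounded (hs.mul_left _).hasSum ?_
  intro n
  by_cases hn : n = 0
  · subst hn
    simp
  · have hz : (fourier n (α : UnitAddCircle) : ℂ) ≠ 1 := by
      rw [fourier_coe_apply]
      intro h
      rw [Complex.exp_eq_one_iff] at h
      obtain ⟨k, hk⟩ := h
      have hk' : ((n * α : ℝ) : ℂ) = ((k : ℝ) : ℂ) := by
        have h2 : (2 * (Real.pi:ℂ) * Complex.I) ≠ 0 := Complex.two_pi_I_ne_zero
        apply mul_left_cancel₀ h2
        push_cast at hk ⊢
        rw [div_one] at hk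
        linear_combination hk
      have hk'' : (n:ℝ) * α = k := by exact_mod_cast hk'
      have := hirr.intCast_mul hn
      exact (this.ne_int k) hk''
    have hterm : ∀ j : ℕ, (fourier n ((y + j * α : ℝ) : UnitAddCircle) : ℂ) =
        fourier n (y : UnitAddCircle) * (fourier n (α : UnitAddCircle))^j := by
      intro j
      rw [fourier_coe_apply, fourier_coe_apply, fourier_coe_apply, ← Complex.exp_nat_mul, ← Complex.exp_add]
      congr 1
      push_cast
      ring
    simp only [hn, if_false, sub_zero]
    simp_rw [hterm, ← mul_assoc]
    rw [← Finset.mul_sum, geom_sum_eq hz, norm_mul, norm_mul, norm_div]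
    have hn1 : ∀ x : UnitAddCircle, ‖(fourier n x : ℂ)‖ = 1 := by
      intro x; rw [fourier_apply, Circle.norm_coe]
    have hn2 : ‖(fourier n (α : UnitAddCircle) : ℂ)^N - 1‖ ≤ 2 := by
      refine (norm_sub_le _ _).trans ?_
      rw [norm_pow, hn1]; norm_num
    rw [hn1, mul_one]
    have hz' : 0 < ‖(fourier n (α : UnitAddCircle) : ℂ) - 1‖ := norm_pos_iff.mpr (sub_ne_zero.mpr hz)
    calc _ ≤ (16 * √(√(1 + α^2)) * |(n:ℝ)| ^ (-(3/2) : ℝ)) * (2 / ‖(fourier n (α : UnitAddCircle) : ℂ) - 1‖) := by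
          gcongr
          exact hab n hn
      _ = _ := by ring

theorem statement9 :
    ∀ᵐ α : ℝ ∂volume, 0 < α →
      ∃ C : ℝ, ∀ x₁ x₂ : ℝ, x₁ ∈ Set.Ico (0:ℝ) 1 → x₂ ∈ Set.Ico (0:ℝ) 1 →
        ∀ (c : ℝ × ℝ) (r : ℝ), 0 < r →
          closedDisc c r ⊆ Set.Ico (0:ℝ) 1 ×ˢ Set.Ico (0:ℝ) 1 →
          ∀ T : ℝ, 0 < T →
            |rotDelta (closedDisc c r) α x₁ x₂ T| ≤ C := by
  have hirr : ∀ᵐ α : ℝ, Irrational α := by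
    exact (Set.countable_range ((↑) : ℚ → ℝ)).ae_notMem volume
  filter_upwards [ae_real, hirr] with α hs hα _
  refine ⟨(∑' n : ℤ, 32 * √(√(1 + α^2)) * (|(n:ℝ)| ^ (-(3/2) : ℝ) / ‖fourier n (α : UnitAddCircle) - 1‖)) + 4, ?_⟩
  intro x₁ x₂ hx₁ hx₂ c r hr hsub T hT
  have hr1 : r ≤ 1 := by
    have h1 : ((c.1 + r, c.2) : ℝ × ℝ) ∈ closedDisc c r := by
      show (c.1 + r - c.1)^2 + (c.2 - c.2)^2 ≤ r^2
      apply le_of_eq; ring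
    have h2 : ((c.1 - r, c.2) : ℝ × ℝ) ∈ closedDisc c r := by
      show (c.1 - r - c.1)^2 + (c.2 - c.2)^2 ≤ r^2
      apply le_of_eq; ring
    have h3 := (hsub h1).1.2
    have h4 := (hsub h2).1.1
    simp only at h3 h4
    linarith
  have hvol : (volume (closedDisc c r)).toReal ≤ 1 := by
    have h1 : volume (closedDisc c r) ≤ 1 := by
      refine (measure_mono hsub).trans ?_
      rw [Measure.volume_eq_prod, Measure.prod_prod]
      simp
    exact ENNReal.toReal_mono (by simp) h1
  have hvol0 : 0 ≤ (volume (closedDisc c r)).toReal := ENNReal.toReal_nonneg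
  set V := (volume (closedDisc c r)).toReal with hV
  set y := x₂ - α * x₁ with hy
  set φ : ℝ → ℝ := fun u => (closedDisc c r).indicator (fun _ => (1:ℝ)) (Int.fract u, Int.fract (y + α * u)) with hφ
  have hφ1 : ∀ u, ‖φ u‖ ≤ 1 := by
    intro u
    refine (norm_indicator_le_norm_self _ _).trans ?_
    simp
  have hφm : Measurable φ := by
    have h1 : Measurable (fun u : ℝ => (Int.fract u, Int.fract (y + α * u))) :=
      measurable_fract.prodMk (measurable_fract.comp (by fun_prop))
    exact (measurable_const.indicator (disc_meas c r)).comp h1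
  have hφi : ∀ p q : ℝ, IntervalIntegrable φ volume p q := by
    intro p q
    refine IntervalIntegrable.mono_fun (g := φ) (f := fun _ => (1:ℝ)) intervalIntegrable_const hφm.aestronglyMeasurable ?_
    filter_upwards with u
    simpa using hφ1 u
  have hI : ∫ t in (0:ℝ)..T, (closedDisc c r).indicator (fun _ => (1:ℝ)) (Int.fract (x₁ + t), Int.fract (x₂ + α * t))
      = ∫ u in x₁..(x₁ + T), φ u := by
    have := intervalIntegral.integral_comp_add_left (a := 0) (b := T) φ x₁
    rw [add_zero] at this
    rw [← this]
    congr 1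
    ext t
    simp only [hφ]
    congr 3
    rw [hy]; ring
  set N := ⌊T⌋₊ with hN
  have hN1 : (N:ℝ) ≤ T := Nat.floor_le hT.le
  have hN2 : T < N + 1 := Nat.lt_floor_add_one T
  have hNint : ∫ u in (0:ℝ)..N, φ u = ∑ j ∈ Finset.range N, (∑' n : ℤ, chord α c r ((y + j * α) + n)) := by
    have h := intervalIntegral.sum_integral_adjacent_intervals (μ := volume) (f := φ) (a := fun k : ℕ => (k:ℝ)) (n := N)
      (fun k _ => hφi _ _)
    simp only [Nat.cast_zero] at h
    rw [← h]
    apply Finset.sum_congr rfl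
    intro j _
    rw [← one_step α c r _ hsub]
    have h2 := intervalIntegral.integral_comp_add_right (a := 0) (b := 1) φ (j:ℝ)
    rw [zero_add] at h2
    push_cast
    rw [add_comm (j:ℝ) 1, ← h2]
    congr 1
    ext u
    simp only [hφ]
    congr 2
    · exact Int.fract_add_natCast u j
    · congr 1; ring
  have hsplit : ∫ u in x₁..(x₁ + T), φ u = (∫ u in x₁..0, φ u) + (∫ u in (0:ℝ)..N, φ u) + ∫ u in (N:ℝ)..(x₁+T), φ u := by
    rw [intervalIntegral.integral_add_adjacent_intervals (hφi _ _) (hφi _ _),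
      intervalIntegral.integral_add_adjacent_intervals (hφi _ _) (hφi _ _)]
  have b1 : |∫ u in x₁..0, φ u| ≤ 1 := by
    have := intervalIntegral.norm_integral_le_of_norm_le_const (a := x₁) (b := 0) (C := 1) (f := φ) (fun u _ => hφ1 u)
    rw [Real.norm_eq_abs, zero_sub, abs_neg, abs_of_nonneg hx₁.1] at this
    linarith [hx₁.2]
  have b2 : |∫ u in (N:ℝ)..(x₁+T), φ u| ≤ 2 := by
    have := intervalIntegral.norm_integral_le_of_norm_le_const (a := (N:ℝ)) (b := x₁ + T) (C := 1) (f := φ) (fun u _ => hφ1 u)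
    rw [Real.norm_eq_abs, abs_of_nonneg (a := x₁ + T - N) (by linarith [hx₁.1])] at this
    linarith [hx₁.2]
  have b3 := birk α hα hs c r hr.le hr1 y N
  rw [← hV, ← hNint] at b3
  unfold rotDelta
  rw [hI, hsplit, ← hV]
  rw [abs_le] at b1 b2 b3 ⊢
  have b4 : 0 ≤ (T - N) * V := mul_nonneg (by linarith) hvol0
  have b5 : (T - N) * V ≤ 1 := by nlinarith
  constructor <;> nlinarith [b1.1, b1.2, b2.1, b2.2, b3.1, b3.2]
end

section
/- For almost every irrational α ∈ (0,1) (with respect to Lebesgue measure) and for every m > 0, there exists a constant C = C(α, m) such that for every integer s ≥ 0 one has ∑_{l=0}^{s} (a_{l+1} / q_l^{1/m}) · (∑_{k=1}^{l+1} a_k) ≤ C, where a₁, a₂, … are the partial quotients of α and q₀, q₁, … the denominators of its continued fraction convergents. -/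
open MeasureTheory

/-- A non-Liouville irrational satisfies a uniform lower bound. -/
theorem aux_lower (x p : ℝ) (hx : Irrational x) (h : ¬ LiouvilleWith p x) :
    ∃ c : ℝ, 0 < c ∧ ∀ n : ℕ, 1 ≤ n → ∀ k : ℤ, c / (n:ℝ) ^ p ≤ |x - k / n| := by
  have hne : ∀ n : ℕ, ∀ k : ℤ, x ≠ k / n := by
    intro n k hk
    apply hx
    refine ⟨(k : ℚ) / n, ?_⟩
    rw [hk]; push_cast; rfl
  have hev : ∃ N : ℕ, ∀ n : ℕ, N ≤ n → ∀ k : ℤ, 1 / (n:ℝ) ^ p ≤ |x - k / n| := by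
    by_contra! hcon
    apply h
    refine ⟨1, Filter.frequently_atTop.2 fun N => ?_⟩
    obtain ⟨n, hn, k, hk⟩ := hcon N
    exact ⟨n, hn, k, hne n k, hk⟩
  obtain ⟨N, hN⟩ := hev
  have hfin : ∀ M : ℕ, ∃ c : ℝ, 0 < c ∧ ∀ n : ℕ, 1 ≤ n → n < M → ∀ k : ℤ,
      c / (n:ℝ) ^ p ≤ |x - k / n| := by
    intro M
    induction M with
    | zero => exact ⟨1, one_pos, fun n _ h => absurd h (by omega)⟩
    | succ M ih =>
      obtain ⟨c, hc, ih⟩ := ih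
      rcases Nat.eq_zero_or_pos M with h0 | hM
      · exact ⟨1, one_pos, fun n _ h => absurd h (by omega)⟩
      have hMr : (0:ℝ) < M := by exact_mod_cast hM
      have hMp : (0:ℝ) < (M:ℝ) ^ p := Real.rpow_pos_of_pos hMr p
      set d : ℝ := |x * M - round (x * M)| / M with hd
      have hdpos : 0 < d := by
        apply div_pos _ hMr
        rw [abs_pos, sub_ne_zero]
        intro heq
        exact hne M (round (x * M)) (by rw [← heq]; field_simp)
      refine ⟨min c (d * (M:ℝ) ^ p), lt_min hc (by positivity), ?_⟩
      intro n hn hnM k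
      rcases Nat.lt_succ_iff_lt_or_eq.1 hnM with hlt | rfl
      · refine le_trans ?_ (ih n hn hlt k)
        gcongr
        exact min_le_left _ _
      · calc min c (d * (n:ℝ) ^ p) / (n:ℝ) ^ p ≤ d * (n:ℝ) ^ p / (n:ℝ) ^ p := by
              gcongr; exact min_le_right _ _
          _ = d := by field_simp
          _ ≤ |x * n - k| / n := by
              rw [hd]; exact div_le_div_of_nonneg_right (round_le (x * n) k) hMr.le
          _ = |x - k / n| := by
              rw [← abs_of_pos hMr, ← abs_div, abs_of_pos hMr]
              congr 1; field_simp
  obtain ⟨c, hc, hcc⟩ := hfin N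
  refine ⟨min c 1, lt_min hc one_pos, fun n hn k => ?_⟩
  have hnr : (0:ℝ) < n := by exact_mod_cast hn
  rcases lt_or_ge n N with hlt | hge
  · refine le_trans ?_ (hcc n hn hlt k)
    gcongr
    exact min_le_left _ _
  · refine le_trans ?_ (hN n hge k)
    gcongr
    exact min_le_right _ _

section cf
variable (a p q : ℕ → ℕ) (ha : ∀ n : ℕ, 1 ≤ n → 1 ≤ a n)
    (hq0 : q 0 = 1) (hq1 : q 1 = a 1)
    (hq : ∀ n : ℕ, q (n + 2) = a (n + 2) * q (n + 1) + q n)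
    (hp0 : p 0 = 0) (hp1 : p 1 = 1)
    (hp : ∀ n : ℕ, p (n + 2) = a (n + 2) * p (n + 1) + p n)

theorem aux_step (ha : ∀ n : ℕ, 1 ≤ n → 1 ≤ a n)
    (hq0 : q 0 = 1) (hq1 : q 1 = a 1)
    (hq : ∀ n : ℕ, q (n + 2) = a (n + 2) * q (n + 1) + q n) (n : ℕ) :
    1 ≤ q n ∧ q n ≤ q (n + 1) ∧ a (n + 1) * q n ≤ q (n + 1) := by
  induction n with
  | zero => have := ha 1 le_rfl; simp [hq0, hq1]; omega
  | succ n ih =>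
    have h1 := ha (n + 2) (by omega)
    rw [hq n]
    refine ⟨by omega, ?_, Nat.le_add_right _ _⟩
    nlinarith

theorem aux_growth (ha : ∀ n : ℕ, 1 ≤ n → 1 ≤ a n)
    (hq0 : q 0 = 1) (hq1 : q 1 = a 1)
    (hq : ∀ n : ℕ, q (n + 2) = a (n + 2) * q (n + 1) + q n) (n : ℕ) :
    2 ^ n ≤ 2 * q n ^ 2 := by
  induction n using Nat.twoStepInduction with
  | zero => simp [hq0]
  | one => have := ha 1 le_rfl; rw [hq1]; nlinarith
  | more n ih _ =>
    obtain ⟨h1, h2, _⟩ := aux_step a q ha hq0 hq1 hq n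
    obtain ⟨_, h3, h4⟩ := aux_step a q ha hq0 hq1 hq (n + 1)
    have h5 := ha (n + 2) (by omega)
    have : 2 * q n ≤ q (n + 2) := by rw [hq n]; nlinarith
    calc 2 ^ (n + 2) = 4 * 2 ^ n := by ring
      _ ≤ 4 * (2 * q n ^ 2) := by omega
      _ = 2 * (2 * q n) ^ 2 := by ring
      _ ≤ _ := by gcongr

theorem aux_det (hq0 : q 0 = 1) (hq1 : q 1 = a 1)
    (hq : ∀ n : ℕ, q (n + 2) = a (n + 2) * q (n + 1) + q n)
    (hp0 : p 0 = 0) (hp1 : p 1 = 1)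
    (hp : ∀ n : ℕ, p (n + 2) = a (n + 2) * p (n + 1) + p n) (n : ℕ) :
    |(q n : ℝ) * p (n + 1) - p n * q (n + 1)| = 1 := by
  induction n with
  | zero => simp [hq0, hp0, hp1]
  | succ n ih =>
    rw [hq n, hp n, ← ih, abs_sub_comm]
    push_cast
    congr 1; ring

theorem aux_D (hq0 : q 0 = 1) (hq1 : q 1 = a 1)
    (hq : ∀ n : ℕ, q (n + 2) = a (n + 2) * q (n + 1) + q n)
    (hp0 : p 0 = 0) (hp1 : p 1 = 1)
    (hp : ∀ n : ℕ, p (n + 2) = a (n + 2) * p (n + 1) + p n) (n j : ℕ) :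
    |(q n : ℝ) * p (n + j) - p n * q (n + j)| * q (n + 1) ≤ q (n + j) := by
  induction j using Nat.twoStepInduction with
  | zero => simp [mul_comm]
  | one => rw [aux_det a p q hq0 hq1 hq hp0 hp1 hp n, one_mul]
  | more j ih1 ih2 =>
    rw [show n + (j + 2) = (n + j) + 2 by ring, hq, hp]
    rw [← add_assoc n j 1] at ih2
    push_cast
    have e : (q n : ℝ) * (a (n + j + 2) * p (n + j + 1) + p (n + j)) -
        p n * (a (n + j + 2) * q (n + j + 1) + q (n + j)) =
        a (n + j + 2) * (q n * p (n + j + 1) - p n * q (n + j + 1)) +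
        (q n * p (n + j) - p n * q (n + j)) := by ring
    rw [e]
    have h := abs_add_le ((a (n + j + 2) : ℝ) * (q n * p (n + j + 1) - p n * q (n + j + 1)))
        (q n * p (n + j) - p n * q (n + j))
    rw [abs_mul, Nat.abs_cast] at h
    have h1 := mul_le_mul_of_nonneg_right h (Nat.cast_nonneg (α := ℝ) (q (n + 1)))
    have h2 := mul_le_mul_of_nonneg_left ih2 (Nat.cast_nonneg (α := ℝ) (a (n + j + 2)))
    linarith

theorem aux_approx (ha : ∀ n : ℕ, 1 ≤ n → 1 ≤ a n)
    (hq0 : q 0 = 1) (hq1 : q 1 = a 1)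
    (hq : ∀ n : ℕ, q (n + 2) = a (n + 2) * q (n + 1) + q n)
    (hp0 : p 0 = 0) (hp1 : p 1 = 1)
    (hp : ∀ n : ℕ, p (n + 2) = a (n + 2) * p (n + 1) + p n) (x : ℝ)
    (hl : Filter.Tendsto (fun n => (p n : ℝ) / (q n : ℝ)) Filter.atTop (nhds x)) (n : ℕ) :
    |x - (p n : ℝ) / q n| ≤ 1 / ((q n : ℝ) * q (n + 1)) := by
  have hpos : ∀ n, (0:ℝ) < q n := fun n => by
    exact_mod_cast (aux_step a q ha hq0 hq1 hq n).1
  have ht : Filter.Tendsto (fun j => |(p (j + n) : ℝ) / (q (j + n) : ℝ) - (p n : ℝ) / q n|)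
      Filter.atTop (nhds |x - (p n : ℝ) / q n|) :=
    (((Filter.tendsto_add_atTop_iff_nat n).2 hl).sub_const _).abs
  refine le_of_tendsto' ht fun j => ?_
  have hD := aux_D a p q hq0 hq1 hq hp0 hp1 hp n j
  rw [add_comm j n]
  have h1 := hpos n
  have h2 := hpos (n + j)
  have h3 := hpos (n + 1)
  have e : (p (n + j) : ℝ) / (q (n + j) : ℝ) - (p n : ℝ) / q n =
      ((q n : ℝ) * p (n + j) - p n * q (n + j)) / (q n * q (n + j)) := by
    field_simp
  rw [e, abs_div, abs_of_pos (mul_pos h1 h2), div_le_div_iff₀ (by positivity) (by positivity)]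
  nlinarith
end cf

theorem statement10 :
    ∀ᵐ α : ℝ ∂volume, (α ∈ Set.Ioo (0:ℝ) 1 ∧ Irrational α) →
      ∀ m : ℝ, 0 < m →
        ∃ C : ℝ,
          ∀ a : ℕ → ℕ, ∀ p q : ℕ → ℕ,
            -- `a₁, a₂, …` are the partial quotients of `α`, i.e. the convergents
            -- `p n / q n` of the continued fraction `[0; a₁, a₂, …]` tend to `α`
            (∀ n : ℕ, 1 ≤ n → 1 ≤ a n) →
            q 0 = 1 → q 1 = a 1 →
            (∀ n : ℕ, q (n + 2) = a (n + 2) * q (n + 1) + q n) →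
            p 0 = 0 → p 1 = 1 →
            (∀ n : ℕ, p (n + 2) = a (n + 2) * p (n + 1) + p n) →
            Filter.Tendsto (fun n => (p n : ℝ) / (q n : ℝ)) Filter.atTop (nhds α) →
            ∀ s : ℕ,
              ∑ l ∈ Finset.range (s + 1),
                ((a (l + 1) : ℝ) / (q l : ℝ) ^ ((1:ℝ) / m)) *
                  (∑ k ∈ Finset.Icc 1 (l + 1), (a k : ℝ)) ≤ C := by
  filter_upwards [ae_not_liouvilleWith] with x hx ⟨_, hirr⟩ m hm
  set e : ℝ := 1 / (4 * m) with he
  have hepos : 0 < e := by positivity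
  obtain ⟨c, hc, hlow⟩ := aux_lower x (2 + e) hirr (hx (2 + e) (by linarith))
  set r : ℝ := (2:ℝ) ^ (-e) with hr
  have hr0 : 0 < r := by positivity
  have hr1 : r < 1 := Real.rpow_lt_one_of_one_lt_of_neg (by norm_num) (by linarith)
  have hsum : Summable (fun l : ℕ => ((l : ℝ) + 1) * (r ^ l * (2:ℝ) ^ e / c ^ 2)) := by
    have s1 : Summable (fun l : ℕ => (l : ℝ) ^ 1 * r ^ l) :=
      summable_pow_mul_geometric_of_norm_lt_one 1 (by rwa [Real.norm_of_nonneg hr0.le])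
    have s2 : Summable (fun l : ℕ => r ^ l) := summable_geometric_of_lt_one hr0.le hr1
    refine ((s1.add s2).mul_right ((2:ℝ) ^ e / c ^ 2)).congr fun l => ?_
    ring
  refine ⟨∑' l : ℕ, ((l : ℝ) + 1) * (r ^ l * (2:ℝ) ^ e / c ^ 2), ?_⟩
  intro a p q ha hq0 hq1 hq hp0 hp1 hp hl s
  refine le_trans (Finset.sum_le_sum fun l _ => ?_) (hsum.sum_le_tsum (Finset.range (s + 1))
    fun l _ => by positivity)
  have hpos : ∀ n, (0:ℝ) < q n := fun n => by
    exact_mod_cast (aux_step a q ha hq0 hq1 hq n).1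
  have hmono : Monotone q := monotone_nat_of_le_succ fun n => (aux_step a q ha hq0 hq1 hq n).2.1
  have hA : ∀ n, (a (n + 1) : ℝ) ≤ (q n : ℝ) ^ e / c := by
    intro n
    have h1 := aux_approx a p q ha hq0 hq1 hq hp0 hp1 hp x hl n
    have h2 := hlow (q n) (aux_step a q ha hq0 hq1 hq n).1 (p n)
    rw [Int.cast_natCast] at h2
    have h3 := h2.trans h1
    have hqn := hpos n
    have hqn1 := hpos (n + 1)
    have h4 : (a (n + 1) : ℝ) * q n ≤ q (n + 1) := by
      exact_mod_cast (aux_step a q ha hq0 hq1 hq n).2.2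
    have hqe : 0 < (q n : ℝ) ^ e := Real.rpow_pos_of_pos hqn e
    rw [Real.rpow_add hqn, Real.rpow_two, div_le_div_iff₀ (by positivity) (by positivity)] at h3
    rw [le_div_iff₀ hc]
    have h5 : c * q (n + 1) ≤ q n * (q n : ℝ) ^ e := by
      refine le_of_mul_le_mul_left ?_ hqn
      nlinarith
    refine le_of_mul_le_mul_left ?_ hqn
    nlinarith
  have hS : ∑ k ∈ Finset.Icc 1 (l + 1), (a k : ℝ) ≤ ((l : ℝ) + 1) * ((q l : ℝ) ^ e / c) := by
    have : ∀ k ∈ Finset.Icc 1 (l + 1), (a k : ℝ) ≤ (q l : ℝ) ^ e / c := by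
      intro k hk
      rw [Finset.mem_Icc] at hk
      obtain ⟨j, rfl⟩ : ∃ j, k = j + 1 := ⟨k - 1, by omega⟩
      refine (hA j).trans ?_
      have : (q j : ℝ) ≤ q l := by exact_mod_cast hmono (by omega : j ≤ l)
      gcongr
    refine (Finset.sum_le_card_nsmul _ _ _ this).trans_eq ?_
    simp
  have hQ := hpos l
  have hm4 : (1:ℝ) / m = e + e + (e + e) := by rw [he]; field_simp; norm_num
  have hqe : 0 < (q l : ℝ) ^ e := Real.rpow_pos_of_pos hQ e
  have hgr : ((q l : ℝ) ^ e * (q l : ℝ) ^ e)⁻¹ ≤ r ^ l * (2:ℝ) ^ e := by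
    have h2l : (2:ℝ) ^ l ≤ 2 * (q l : ℝ) ^ 2 := by
      exact_mod_cast aux_growth a q ha hq0 hq1 hq l
    have h := Real.rpow_le_rpow (by positivity) h2l hepos.le
    rw [Real.mul_rpow (by norm_num) (by positivity), sq, Real.mul_rpow hQ.le hQ.le,
      ← Real.rpow_pow_comm (by norm_num)] at h
    rw [hr, Real.rpow_neg (by norm_num), inv_pow, inv_mul_eq_div,
      inv_eq_one_div, div_le_div_iff₀ (by positivity) (by positivity)]
    linarith
  calc (a (l + 1) : ℝ) / (q l : ℝ) ^ ((1:ℝ) / m) * (∑ k ∈ Finset.Icc 1 (l + 1), (a k : ℝ))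
      ≤ ((q l : ℝ) ^ e / c) / (q l : ℝ) ^ ((1:ℝ) / m) * (((l : ℝ) + 1) * ((q l : ℝ) ^ e / c)) := by
        gcongr
        exact hA l
    _ = ((l : ℝ) + 1) * (((q l : ℝ) ^ e * (q l : ℝ) ^ e)⁻¹ / c ^ 2) := by
        rw [hm4, Real.rpow_add hQ, Real.rpow_add hQ]
        field_simp
    _ ≤ _ := by gcongr
end

section
/- Let T : ℝ → [0,∞) be a hat function and let τ(x) = ∑_{m ∈ ℤ} T(x + m) be its 1-periodization. Then for almost every irrational α ∈ ℝ (with respect to Lebesgue measure), τ is a bounded remainder function with respect to α: there exists a constant C = C(τ, α) such that |∑_{k=0}^{N−1} τ(kα) − N ∫₀¹ τ(x) dx| ≤ C for all integers N ≥ 1. -/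
open MeasureTheory

/-- `T` is a hat function: supported on `[0, b]`, rising linearly from `0` to
height `H` at `a`, then falling linearly back to `0` at `b`. -/
def IsHatFunction (T : ℝ → ℝ) : Prop :=
  ∃ a b H : ℝ, 0 < a ∧ a < b ∧ 0 < H ∧
    (∀ x : ℝ, x < 0 → T x = 0) ∧
    (∀ x : ℝ, b < x → T x = 0) ∧
    (∀ x : ℝ, 0 ≤ x → x ≤ a → T x = H / a * x) ∧
    (∀ x : ℝ, a < x → x ≤ b → T x = -(H / (b - a)) * (x - b))


lemma aux_lint : ∫⁻ x : UnitAddCircle, ENNReal.ofReal (‖x‖⁻¹ ^ (3/4 : ℝ)) < ⊤ := by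
  rw [← UnitAddCircle.lintegral_preimage (-1/2)]
  have h1 : ∀ x ∈ Set.Ioc (-1/2 : ℝ) (-1/2 + 1), ENNReal.ofReal (‖(x : UnitAddCircle)‖⁻¹ ^ (3/4 : ℝ))
      = ENNReal.ofReal (|x| ^ (-(3/4) : ℝ)) := by
    intro x hx
    have : ‖(x : UnitAddCircle)‖ = |x| := by
      rw [AddCircle.norm_coe_eq_abs_iff 1 one_ne_zero, abs_le]
      constructor <;> norm_num <;> linarith [hx.1, hx.2]
    rw [this, Real.inv_rpow (abs_nonneg _), Real.rpow_neg (abs_nonneg _)]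
  rw [setLIntegral_congr_fun measurableSet_Ioc h1]
  have h0 : ∀ c : ℝ, 0 ≤ c → IntervalIntegrable (fun x : ℝ => |x| ^ (-(3/4) : ℝ)) volume 0 c := by
    intro c hc
    refine (intervalIntegral.intervalIntegrable_rpow' (r := -(3/4)) (by norm_num)).congr ?_
    intro x hx
    rw [Set.uIoc_of_le hc] at hx
    simp [abs_of_pos hx.1]
  have h2 : IntervalIntegrable (fun x : ℝ => |x| ^ (-(3/4) : ℝ)) volume (-1/2) (-1/2+1) := by
    refine IntervalIntegrable.trans (b := 0) ?_ (h0 _ (by norm_num))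
    have := (IntervalIntegrable.iff_comp_neg).1 (h0 (1/2) (by norm_num))
    simp only [abs_neg] at this
    convert this.symm using 1 <;> norm_num
  rw [intervalIntegrable_iff_integrableOn_Ioc_of_le (by norm_num)] at h2
  exact h2.lintegral_lt_top

lemma aux_summable_s11 {f : ℤ → ℝ} (h0 : ∀ n, 0 ≤ f n) (h : Summable fun n => f n ^ (3/4 : ℝ)) :
    Summable f := by
  refine summable_of_isBigO h (Asymptotics.IsBigO.of_bound 1 ?_)
  have := h.tendsto_cofinite_zero.eventually (gt_mem_nhds one_pos)
  filter_upwards [this] with n hn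
  have h1 : f n ≤ 1 := by
    by_contra hc
    exact absurd hn (not_lt.2 (Real.one_le_rpow (not_le.1 hc).le (by norm_num)))
  rw [one_mul, Real.norm_of_nonneg (h0 n), Real.norm_of_nonneg (Real.rpow_nonneg (h0 n) _)]
  exact Real.self_le_rpow_of_le_one (h0 n) h1 (by norm_num)

lemma aux_ae_circle_s11 : ∀ᵐ x : UnitAddCircle, Summable fun n : ℤ => ((n:ℝ)^2 * ‖n • x‖)⁻¹ := by
  have hm : ∀ n : ℤ, Measurable fun x : UnitAddCircle =>
      ENNReal.ofReal ((((n:ℝ)^2 * ‖n • x‖)⁻¹) ^ (3/4 : ℝ)) := by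
    intro n
    have : Measurable fun x : UnitAddCircle => n • x := (continuous_zsmul n).measurable
    fun_prop
  have key : ∫⁻ x : UnitAddCircle, ∑' n : ℤ, ENNReal.ofReal ((((n:ℝ)^2 * ‖n • x‖)⁻¹) ^ (3/4 : ℝ)) ≠ ⊤ := by
    rw [lintegral_tsum (fun n => (hm n).aemeasurable)]
    have : ∀ n : ℤ, ∫⁻ x : UnitAddCircle, ENNReal.ofReal ((((n:ℝ)^2 * ‖n • x‖)⁻¹) ^ (3/4 : ℝ))
        = ENNReal.ofReal (|(n:ℝ)| ^ (-(3/2) : ℝ)) * ∫⁻ x : UnitAddCircle, ENNReal.ofReal (‖x‖⁻¹ ^ (3/4 : ℝ)) := by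
      intro n
      by_cases hn : n = 0
      · subst hn; simp [Real.zero_rpow]
      have hmp : MeasurePreserving (fun y : UnitAddCircle => n • y) volume volume :=
        Measure.measurePreserving_zsmul volume hn
      have hg : Measurable fun x : UnitAddCircle => ENNReal.ofReal (‖x‖⁻¹ ^ (3/4 : ℝ)) := by fun_prop
      rw [← hmp.lintegral_comp hg, ← lintegral_const_mul _ (show Measurable fun a : UnitAddCircle => ENNReal.ofReal (‖n • a‖⁻¹ ^ (3 / 4 : ℝ)) from hg.comp hmp.measurable)]
      congr 1 with x
      rw [← ENNReal.ofReal_mul (by positivity), mul_inv, Real.mul_rpow (by positivity) (by positivity)]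
      congr 2
      rw [← sq_abs, Real.inv_rpow (by positivity), Real.rpow_neg (by positivity), ← Real.rpow_natCast,
        ← Real.rpow_mul (by positivity)]
      norm_num
    simp_rw [this]
    rw [ENNReal.tsum_mul_right]
    refine ENNReal.mul_ne_top ?_ aux_lint.ne
    exact (Real.summable_abs_int_rpow (by norm_num : (1:ℝ) < 3/2)).tsum_ofReal_ne_top
  filter_upwards [ae_lt_top' (AEMeasurable.tsum fun n => (hm n).aemeasurable) key] with x hx
  refine aux_summable_s11 (fun n => by positivity) ?_
  have := ENNReal.summable_toReal hx.ne
  refine this.congr fun n => ?_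
  rw [ENNReal.toReal_ofReal (by positivity)]

lemma aux_ae : ∀ᵐ α : ℝ, Summable fun n : ℤ => ((n:ℝ)^2 * ‖n • (α : UnitAddCircle)‖)⁻¹ := by
  rw [← Measure.restrict_univ (μ := (volume : Measure ℝ)), ← iUnion_Ioc_intCast ℝ, ae_restrict_iUnion_iff]
  intro n
  exact (UnitAddCircle.measurePreserving_mk n).quasiMeasurePreserving.ae aux_ae_circle_s11

lemma aux_exp (α : ℝ) (n : ℤ) :
    4 * ‖n • (α : UnitAddCircle)‖ ≤ ‖Complex.exp (2 * Real.pi * Complex.I * n * α) - 1‖ := by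
  have e1 : (2 * Real.pi * Complex.I * n * α : ℂ) = Complex.I * ((2 * Real.pi * (n * α) : ℝ) : ℂ) := by
    push_cast; ring
  have e2 : n • (α : UnitAddCircle) = ((n * α : ℝ) : UnitAddCircle) := by
    rw [← zsmul_eq_mul]; rfl
  rw [e1, e2, Complex.norm_exp_I_mul_ofReal_sub_one, UnitAddCircle.norm_eq, norm_mul, Real.norm_eq_abs,
    Real.norm_eq_abs]
  set y := (n * α : ℝ) with hy
  have h := abs_sub_round y
  have h1 : |Real.sin (Real.pi * (y - round y))| = |Real.sin (2 * Real.pi * y / 2)| := by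
    have : Real.pi * (y - round y) = 2 * Real.pi * y / 2 - (round y) * Real.pi := by ring
    rw [this, Real.sin_sub_int_mul_pi, abs_mul, abs_zpow]; simp
  rw [← h1]
  have h2 := Real.mul_abs_le_abs_sin (x := Real.pi * (y - round y)) (by
    rw [abs_mul, abs_of_pos Real.pi_pos]; nlinarith [Real.pi_pos])
  rw [abs_mul, abs_of_pos Real.pi_pos, ← mul_assoc, div_mul_cancel₀ _ Real.pi_pos.ne'] at h2
  norm_num; linarith

lemma aux_geom (α : ℝ) (hα : Irrational α) (n : ℤ) (hn : n ≠ 0) (N : ℕ) :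
    ‖∑ k ∈ Finset.range N, (Complex.exp (2 * Real.pi * Complex.I * n * α)) ^ k‖
      ≤ ‖n • (α : UnitAddCircle)‖⁻¹ := by
  have hp : 0 < ‖n • (α : UnitAddCircle)‖ := by
    rw [norm_pos_iff]
    intro h
    have e2 : n • (α : UnitAddCircle) = ((n * α : ℝ) : UnitAddCircle) := by
      rw [← zsmul_eq_mul]; rfl
    rw [e2, AddCircle.coe_eq_zero_iff] at h
    obtain ⟨m, hm⟩ := h
    rw [zsmul_eq_mul, mul_one] at hm
    exact ((hα.intCast_mul hn).ne_int m) hm.symm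
  have h := aux_exp α n
  set e := Complex.exp (2 * Real.pi * Complex.I * n * α) with he
  have hen : ‖e‖ = 1 := by
    have e1 : (2 * Real.pi * Complex.I * n * α : ℂ) = ((2 * Real.pi * (n * α) : ℝ) : ℂ) * Complex.I := by
      push_cast; ring
    rw [he, e1, Complex.norm_exp_ofReal_mul_I]
  have hne : e ≠ 1 := by
    intro h'; rw [h', sub_self, norm_zero] at h; linarith
  rw [geom_sum_eq hne, norm_div, ← one_div, div_le_div_iff₀ (by linarith) hp]
  have : ‖e ^ N - 1‖ ≤ 2 := by
    refine (norm_sub_le _ _).trans ?_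
    rw [norm_pow, hen]; norm_num
  nlinarith

lemma aux_cont {T : ℝ → ℝ} (hT : IsHatFunction T) : Continuous T := by
  obtain ⟨a, b, H, ha, hab, hH, h1, h2, h3, h4⟩ := hT
  have hba : 0 < b - a := by linarith
  have : T = fun x => max 0 (min (H / a * x) (H / (b - a) * (b - x))) := by
    ext x
    have p1 : 0 < H / a := by positivity
    have p2 : 0 < H / (b - a) := by positivity
    have q1 : H / a * a = H := by field_simp
    have q2 : H / (b - a) * (b - a) = H := by field_simp
    rcases lt_or_ge x 0 with hx | hx
    · rw [h1 x hx, max_eq_left]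
      exact (min_le_left _ _).trans (by nlinarith)
    rcases le_or_gt x a with hx' | hx'
    · rw [h3 x hx hx', min_eq_left (by nlinarith), max_eq_right (by positivity)]
    rcases le_or_gt x b with hb | hb
    · rw [h4 x hx' hb, min_eq_right (by nlinarith), max_eq_right (mul_nonneg p2.le (by linarith))]
      ring
    · rw [h2 x hb, max_eq_left]
      exact (min_le_right _ _).trans (by nlinarith)
  rw [this]
  fun_prop

lemma aux_int_s11 (c : ℂ) (hc : c ≠ 0) (p q : ℝ) (u v : ℝ) :
    ∫ x in u..v, Complex.exp (c * x) * ((p * (x - q) : ℝ) : ℂ)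
      = Complex.exp (c * v) * (p * (v - q) / c - p / c ^ 2)
        - Complex.exp (c * u) * (p * (u - q) / c - p / c ^ 2) := by
  have hd : ∀ x : ℝ, HasDerivAt (fun y : ℝ => Complex.exp (c * y) * (p * (y - q) / c - p / c ^ 2))
      (Complex.exp (c * x) * ((p * (x - q) : ℝ) : ℂ)) x := by
    intro x
    have h0 : HasDerivAt (fun z : ℂ => Complex.exp (c * z) * (p * (z - q) / c - p / c ^ 2))
      (Complex.exp (c * x) * (c * 1) * (p * ((x:ℂ) - q) / c - p / c ^ 2) +
        Complex.exp (c * x) * (p * 1 / c)) (x : ℂ) :=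
      (((hasDerivAt_id' (x:ℂ)).const_mul c).cexp).mul
        (((((hasDerivAt_id' (x:ℂ)).sub_const (q:ℂ)).const_mul (p:ℂ)).div_const c).sub_const _)
    have := h0.comp_ofReal
    convert this using 1
    push_cast
    field_simp
    ring
  rw [intervalIntegral.integral_eq_sub_of_hasDerivAt (fun x _ => hd x)]
  apply Continuous.intervalIntegrable
  fun_prop

open FourierTransform in
lemma aux_fourier {T : ℝ → ℝ} (hT : IsHatFunction T) :
    ∃ K : ℝ, 0 ≤ K ∧ ∀ ξ : ℝ, ξ ≠ 0 → ‖𝓕 (fun x : ℝ => (T x : ℂ)) ξ‖ ≤ K * (ξ ^ 2)⁻¹ := by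
  have hcont := aux_cont hT
  obtain ⟨a, b, H, ha, hab, hH, h1, h2, h3, h4⟩ := hT
  have hba : 0 < b - a := by linarith
  refine ⟨2 * (H / a) + 2 * (H / (b - a)), by positivity, fun ξ hξ => ?_⟩
  set c : ℂ := ((-2 * Real.pi * ξ : ℝ) : ℂ) * Complex.I with hc
  have hc0 : c ≠ 0 := by
    rw [hc]; simp [hξ, Real.pi_ne_zero]
  have hF : 𝓕 (fun x : ℝ => (T x : ℂ)) ξ = ∫ x in (0:ℝ)..b, Complex.exp (c * x) * (T x : ℂ) := by
    rw [Real.fourier_real_eq_integral_exp_smul,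
      intervalIntegral.integral_eq_integral_of_support_subset]
    · congr 1 with x
      rw [smul_eq_mul, hc]; congr 2; push_cast; ring
    · intro x hx
      by_contra hn
      apply hx
      have : T x = 0 := by
        rw [Set.mem_Ioc, not_and_or, not_lt, not_le] at hn
        rcases hn with hn | hn
        · rcases hn.lt_or_eq with h | h
          · exact h1 x h
          · rw [h, h3 0 le_rfl ha.le, mul_zero]
        · exact h2 x hn
      simp [this]
  have hii : ∀ u v : ℝ, IntervalIntegrable (fun x : ℝ => Complex.exp (c * x) * (T x : ℂ)) volume u v :=
    fun u v => Continuous.intervalIntegrable (by fun_prop) _ _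
  have i1 : ∫ x in (0:ℝ)..a, Complex.exp (c * x) * (T x : ℂ)
      = ∫ x in (0:ℝ)..a, Complex.exp (c * x) * (((H / a) * (x - 0) : ℝ) : ℂ) := by
    refine intervalIntegral.integral_congr fun x hx => ?_
    rw [Set.uIcc_of_le ha.le] at hx
    simp only [h3 x hx.1 hx.2, sub_zero]
  have i2 : ∫ x in a..b, Complex.exp (c * x) * (T x : ℂ)
      = ∫ x in a..b, Complex.exp (c * x) * ((-(H / (b - a)) * (x - b) : ℝ) : ℂ) := by
    refine intervalIntegral.integral_congr_ae (Filter.Eventually.of_forall fun x hx => ?_)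
    rw [Set.uIoc_of_le hab.le] at hx
    simp only [h4 x hx.1 hx.2]
  have hE : ∀ x : ℝ, ‖Complex.exp (c * x)‖ = 1 := by
    intro x
    have : c * x = ((-2 * Real.pi * ξ * x : ℝ) : ℂ) * Complex.I := by rw [hc]; push_cast; ring
    rw [this, Complex.norm_exp_ofReal_mul_I]
  have e : 𝓕 (fun x : ℝ => (T x : ℂ)) ξ = (((H / a : ℝ) : ℂ) * (1 - Complex.exp (c * a))
      + ((H / (b - a) : ℝ) : ℂ) * (Complex.exp (c * b) - Complex.exp (c * a))) / c ^ 2 := by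
    rw [hF, ← intervalIntegral.integral_add_adjacent_intervals (hii 0 a) (hii a b), i1, i2,
      aux_int_s11 c hc0, aux_int_s11 c hc0]
    have ha' : (a : ℂ) ≠ 0 := by exact_mod_cast ha.ne'
    have hb' : (b : ℂ) - a ≠ 0 := by exact_mod_cast hba.ne'
    push_cast
    simp only [mul_zero, Complex.exp_zero, sub_zero]
    field_simp
    ring
  have hcn : ξ ^ 2 ≤ ‖c ^ 2‖ := by
    rw [norm_pow, hc, norm_mul, Complex.norm_I, mul_one, Complex.norm_real, Real.norm_eq_abs, sq_abs]
    nlinarith [Real.pi_gt_three, sq_nonneg ξ, mul_nonneg (sq_nonneg ξ) (by nlinarith [Real.pi_gt_three] : 0 ≤ (2 * Real.pi)^2 - 1)]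
  have hξ2 : 0 < ξ ^ 2 := by positivity
  rw [e, norm_div, div_eq_mul_inv]
  refine mul_le_mul ?_ (inv_anti₀ hξ2 hcn) (by positivity) (by positivity)
  refine (norm_add_le _ _).trans ?_
  rw [norm_mul, norm_mul, Complex.norm_real, Complex.norm_real, Real.norm_of_nonneg (by positivity),
    Real.norm_of_nonneg (by positivity)]
  have t1 : ‖1 - Complex.exp (c * a)‖ ≤ 2 := by
    refine (norm_sub_le _ _).trans ?_
    rw [hE]; norm_num
  have t2 : ‖Complex.exp (c * b) - Complex.exp (c * a)‖ ≤ 2 := by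
    refine (norm_sub_le _ _).trans ?_
    rw [hE, hE]; norm_num
  have p1 : 0 ≤ H / a := by positivity
  have p2 : 0 ≤ H / (b - a) := by positivity
  nlinarith

lemma aux_expint (n : ℤ) : ∫ x in (0:ℝ)..1, Complex.exp (2 * Real.pi * Complex.I * n * x)
    = if n = 0 then 1 else 0 := by
  split_ifs with h
  · simp [h]
  · have hc : (2 * Real.pi * Complex.I * n : ℂ) ≠ 0 := by simp [h, Real.pi_ne_zero]
    rw [integral_exp_mul_complex hc]
    have : Complex.exp (2 * Real.pi * Complex.I * n * (1:ℝ)) = 1 := by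
      rw [Complex.exp_eq_one_iff]; exact ⟨n, by push_cast; ring⟩
    rw [this]; simp

open FourierTransform in
lemma aux_series {T : ℝ → ℝ} (hT : IsHatFunction T) :
    ∃ (c : ℤ → ℂ) (K : ℝ), 0 ≤ K ∧ (∀ n, n ≠ 0 → ‖c n‖ ≤ K * ((n:ℝ) ^ 2)⁻¹) ∧ Summable (fun n => ‖c n‖) ∧
      ∀ x : ℝ, ((∑' m : ℤ, T (x + m) : ℝ) : ℂ)
        = ∑' n : ℤ, c n * Complex.exp (2 * Real.pi * Complex.I * n * x) := by
  obtain ⟨K, hK, hF⟩ := aux_fourier hT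
  have hcont := aux_cont hT
  have hb : ∀ n : ℤ, n ≠ 0 → ‖𝓕 (fun x : ℝ => (T x : ℂ)) n‖ ≤ K * ((n:ℝ) ^ 2)⁻¹ :=
    fun n hn => hF n (by exact_mod_cast hn)
  have hs : Summable fun n : ℤ => ‖𝓕 (fun x : ℝ => (T x : ℂ)) n‖ := by
    have s0 : Summable fun n : ℤ => 1 / (n:ℝ) ^ 2 := Real.summable_one_div_int_pow.2 one_lt_two
    refine summable_of_isBigO s0 (Asymptotics.IsBigO.of_bound K ?_)
    have : ∀ᶠ n : ℤ in Filter.cofinite, n ≠ 0 := by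
      exact (Set.finite_singleton (0 : ℤ)).eventually_cofinite_notMem
    filter_upwards [this] with n hn
    rw [norm_norm, Real.norm_of_nonneg (by positivity), one_div]
    exact hb n hn
  refine ⟨fun n => 𝓕 (fun x : ℝ => (T x : ℂ)) n, K, hK, hb, hs, fun x => ?_⟩
  have hcs : HasCompactSupport (fun x : ℝ => (T x : ℂ)) := by
    obtain ⟨a, b, H, ha, hab, hH, h1, h2, h3, h4⟩ := hT
    refine HasCompactSupport.intro (isCompact_Icc (a := 0) (b := b)) fun x hx => ?_
    rw [Set.mem_Icc, not_and_or, not_le, not_le] at hx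
    rcases hx with hx | hx
    · simp [h1 x hx]
    · simp [h2 x hx]
  have hO : (fun x : ℝ => (T x : ℂ)) =O[Filter.cocompact ℝ] fun x : ℝ => |x| ^ (-2 : ℝ) := by
    refine Asymptotics.IsBigO.of_bound 1 ?_
    filter_upwards [hcs.compl_mem_cocompact] with x hx
    rw [Set.mem_compl_iff] at hx
    rw [image_eq_zero_of_notMem_tsupport hx, norm_zero]; positivity
  have := Real.tsum_eq_tsum_fourier_of_rpow_decay_of_summable (f := fun x : ℝ => (T x : ℂ))
    (by fun_prop) one_lt_two hO hs.of_norm x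
  rw [Complex.ofReal_tsum, this]
  refine tsum_congr fun n => ?_
  rw [fourier_coe_apply]
  simp

lemma aux_norm (n : ℤ) (x : ℝ) : ‖Complex.exp (2 * Real.pi * Complex.I * n * x)‖ = 1 := by
  have e1 : (2 * Real.pi * Complex.I * n * x : ℂ) = ((2 * Real.pi * (n * x) : ℝ) : ℂ) * Complex.I := by
    push_cast; ring
  rw [e1, Complex.norm_exp_ofReal_mul_I]

lemma aux_mean {τ : ℝ → ℝ} {c : ℤ → ℂ} (hs : Summable fun n => ‖c n‖)
    (h : ∀ x : ℝ, ((τ x : ℝ) : ℂ) = ∑' n : ℤ, c n * Complex.exp (2 * Real.pi * Complex.I * n * x)) :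
    ((∫ x in (0:ℝ)..1, τ x : ℝ) : ℂ) = c 0 := by
  rw [← intervalIntegral.integral_ofReal]
  have := intervalIntegral.hasSum_integral_of_dominated_convergence (μ := volume) (a := 0) (b := 1)
    (F := fun (n : ℤ) (x : ℝ) => c n * Complex.exp (2 * Real.pi * Complex.I * n * x))
    (f := fun x => (τ x : ℂ)) (fun n _ => ‖c n‖)
    (fun n => (Continuous.aestronglyMeasurable (by fun_prop)))
    (fun n => Filter.Eventually.of_forall fun x _ => by rw [norm_mul, aux_norm, mul_one])
    (Filter.Eventually.of_forall fun x _ => hs)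
    (by simp)
    (Filter.Eventually.of_forall fun x _ => by
      rw [h x]
      refine Summable.hasSum (Summable.of_norm ?_)
      simpa only [norm_mul, aux_norm, mul_one] using hs)
  rw [← this.tsum_eq, tsum_eq_single 0]
  · simp
  · intro n hn
    rw [intervalIntegral.integral_const_mul, aux_expint, if_neg hn, mul_zero]

theorem statement11 (T : ℝ → ℝ) (hT : IsHatFunction T) :
    ∀ᵐ α : ℝ ∂volume, Irrational α →
      ∃ C : ℝ, ∀ N : ℕ, 1 ≤ N →
        |(∑ k ∈ Finset.range N, ∑' m : ℤ, T ((k : ℝ) * α + (m : ℝ))) -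
          (N : ℝ) * ∫ x in (0:ℝ)..1, ∑' m : ℤ, T (x + (m : ℝ))| ≤ C := by
  obtain ⟨c, K, hK, hc, hs, hτ⟩ := aux_series hT
  have hmean := aux_mean (τ := fun x => ∑' m : ℤ, T (x + (m : ℝ))) hs hτ
  filter_upwards [aux_ae] with α hα hirr
  refine ⟨∑' n : ℤ, K * ((n:ℝ)^2 * ‖n • (α : UnitAddCircle)‖)⁻¹, fun N _ => ?_⟩
  rw [← Real.norm_eq_abs, ← Complex.norm_real]
  have hk : ∀ (k : ℕ), ((∑' m : ℤ, T ((k : ℝ) * α + (m : ℝ)) : ℝ) : ℂ)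
      = ∑' n : ℤ, c n * (Complex.exp (2 * Real.pi * Complex.I * n * α)) ^ k := by
    intro k
    rw [hτ]
    refine tsum_congr fun n => ?_
    rw [← Complex.exp_nat_mul]
    congr 2; push_cast; ring
  have hsk : ∀ k : ℕ, Summable fun n : ℤ =>
      c n * (Complex.exp (2 * Real.pi * Complex.I * n * α)) ^ k := by
    intro k
    refine Summable.of_norm ?_
    simpa only [norm_mul, norm_pow, aux_norm, one_pow, mul_one] using hs
  rw [Complex.ofReal_sub, Complex.ofReal_mul, hmean, Complex.ofReal_sum]
  simp_rw [hk]
  rw [← Summable.tsum_finsetSum (fun k _ => hsk k),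
    (summable_sum (fun k _ => hsk k)).tsum_eq_add_tsum_ite 0]
  have h0 : ∑ k ∈ Finset.range N, c 0 * (Complex.exp (2 * Real.pi * Complex.I * (0 : ℤ) * α)) ^ k
      - ((N : ℝ) : ℂ) * c 0 = 0 := by
    simp
  rw [add_sub_right_comm, h0, zero_add]
  refine tsum_of_norm_bounded (hα.mul_left K).hasSum fun n => ?_
  split_ifs with hn
  · rw [norm_zero]; positivity
  · rw [← Finset.mul_sum, norm_mul, mul_inv, ← mul_assoc]
    exact mul_le_mul (hc n hn) (aux_geom α hirr n hn N) (norm_nonneg _) (by positivity)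
end

section
/- Let T : ℝ → [0,∞) be a dome function and let τ(x) = ∑_{m ∈ ℤ} T(x + m) be its 1-periodization. Then for almost every irrational α ∈ ℝ (with respect to Lebesgue measure), τ is a bounded remainder function with respect to α: there exists a constant C = C(τ, α) such that |∑_{k=0}^{N−1} τ(kα) − N ∫₀¹ τ(x) dx| ≤ C for all integers N ≥ 1. -/
open MeasureTheory

/-- `T` is a dome function: continuous, nonnegative, supported on `[0, B]` with
`B > 0`, concave and twice differentiable on `(0, B)`, and satisfying the growth
condition `T(x) ≤ c x^{1/m}` and `T(B - x) ≤ c x^{1/m}` for `0 ≤ x < ε`. -/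
def IsDomeFunction (T : ℝ → ℝ) : Prop :=
  ∃ B : ℝ, 0 < B ∧ Continuous T ∧ (∀ x : ℝ, 0 ≤ T x) ∧
    (∀ x : ℝ, x < 0 → T x = 0) ∧
    (∀ x : ℝ, B < x → T x = 0) ∧
    ConcaveOn ℝ (Set.Ioo 0 B) T ∧
    (∀ x ∈ Set.Ioo (0:ℝ) B, DifferentiableAt ℝ T x) ∧
    (∀ x ∈ Set.Ioo (0:ℝ) B, DifferentiableAt ℝ (deriv T) x) ∧
    ∃ ε m c : ℝ, 0 < ε ∧ 0 < m ∧ 0 < c ∧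
      (∀ x : ℝ, 0 ≤ x → x < ε → T x ≤ c * x ^ ((1:ℝ) / m)) ∧
      (∀ x : ℝ, 0 ≤ x → x < ε → T (B - x) ≤ c * x ^ ((1:ℝ) / m))

open FourierTransform in
lemma dome_fourier_aux (T : ℝ → ℝ) (hc : Continuous T) (hs : HasCompactSupport T) (w h : ℝ)
    (hw : |w| * h = 1 / 2) :
    ‖𝓕 (fun x => (T x : ℂ)) w‖ ≤ (1/4) * ∫ x, |T (x + h) + T (x - h) - 2 * T x| := by
  have hTi : Integrable T := hc.integrable_of_hasCompactSupport hs
  set E : ℝ → ℂ := fun x => Complex.exp (((-2 * Real.pi * x * w : ℝ) : ℂ) * Complex.I) with hE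
  have hEn : ∀ x, ‖E x‖ = 1 := fun x => Complex.norm_exp_ofReal_mul_I _
  have hEc : Continuous E := by rw [hE]; fun_prop
  have hexp1 : Complex.exp (Real.pi * Complex.I) = -1 := Complex.exp_pi_mul_I
  have hexp2 : Complex.exp (-(Real.pi * Complex.I)) = -1 := by
    rw [Complex.exp_neg, hexp1]; norm_num
  have hwh : w * h = 1/2 ∨ w * h = -(1/2) := by
    rcases abs_cases w with ⟨h1, _⟩ | ⟨h1, _⟩
    · left; rw [← hw, h1]
    · right; rw [← hw, h1]; ring
  have hEp : ∀ x, E (x + h) = - E x := by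
    intro x
    rcases hwh with h1 | h1
    · have : ((-2 * Real.pi * (x + h) * w : ℝ) : ℂ) * Complex.I
          = ((-2 * Real.pi * x * w : ℝ) : ℂ) * Complex.I + -(Real.pi * Complex.I) := by
        have : (-2 * Real.pi * (x + h) * w : ℝ) = -2 * Real.pi * x * w - Real.pi := by
          linear_combination (-2 * Real.pi) * h1
        rw [this]; push_cast; ring
      simp only [hE]
      rw [this, Complex.exp_add, hexp2]; ring
    · have : ((-2 * Real.pi * (x + h) * w : ℝ) : ℂ) * Complex.I
          = ((-2 * Real.pi * x * w : ℝ) : ℂ) * Complex.I + (Real.pi * Complex.I) := by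
        have : (-2 * Real.pi * (x + h) * w : ℝ) = -2 * Real.pi * x * w + Real.pi := by
          linear_combination (-2 * Real.pi) * h1
        rw [this]; push_cast; ring
      simp only [hE]
      rw [this, Complex.exp_add, hexp1]; ring
  have hEm : ∀ x, E (x - h) = - E x := by
    intro x
    have := hEp (x - h)
    rw [sub_add_cancel] at this
    rw [this, neg_neg]
  have hF : 𝓕 (fun x => (T x : ℂ)) w = ∫ x, E x * (T x : ℂ) := by
    rw [Real.fourier_real_eq_integral_exp_smul]
    simp only [smul_eq_mul, hE]
  have hint : ∀ g : ℝ → ℝ, Integrable g → Integrable (fun x => E x * (g x : ℂ)) := by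
    intro g hg
    refine (hg.ofReal (𝕜 := ℂ)).bdd_mul (c := 1) hEc.aestronglyMeasurable ?_
    exact Filter.Eventually.of_forall fun x => (hEn x).le
  have hip : Integrable (fun x => T (x + h)) := hTi.comp_add_right h
  have him : Integrable (fun x => T (x - h)) := hTi.comp_sub_right h
  have h1 : ∫ x, E x * (T (x + h) : ℂ) = - ∫ x, E x * (T x : ℂ) := by
    rw [← integral_add_right_eq_self (fun x => E x * (T x : ℂ)) h, ← integral_neg]
    congr 1 with x
    rw [hEp]; ring
  have h2 : ∫ x, E x * (T (x - h) : ℂ) = - ∫ x, E x * (T x : ℂ) := by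
    rw [← integral_sub_right_eq_self (fun x => E x * (T x : ℂ)) h, ← integral_neg]
    congr 1 with x
    rw [hEm]; ring
  have h3 : ∫ x, E x * ((T (x + h) + T (x - h) - 2 * T x : ℝ) : ℂ) =
      -4 * 𝓕 (fun x => (T x : ℂ)) w := by
    have : ∀ x, E x * ((T (x + h) + T (x - h) - 2 * T x : ℝ) : ℂ) =
        (E x * (T (x + h) : ℂ) + E x * (T (x - h) : ℂ)) - 2 * (E x * (T x : ℂ)) := by
      intro x; push_cast; ring
    simp_rw [this]
    have hadd : Integrable (fun x => E x * (T (x + h) : ℂ) + E x * (T (x - h) : ℂ)) :=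
      (hint _ hip).add (hint _ him)
    rw [integral_sub hadd ((hint _ hTi).const_mul 2),
      integral_add (hint _ hip) (hint _ him), integral_const_mul, h1, h2, hF]
    ring
  have h4 : 4 * ‖𝓕 (fun x => (T x : ℂ)) w‖ ≤ ∫ x, |T (x + h) + T (x - h) - 2 * T x| := by
    have : 4 * ‖𝓕 (fun x => (T x : ℂ)) w‖ = ‖∫ x, E x * ((T (x + h) + T (x - h) - 2 * T x : ℝ) : ℂ)‖ := by
      rw [h3, norm_mul]; norm_num
    rw [this]
    refine (norm_integral_le_integral_norm _).trans (le_of_eq ?_)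
    congr 1 with x
    rw [norm_mul, hEn, one_mul, Complex.norm_real, Real.norm_eq_abs]
  linarith

lemma dome_second_diff (T : ℝ → ℝ) (B h M : ℝ) (hh : 0 < h) (hc : Continuous T)
    (hs : HasCompactSupport T)
    (h0 : ∀ x, 0 ≤ T x) (hl : ∀ x, x < 0 → T x = 0) (hr : ∀ x, B < x → T x = 0)
    (hconc : ConcaveOn ℝ (Set.Ioo 0 B) T)
    (hM1 : ∀ x, x ≤ 2 * h → T x ≤ M) (hM2 : ∀ x, B - 2 * h ≤ x → T x ≤ M) :
    ∫ x, |T (x + h) + T (x - h) - 2 * T x| ≤ 16 * M * h := by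
  have hTi : Integrable T := hc.integrable_of_hasCompactSupport hs
  have hip : Integrable (fun x => T (x + h)) := hTi.comp_add_right h
  have him : Integrable (fun x => T (x - h)) := hTi.comp_sub_right h
  have hM : 0 ≤ M := (h0 0).trans (hM1 0 (by linarith))
  set D : ℝ → ℝ := fun x => T (x + h) + T (x - h) - 2 * T x with hD
  have hDi : Integrable D := (hip.add him).sub (hTi.const_mul 2)
  have hD0 : ∫ x, D x = 0 := by
    simp only [hD]
    have hadd : Integrable (fun x => T (x + h) + T (x - h)) := hip.add him
    rw [integral_sub hadd (hTi.const_mul 2), integral_add hip him, integral_const_mul,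
      integral_add_right_eq_self T h, integral_sub_right_eq_self T h]
    ring
  set I1 : ℝ → ℝ := (Set.Icc (-h) h).indicator (fun _ => 4 * M) with hI1
  set I2 : ℝ → ℝ := (Set.Icc (B - h) (B + h)).indicator (fun _ => 4 * M) with hI2
  have hi1 : Integrable I1 := by
    rw [hI1, integrable_indicator_iff measurableSet_Icc]; exact integrableOn_const (by simp)
  have hi2 : Integrable I2 := by
    rw [hI2, integrable_indicator_iff measurableSet_Icc]; exact integrableOn_const (by simp)
  have hI1n : ∀ x, 0 ≤ I1 x := by
    have h4M : 0 ≤ 4 * M := by positivity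
    exact fun x => Set.indicator_nonneg (fun _ _ => h4M) x
  have hI2n : ∀ x, 0 ≤ I2 x := by
    have h4M : 0 ≤ 4 * M := by positivity
    exact fun x => Set.indicator_nonneg (fun _ _ => h4M) x
  have key : ∀ x, |D x| ≤ - D x + (I1 x + I2 x) := by
    intro x
    by_cases hx1 : x ∈ Set.Icc (-h) h
    · have e1 : I1 x = 4 * M := by simp only [hI1, Set.indicator_of_mem hx1]
      have e2 := hI2n x
      have a1 := hM1 (x + h) (by linarith [hx1.2])
      have a2 := hM1 (x - h) (by linarith [hx1.2])
      have a3 := h0 x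
      have : D x ≤ 2 * M := by simp only [hD]; linarith
      rw [abs_le]; constructor <;> linarith
    by_cases hx2 : x ∈ Set.Icc (B - h) (B + h)
    · have e1 : I2 x = 4 * M := by simp only [hI2, Set.indicator_of_mem hx2]
      have e2 := hI1n x
      have a1 := hM2 (x + h) (by linarith [hx2.1])
      have a2 := hM2 (x - h) (by linarith [hx2.1])
      have a3 := h0 x
      have : D x ≤ 2 * M := by simp only [hD]; linarith
      rw [abs_le]; constructor <;> linarith
    have hDn : D x ≤ 0 := by
      rw [Set.mem_Icc, not_and_or, not_le, not_le] at hx1 hx2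
      rcases hx1 with hx1 | hx1
      · simp only [hD]
        rw [hl _ (by linarith : x + h < 0), hl _ (by linarith : x - h < 0)]
        linarith [h0 x]
      rcases hx2 with hx2 | hx2
      · have := hconc.2 (show x + h ∈ Set.Ioo 0 B from ⟨by linarith, by linarith⟩)
          (show x - h ∈ Set.Ioo 0 B from ⟨by linarith, by linarith⟩)
          (by norm_num : (0:ℝ) ≤ 1/2) (by norm_num : (0:ℝ) ≤ 1/2) (by norm_num)
        simp only [smul_eq_mul] at this
        rw [show 1/2 * (x + h) + 1/2 * (x - h) = x by ring] at this
        simp only [hD]; linarith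
      · simp only [hD]
        rw [hr _ (by linarith : B < x + h), hr _ (by linarith : B < x - h)]
        linarith [h0 x]
    rw [abs_of_nonpos hDn]
    linarith [hI1n x, hI2n x]
  have i1 : ∫ x, I1 x = 8 * M * h := by
    rw [hI1, integral_indicator measurableSet_Icc, setIntegral_const, Real.volume_real_Icc_of_le (by linarith)]
    simp only [smul_eq_mul]; ring
  have i2 : ∫ x, I2 x = 8 * M * h := by
    rw [hI2, integral_indicator measurableSet_Icc, setIntegral_const, Real.volume_real_Icc_of_le (by linarith)]
    simp only [smul_eq_mul]; ring
  calc ∫ x, |D x| ≤ ∫ x, (- D x + (I1 x + I2 x)) :=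
        integral_mono hDi.abs (hDi.neg.add (hi1.add hi2)) key
    _ = 16 * M * h := by
        have hadd : Integrable (fun x => I1 x + I2 x) := hi1.add hi2
        have hneg : Integrable (fun x => - D x) := hDi.neg
        rw [integral_add hneg hadd, integral_add hi1 hi2, integral_neg, hD0, i1, i2]
        ring

lemma dome_extend (T : ℝ → ℝ) (ε r c K : ℝ) (hε : 0 < ε) (hr : 0 < r) (hc : 0 < c)
    (hK : ∀ x, T x ≤ K) (h : ∀ x, 0 ≤ x → x < ε → T x ≤ c * x ^ r) :
    ∃ c', 0 ≤ c' ∧ ∀ x, 0 ≤ x → T x ≤ c' * x ^ r := by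
  have hp : 0 < ε ^ r := Real.rpow_pos_of_pos hε r
  refine ⟨c + |K| / ε ^ r, by positivity, fun x hx => ?_⟩
  by_cases hxe : x < ε
  · refine (h x hx hxe).trans ?_
    gcongr
    have : 0 ≤ |K| / ε ^ r := by positivity
    linarith
  · push Not at hxe
    have h1 : ε ^ r ≤ x ^ r := Real.rpow_le_rpow hε.le hxe hr.le
    have h2 : |K| ≤ |K| / ε ^ r * x ^ r := by
      rw [div_mul_eq_mul_div, le_div_iff₀ hp]
      gcongr
    have h3 : 0 ≤ c * x ^ r := by positivity
    nlinarith [hK x, le_abs_self K]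

open FourierTransform in
lemma dome_decay (T : ℝ → ℝ) (hT : IsDomeFunction T) :
    ∃ A s : ℝ, 1 < s ∧ 0 ≤ A ∧ ∀ n : ℤ, n ≠ 0 →
      ‖𝓕 (fun x => (T x : ℂ)) (n : ℝ)‖ ≤ A * |(n : ℝ)| ^ (-s) := by
  obtain ⟨B, hB, hc, h0, hl, hr, hconc, -, -, ε, m, c, hε, hm, hcp, hT1, hT2⟩ := hT
  have hs : HasCompactSupport T := by
    refine HasCompactSupport.intro (isCompact_Icc (a := 0) (b := B)) fun x hx => ?_
    rw [Set.mem_Icc, not_and_or, not_le, not_le] at hx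
    exact hx.elim (hl x) (hr x)
  obtain ⟨K, hK⟩ := hc.bounded_above_of_compact_support hs
  have hK' : ∀ x, T x ≤ K := fun x => (le_abs_self _).trans (hK x)
  have hrp : 0 < 1 / m := by positivity
  obtain ⟨c1, hc1, H1⟩ := dome_extend T ε (1/m) c K hε hrp hcp hK' hT1
  obtain ⟨c2, hc2, H2⟩ := dome_extend (fun x => T (B - x)) ε (1/m) c K hε hrp hcp
    (fun x => hK' _) hT2
  refine ⟨2 * (c1 + c2), 1 + 1 / m, by linarith, by positivity, fun n hn => ?_⟩
  have hn' : 0 < |(n : ℝ)| := abs_pos.2 (by exact_mod_cast hn)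
  set h : ℝ := 1 / (2 * |(n : ℝ)|) with hh
  have hhp : 0 < h := by positivity
  set M := (c1 + c2) * (2 * h) ^ (1 / m) with hMdef
  have hM0 : 0 ≤ M := by positivity
  have hM1 : ∀ x, x ≤ 2 * h → T x ≤ M := by
    intro x hx
    rcases lt_or_ge x 0 with h' | h'
    · rw [hl x h']; exact hM0
    · refine (H1 x h').trans ?_
      rw [hMdef]
      gcongr
      linarith
  have hM2 : ∀ x, B - 2 * h ≤ x → T x ≤ M := by
    intro x hx
    rcases lt_or_ge B x with h' | h'
    · rw [hr x h']; exact hM0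
    · have := H2 (B - x) (by linarith)
      simp only [sub_sub_cancel] at this
      refine this.trans ?_
      rw [hMdef]
      have : B - x ≤ 2 * h := by linarith
      have : 0 ≤ B - x := by linarith
      gcongr
      linarith
  have e1 := dome_fourier_aux T hc hs (n : ℝ) h (by rw [hh]; field_simp)
  have e2 := dome_second_diff T B h M hhp hc hs h0 hl hr hconc hM1 hM2
  have e3 : (2 * h) ^ (1 / m) = |(n : ℝ)| ^ (-(1 / m)) := by
    rw [show 2 * h = |(n : ℝ)|⁻¹ by rw [hh]; field_simp, Real.inv_rpow hn'.le, Real.rpow_neg hn'.le]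
  have e4 : |(n : ℝ)| ^ (-(1 + 1 / m)) = |(n : ℝ)|⁻¹ * |(n : ℝ)| ^ (-(1 / m)) := by
    rw [neg_add, Real.rpow_add hn', Real.rpow_neg_one]
  have e5 : h = |(n : ℝ)|⁻¹ / 2 := by rw [hh]; field_simp
  calc _ ≤ 1/4 * (16 * M * h) := e1.trans (by linarith)
    _ = _ := by rw [e4, hMdef, e3, e5]; ring

lemma sin_rpow_intervalIntegrable (p : ℝ) (hp0 : 0 < p) (hp : p < 1) :
    IntervalIntegrable (fun x : ℝ => |Real.sin (Real.pi * x)| ^ (-p)) volume 0 1 := by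
  have h1 : IntervalIntegrable (fun x : ℝ => x ^ (-p)) volume 0 1 :=
    intervalIntegral.intervalIntegrable_rpow' (by linarith)
  have h2 : IntervalIntegrable (fun x : ℝ => (1 - x) ^ (-p)) volume 0 1 := by
    have := (h1.comp_sub_left 1).symm
    simpa using this
  refine (h1.add h2).mono_fun ?_ ?_
  · apply Measurable.aestronglyMeasurable
    fun_prop
  · rw [Set.uIoc_of_le zero_le_one]
    have hne : ∀ᵐ x : ℝ ∂(volume.restrict (Set.Ioc (0:ℝ) 1)), x ≠ 1 :=
      ae_restrict_of_ae (Measure.ae_ne volume 1)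
    filter_upwards [ae_restrict_mem measurableSet_Ioc, hne] with x hx hx1
    have hx0 : 0 < x := hx.1
    have hx1 : x < 1 := lt_of_le_of_ne hx.2 hx1
    have hpi := Real.pi_pos
    have a1 : 0 ≤ x ^ (-p) := by positivity
    have a2 : 0 ≤ (1 - x) ^ (-p) := Real.rpow_nonneg (by linarith) _
    change _ ≤ ‖x ^ (-p) + (1 - x) ^ (-p)‖
    rw [Real.norm_of_nonneg (by positivity), Real.norm_of_nonneg (by positivity)]
    rcases le_total x (1/2) with h | h
    · have : x ≤ |Real.sin (Real.pi * x)| := by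
        have := Real.mul_le_sin (x := Real.pi * x) (by positivity) (by nlinarith)
        rw [show 2 / Real.pi * (Real.pi * x) = 2 * x by field_simp] at this
        exact le_trans (by linarith) (le_abs_self _)
      have := Real.rpow_le_rpow_of_nonpos hx0 this (z := -p) (by linarith)
      linarith
    · have : 1 - x ≤ |Real.sin (Real.pi * x)| := by
        have := Real.mul_le_sin (x := Real.pi * (1 - x)) (by nlinarith) (by nlinarith)
        rw [show 2 / Real.pi * (Real.pi * (1 - x)) = 2 * (1 - x) by field_simp,
          show Real.pi * (1 - x) = Real.pi - Real.pi * x by ring, Real.sin_pi_sub] at this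
        exact le_trans (by linarith) (le_abs_self _)
      have := Real.rpow_le_rpow_of_nonpos (by linarith) this (z := -p) (by linarith)
      linarith

lemma sin_rpow_lintegral (p : ℝ) (hp0 : 0 < p) (hp : p < 1) (K : ℕ) :
    ∃ C : ℝ, 0 ≤ C ∧ ∀ n : ℤ, n ≠ 0 →
      ∫⁻ x in Set.Ioc (-(K:ℝ)) K, ENNReal.ofReal (|Real.sin (Real.pi * (n * x))| ^ (-p))
        ≤ ENNReal.ofReal C := by
  set φ : ℝ → ℝ := fun x : ℝ => |Real.sin (Real.pi * x)| ^ (-p) with hφ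
  have hper : Function.Periodic φ 1 := by
    intro x
    simp only [hφ]
    rw [mul_add, mul_one, Real.sin_add_pi, abs_neg]
  have hφn : ∀ x, 0 ≤ φ x := fun x => by simp only [hφ]; positivity
  have hi : ∀ a b, IntervalIntegrable φ volume a b := fun a b =>
    hper.intervalIntegrable₀ one_ne_zero (sin_rpow_intervalIntegrable p hp0 hp) a b
  refine ⟨2 * K * ∫ x in (0:ℝ)..1, φ x, ?_, fun n hn => ?_⟩
  · have := intervalIntegral.integral_nonneg (μ := volume) (zero_le_one (α := ℝ)) (fun x _ => hφn x)
    positivity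
  have hn' : (n : ℝ) ≠ 0 := by exact_mod_cast hn
  have hin : IntervalIntegrable (fun x => φ (n * x)) volume (-(K:ℝ)) K := by
    have := (hi (n * -(K:ℝ)) (n * K)).comp_mul_left (c := (n : ℝ))
    rwa [mul_div_cancel_left₀ _ hn', mul_div_cancel_left₀ _ hn'] at this
  have hK : -(K:ℝ) ≤ K := by have : (0:ℝ) ≤ K := by positivity
                             linarith
  change ∫⁻ x in Set.Ioc (-(K:ℝ)) K, ENNReal.ofReal (φ (n * x)) ≤ _
  rw [← ofReal_integral_eq_lintegral_ofReal]
  · apply ENNReal.ofReal_le_ofReal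
    rw [← intervalIntegral.integral_of_le hK, intervalIntegral.integral_comp_mul_left _ hn']
    have := hper.intervalIntegral_add_zsmul_eq (n * (2 * K)) (n * -(K:ℝ)) hi
    have e : (n * -(K:ℝ)) + (n * (2 * K) : ℤ) • (1:ℝ) = n * K := by
      simp; ring
    rw [e, hper.intervalIntegral_add_eq _ 0, zero_add] at this
    rw [this]
    apply le_of_eq
    simp only [zsmul_eq_mul, smul_eq_mul]
    push_cast
    field_simp
  · exact (intervalIntegrable_iff_integrableOn_Ioc_of_le hK).1 hin
  · exact Filter.Eventually.of_forall fun x => hφn _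

lemma ae_summable_sin (s : ℝ) (hs : 1 < s) :
    ∀ᵐ α : ℝ ∂volume, Summable fun n : ℤ => |(n:ℝ)| ^ (-s) * |Real.sin (Real.pi * (n * α))|⁻¹ := by
  obtain ⟨p, hp1, hp2⟩ : ∃ p : ℝ, 1 / s < p ∧ p < 1 := exists_between (by
    rw [div_lt_one (by linarith)]; exact hs)
  have hs0 : 0 < s := by linarith
  have hp0 : 0 < p := lt_trans (by positivity) hp1
  have hsp : 1 < s * p := by
    rw [div_lt_iff₀ hs0] at hp1; linarith
  suffices H : ∀ K : ℕ, ∀ᵐ α : ℝ ∂(volume.restrict (Set.Ioc (-(K:ℝ)) K)),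
      Summable fun n : ℤ => |(n:ℝ)| ^ (-s) * |Real.sin (Real.pi * (n * α))|⁻¹ by
    have hU : (⋃ K : ℕ, Set.Ioc (-(K:ℝ)) K) = Set.univ := by
      rw [Set.eq_univ_iff_forall]
      intro x
      obtain ⟨K, hK⟩ := exists_nat_gt |x|
      rw [abs_lt] at hK
      exact Set.mem_iUnion.2 ⟨K, hK.1, hK.2.le⟩
    have := (ae_restrict_iUnion_iff (μ := volume) (fun K : ℕ => Set.Ioc (-(K:ℝ)) K) _).2 H
    rwa [hU, Measure.restrict_univ] at this
  intro K
  obtain ⟨C, hC0, hC⟩ := sin_rpow_lintegral p hp0 hp2 K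
  set g : ℤ → ℝ → ℝ := fun n α =>
    |(n:ℝ)| ^ (-(s * p)) * |Real.sin (Real.pi * (n * α))| ^ (-p) with hg
  have hgn : ∀ n α, 0 ≤ g n α := fun n α => by simp only [hg]; positivity
  have hgm : ∀ n, Measurable (g n) := fun n => by simp only [hg]; fun_prop
  have hsum : Summable fun n : ℤ => |(n:ℝ)| ^ (-(s * p)) * C :=
    (Real.summable_abs_int_rpow hsp).mul_right C
  have hle : ∀ n : ℤ, ∫⁻ x in Set.Ioc (-(K:ℝ)) K, ENNReal.ofReal (g n x) ≤
      ENNReal.ofReal (|(n:ℝ)| ^ (-(s * p)) * C) := by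
    intro n
    simp only [hg]
    simp_rw [fun x : ℝ => ENNReal.ofReal_mul (q := |Real.sin (Real.pi * (n * x))| ^ (-p))
      (by positivity : 0 ≤ |(n:ℝ)| ^ (-(s * p)))]
    rw [lintegral_const_mul _ (by fun_prop), ENNReal.ofReal_mul (by positivity)]
    by_cases hn : n = 0
    · subst hn
      simp [Real.zero_rpow (by linarith : -(s*p) ≠ 0)]
    · gcongr; exact hC n hn
  have hfin : ∫⁻ x in Set.Ioc (-(K:ℝ)) K, ∑' n : ℤ, ENNReal.ofReal (g n x) ≠ ⊤ := by
    rw [lintegral_tsum fun n => (hgm n).ennreal_ofReal.aemeasurable]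
    refine ne_top_of_le_ne_top ?_ (ENNReal.tsum_le_tsum hle)
    exact hsum.tsum_ofReal_ne_top
  have hae := ae_lt_top (Measurable.tsum fun n => (hgm n).ennreal_ofReal) hfin
  filter_upwards [hae] with α hα
  have hsg : Summable fun n : ℤ => g n α := by
    have := ENNReal.summable_toReal hα.ne
    simpa only [ENNReal.toReal_ofReal (hgn _ α)] using this
  have hev : ∀ᶠ n in Filter.cofinite, g n α < 1 :=
    hsg.tendsto_cofinite_zero.eventually_lt_const (by norm_num)
  refine Summable.of_norm_bounded_eventually hsg ?_
  filter_upwards [hev] with n hn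
  have e : g n α ^ (1 / p) = |(n:ℝ)| ^ (-s) * |Real.sin (Real.pi * (n * α))|⁻¹ := by
    simp only [hg]
    rw [Real.mul_rpow (by positivity) (by positivity), ← Real.rpow_mul (abs_nonneg _),
      ← Real.rpow_mul (abs_nonneg _), ← Real.rpow_neg_one]
    congr 2 <;> field_simp
  rw [Real.norm_of_nonneg (by positivity), ← e]
  apply Real.rpow_le_self_of_le_one (hgn _ _) hn.le
  rw [le_div_iff₀ hp0]; linarith

lemma dome_integral (T : ℝ → ℝ) (B : ℝ) (hc : Continuous T) (hs : HasCompactSupport T)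
    (hl : ∀ x, x < 0 → T x = 0) (hr : ∀ x, B < x → T x = 0) :
    ∫ x in (0:ℝ)..1, ∑' m : ℤ, T (x + (m : ℝ)) = ∫ x, T x := by
  have hTi : Integrable T := hc.integrable_of_hasCompactSupport hs
  rw [← hTi.hasSum_intervalIntegral_comp_add_int.tsum_eq]
  let f : ℤ → C(ℝ, ℝ) := fun m => ⟨fun x => T (x + m), by fun_prop⟩
  refine (intervalIntegral.tsum_intervalIntegral_eq_of_summable_norm (f := f) ?_).symm
  refine summable_of_ne_finset_zero (s := Finset.Icc (-1) ⌈B⌉) fun m hm => ?_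
  rw [norm_eq_zero]
  ext ⟨x, hx⟩
  have hx' : x ∈ Set.Icc (0:ℝ) 1 := by
    rw [← Set.uIcc_of_le zero_le_one]; exact hx
  change T (x + m) = 0
  rw [Finset.mem_Icc, not_and_or, not_le, not_le] at hm
  rcases hm with hm | hm
  · apply hl
    have : m ≤ -2 := by omega
    have : (m : ℝ) ≤ -2 := by exact_mod_cast this
    linarith [hx'.2]
  · apply hr
    have : B ≤ m - 1 := Int.ceil_lt_iff.1 hm
    linarith [hx'.1]

lemma geom_bound (x : ℝ) (N : ℕ) (hx : Real.sin (Real.pi * x) ≠ 0) :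
    ‖∑ k ∈ Finset.range N, Complex.exp (Complex.I * ((2 * Real.pi * x : ℝ) : ℂ)) ^ k‖ ≤
      |Real.sin (Real.pi * x)|⁻¹ := by
  set z := Complex.exp (Complex.I * ((2 * Real.pi * x : ℝ) : ℂ)) with hz
  have hzn : ‖z‖ = 1 := by rw [hz, mul_comm]; exact Complex.norm_exp_ofReal_mul_I _
  have h1 : ‖z - 1‖ = 2 * |Real.sin (Real.pi * x)| := by
    rw [hz, Complex.norm_exp_I_mul_ofReal_sub_one, norm_mul, Real.norm_eq_abs, Real.norm_eq_abs,
      show 2 * Real.pi * x / 2 = Real.pi * x by ring]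
    norm_num
  have hp : 0 < |Real.sin (Real.pi * x)| := abs_pos.2 hx
  have hz1 : z ≠ 1 := by
    intro h
    rw [h, sub_self, norm_zero] at h1
    linarith
  rw [geom_sum_eq hz1, norm_div, h1]
  have h2 : ‖z ^ N - 1‖ ≤ 2 := by
    refine (norm_sub_le _ _).trans ?_
    rw [norm_pow, hzn]; norm_num
  rw [div_le_iff₀ (by positivity)]
  have : |Real.sin (Real.pi * x)|⁻¹ * (2 * |Real.sin (Real.pi * x)|) = 2 := by
    field_simp
  linarith

theorem statement12 (T : ℝ → ℝ) (hT : IsDomeFunction T) :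
    ∀ᵐ α : ℝ ∂volume, Irrational α →
      ∃ C : ℝ, ∀ N : ℕ, 1 ≤ N →
        |(∑ k ∈ Finset.range N, ∑' m : ℤ, T ((k : ℝ) * α + (m : ℝ))) -
          (N : ℝ) * ∫ x in (0:ℝ)..1, ∑' m : ℤ, T (x + (m : ℝ))| ≤ C := by
  obtain ⟨A, s, hs1, hA, hdec⟩ := dome_decay T hT
  obtain ⟨B, hB, hc, h0, hl, hr, -⟩ := hT
  have hs : HasCompactSupport T := by
    refine HasCompactSupport.intro (isCompact_Icc (a := 0) (b := B)) fun x hx => ?_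
    rw [Set.mem_Icc, not_and_or, not_le, not_le] at hx
    exact hx.elim (hl x) (hr x)
  set F : ℤ → ℂ := fun n => FourierTransform.fourier (fun x : ℝ => (T x : ℂ)) (n : ℝ) with hF
  have hFs : Summable fun n => ‖F n‖ := by
    refine Summable.of_norm_bounded_eventually ((Real.summable_abs_int_rpow hs1).mul_left A) ?_
    rw [Filter.eventually_cofinite]
    refine (Set.finite_singleton (0 : ℤ)).subset fun n hn => ?_
    by_contra hne
    apply hn
    rw [norm_norm]
    exact hdec n hne
  have hF0 : F 0 = ((∫ x in (0:ℝ)..1, ∑' m : ℤ, T (x + (m : ℝ)) : ℝ) : ℂ) := by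
    rw [dome_integral T B hc hs hl hr, hF]
    simp only [Real.fourier_real_eq_integral_exp_smul]
    rw [← integral_complex_ofReal]
    simp
  have hpoisson : ∀ x : ℝ, ((∑' m : ℤ, T (x + (m : ℝ)) : ℝ) : ℂ) =
      ∑' n : ℤ, F n * fourier n (x : UnitAddCircle) := by
    intro x
    rw [Complex.ofReal_tsum]
    have hsC : HasCompactSupport (fun x : ℝ => (T x : ℂ)) := hs.comp_left Complex.ofReal_zero
    refine Real.tsum_eq_tsum_fourier_of_rpow_decay_of_summable (f := fun x : ℝ => (T x : ℂ))
      (by fun_prop) one_lt_two ?_ hFs.of_norm x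
    have hz0 : Asymptotics.IsBigO (Filter.cocompact ℝ) (fun _ : ℝ => (0:ℂ)) (fun x : ℝ => |x| ^ (-(2:ℝ))) :=
      Asymptotics.isBigO_zero _ _
    refine Filter.EventuallyEq.trans_isBigO ?_ hz0
    rw [hasCompactSupport_iff_eventuallyEq, Filter.coclosedCompact_eq_cocompact] at hsC
    exact hsC
  filter_upwards [ae_summable_sin s hs1] with α hα hirr
  refine ⟨∑' n : ℤ, A * (|(n:ℝ)| ^ (-s) * |Real.sin (Real.pi * (n * α))|⁻¹), fun N _ => ?_⟩
  set z : ℤ → ℂ := fun n => Complex.exp (Complex.I * ((2 * Real.pi * (n * α) : ℝ) : ℂ)) with hz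
  have hfz : ∀ (n : ℤ) (k : ℕ), fourier n (((k:ℝ) * α : ℝ) : UnitAddCircle) = z n ^ k := by
    intro n k
    rw [fourier_coe_apply, hz]
    simp only
    rw [← Complex.exp_nat_mul]
    congr 1
    push_cast
    ring
  have hsm : ∀ k ∈ Finset.range N, Summable fun n : ℤ => F n * z n ^ k := by
    intro k _
    refine Summable.of_norm_bounded hFs fun n => ?_
    have : ‖z n‖ = 1 := by
      simp only [hz]; rw [mul_comm]; exact Complex.norm_exp_ofReal_mul_I _
    rw [norm_mul, norm_pow, this, one_pow, mul_one]
  set G : ℤ → ℂ := fun n => F n * ∑ k ∈ Finset.range N, z n ^ k with hG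
  have hGs : Summable G := by
    have := summable_sum hsm
    simpa only [hG, Finset.mul_sum] using this
  have hsum : ((∑ k ∈ Finset.range N, ∑' m : ℤ, T ((k : ℝ) * α + (m : ℝ)) : ℝ) : ℂ) = ∑' n, G n := by
    rw [Complex.ofReal_sum]
    simp_rw [hpoisson, hfz]
    rw [← Summable.tsum_finsetSum hsm]
    simp only [hG, Finset.mul_sum]
  have hG0 : G 0 = N * F 0 := by
    simp only [hG, hz]
    simp [mul_comm]
  rw [← Real.norm_eq_abs, ← Complex.norm_real, Complex.ofReal_sub, Complex.ofReal_mul, hsum, ← hF0,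
    hGs.tsum_eq_add_tsum_ite 0, hG0, Complex.ofReal_natCast, add_sub_cancel_left]
  refine tsum_of_norm_bounded (hα.mul_left A).hasSum fun n => ?_
  split_ifs with hn
  · rw [norm_zero]; positivity
  · have hsin : Real.sin (Real.pi * (n * α)) ≠ 0 := by
      intro h
      rw [Real.sin_eq_zero_iff] at h
      obtain ⟨j, hj⟩ := h
      have hj' : (j : ℝ) = n * α := by
        have := Real.pi_pos
        rw [mul_comm] at hj
        exact mul_left_cancel₀ this.ne' hj
      exact (hirr.intCast_mul hn).ne_int j hj'.symm
    simp only [hG]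
    rw [norm_mul, ← mul_assoc]
    exact mul_le_mul (hdec n hn) (geom_bound (n * α) N hsin) (norm_nonneg _) (by positivity)
end

section
/- Let T : ℝ → [0,∞) be a hat function or a dome function and let τ(x) = ∑_{m ∈ ℤ} T(x + m) be its 1-periodization. Then for almost every irrational α ∈ ℝ (with respect to Lebesgue measure), there exists a constant C = C(τ, α) such that |∑_{k=0}^{N−1} τ(kα + x₀) − N ∫₀¹ τ(x) dx| ≤ C for all integers N ≥ 1 and every shift x₀ ∈ ℝ; in particular the constant C is independent of N and of x₀. -/
open MeasureTheory

lemma lintegral_norm_rpow_lt_top (p : ℝ) (hp : p < 1) :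
    ∫⁻ t : UnitAddCircle, ENNReal.ofReal (‖t‖ ^ (-p)) < ⊤ := by
  have hm := UnitAddCircle.measurePreserving_mk (-(1/2))
  have hmeas : Measurable (fun t : UnitAddCircle => ENNReal.ofReal (‖t‖ ^ (-p))) := by fun_prop
  rw [← hm.lintegral_comp hmeas]
  have hint : IntervalIntegrable (fun x : ℝ => |x| ^ (-p)) volume (-(1/2)) (-(1/2) + 1) := by
    have h1 : IntervalIntegrable (fun x : ℝ => |x| ^ (-p)) volume 0 (-(1/2)+1) := by
      refine (intervalIntegral.intervalIntegrable_rpow' (r := -p) (by linarith)).congr ?_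
      intro x hx
      rw [Set.uIoc_of_le (by norm_num)] at hx
      simp [abs_of_pos hx.1]
    refine IntervalIntegrable.trans (b := 0) ?_ h1
    have := (IntervalIntegrable.iff_comp_neg (f := fun x : ℝ => |x| ^ (-p))).1 h1
    simp only [abs_neg] at this
    norm_num at this ⊢
    exact this.symm
  rw [intervalIntegrable_iff_integrableOn_Ioc_of_le (by norm_num)] at hint
  have h2 := hint.lintegral_lt_top
  refine lt_of_le_of_lt (le_of_eq ?_) h2
  refine setLIntegral_congr_fun measurableSet_Ioc ?_
  intro x hx
  have : ‖(x : UnitAddCircle)‖ = |x| := by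
    rw [AddCircle.norm_coe_eq_abs_iff 1 one_ne_zero, abs_le]
    simp only [Set.mem_Ioc] at hx
    norm_num at hx ⊢
    constructor <;> linarith [hx.1, hx.2]
  simp only [this]

lemma pointwise_summable (s : ℝ) (hs : 0 < s) (hs1 : s ≤ 1) (v : ℤ → ℝ) (hv : ∀ n, 0 ≤ v n)
    (h : Summable (fun n : ℤ => |(n:ℝ)| ^ (-(1 + s/2)) * v n ^ (-(1 / (1 + s/3))))) :
    Summable (fun n : ℤ => |(n:ℝ)| ^ (-(1 + s)) * (v n)⁻¹) := by
  have hnn : ∀ n : ℤ, 0 ≤ |(n:ℝ)| ^ (-(1 + s/2)) * v n ^ (-(1 / (1 + s/3))) := fun n =>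
    mul_nonneg (Real.rpow_nonneg (abs_nonneg _) _) (Real.rpow_nonneg (hv n) _)
  set G := ∑' n : ℤ, |(n:ℝ)| ^ (-(1 + s/2)) * v n ^ (-(1 / (1 + s/3))) with hG
  have hle : ∀ n : ℤ, |(n:ℝ)| ^ (-(1 + s/2)) * v n ^ (-(1 / (1 + s/3))) ≤ G := fun n =>
    h.le_tsum n (fun j _ => hnn j)
  refine Summable.of_nonneg_of_le (fun n => mul_nonneg (Real.rpow_nonneg (abs_nonneg _) _)
    (inv_nonneg.2 (hv n))) (fun n => ?_) (h.mul_left (G ^ (s/3)))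
  have hG0 : 0 ≤ G := tsum_nonneg hnn
  have hR : 0 ≤ G ^ (s/3) * (|(n:ℝ)| ^ (-(1 + s/2)) * v n ^ (-(1 / (1 + s/3)))) :=
    mul_nonneg (Real.rpow_nonneg hG0 _) (hnn n)
  rcases eq_or_ne n 0 with rfl | hn
  · simp only [Int.cast_zero, abs_zero] at hR ⊢
    rw [Real.zero_rpow (by linarith), zero_mul]
    exact hR
  rcases (hv n).eq_or_lt with h0 | hpos
  · rw [← h0] at hR ⊢
    simpa using hR
  have hx1 : 1 ≤ |(n:ℝ)| := by
    exact_mod_cast Int.one_le_abs hn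
  set x := |(n:ℝ)|
  have hx0 : 0 < x := by linarith
  set w := v n ^ (-(1 / (1 + s/3))) with hw
  have hw0 : 0 < w := Real.rpow_pos_of_pos hpos _
  have hinv : (v n)⁻¹ = w * w ^ (s/3) := by
    rw [hw, ← Real.rpow_mul hpos.le, ← Real.rpow_add hpos, ← Real.rpow_neg_one]
    congr 1
    field_simp
    ring
  have hwle : w ≤ G * x ^ (1 + s/2) := by
    have := hle n
    rw [Real.rpow_neg hx0.le, inv_mul_le_iff₀ (Real.rpow_pos_of_pos hx0 _)] at this
    linarith
  have h1 : w ^ (s/3) ≤ G ^ (s/3) * x ^ ((1 + s/2) * (s/3)) := by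
    rw [Real.rpow_mul hx0.le, ← Real.mul_rpow hG0 (Real.rpow_nonneg hx0.le _)]
    exact Real.rpow_le_rpow hw0.le hwle (by linarith)
  have h2 : x ^ (-(1+s)) * x ^ ((1 + s/2) * (s/3)) ≤ x ^ (-(1 + s/2)) := by
    rw [← Real.rpow_add hx0]
    exact Real.rpow_le_rpow_of_exponent_le hx1 (by nlinarith)
  calc x ^ (-(1+s)) * (v n)⁻¹ = x ^ (-(1+s)) * w * w ^ (s/3) := by rw [hinv]; ring
    _ ≤ x ^ (-(1+s)) * w * (G ^ (s/3) * x ^ ((1 + s/2) * (s/3))) := by gcongr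
    _ = G ^ (s/3) * w * (x ^ (-(1+s)) * x ^ ((1 + s/2) * (s/3))) := by ring
    _ ≤ G ^ (s/3) * w * x ^ (-(1 + s/2)) := by gcongr
    _ = _ := by ring

lemma ae_real_of_ae_circle (P : UnitAddCircle → Prop) (h : ∀ᵐ t : UnitAddCircle, P t) :
    ∀ᵐ x : ℝ, P (x : UnitAddCircle) := by
  have h1 : ∀ a : ℤ, ∀ᵐ x : ℝ ∂(volume.restrict (Set.Ioc (a:ℝ) (a + 1))),
      P (x : UnitAddCircle) := fun a =>
    (UnitAddCircle.measurePreserving_mk (a:ℝ)).quasiMeasurePreserving.ae h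
  have h2 : ∀ᵐ x : ℝ, ∀ a : ℤ, x ∈ Set.Ioc (a:ℝ) (a + 1) → P (x : UnitAddCircle) := by
    rw [ae_all_iff]
    exact fun a => (ae_restrict_iff' measurableSet_Ioc).1 (h1 a)
  filter_upwards [h2] with x hx
  refine hx (⌈x⌉ - 1) ⟨?_, ?_⟩
  · push_cast; linarith [Int.ceil_lt_add_one x]
  · push_cast; linarith [Int.le_ceil x]

lemma ae_summable (s : ℝ) (hs : 0 < s) (hs1 : s ≤ 1) :
    ∀ᵐ α : ℝ, Summable (fun n : ℤ => |(n:ℝ)| ^ (-(1 + s)) * ‖n • (α : UnitAddCircle)‖⁻¹) := by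
  apply ae_real_of_ae_circle (fun t => Summable (fun n : ℤ => |(n:ℝ)| ^ (-(1 + s)) * ‖n • t‖⁻¹))
  set p := 1 / (1 + s/3) with hp
  have hp0 : 0 < p := by positivity
  have hp1 : p < 1 := by rw [hp, div_lt_one (by linarith)]; linarith
  have hI := lintegral_norm_rpow_lt_top p hp1
  have hmeas : ∀ n : ℤ, Measurable (fun t : UnitAddCircle =>
      ENNReal.ofReal (|(n:ℝ)| ^ (-(1 + s/2)) * ‖n • t‖ ^ (-p))) := by
    intro n
    have : Measurable (fun t : UnitAddCircle => n • t) := (continuous_zsmul n).measurable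
    fun_prop
  have key : ∫⁻ t : UnitAddCircle, ∑' n : ℤ,
      ENNReal.ofReal (|(n:ℝ)| ^ (-(1 + s/2)) * ‖n • t‖ ^ (-p)) ≠ ⊤ := by
    rw [lintegral_tsum (fun n => (hmeas n).aemeasurable)]
    have hterm : ∀ n : ℤ, ∫⁻ t : UnitAddCircle,
        ENNReal.ofReal (|(n:ℝ)| ^ (-(1 + s/2)) * ‖n • t‖ ^ (-p)) ≤
        ENNReal.ofReal (|(n:ℝ)| ^ (-(1 + s/2))) *
          ∫⁻ t : UnitAddCircle, ENNReal.ofReal (‖t‖ ^ (-p)) := by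
      intro n
      rcases eq_or_ne n 0 with rfl | hn
      · simp [Real.zero_rpow (show -(1 + s/2) ≠ 0 by linarith),
          Real.zero_rpow (show -(s/2) + -1 ≠ 0 by linarith)]
      have hmp := MeasureTheory.Measure.measurePreserving_zsmul (volume : Measure UnitAddCircle) hn
      have hg : Measurable (fun t : UnitAddCircle => ENNReal.ofReal (‖t‖ ^ (-p))) := by fun_prop
      rw [← hmp.lintegral_comp hg, ← lintegral_const_mul]
      · refine le_of_eq (lintegral_congr fun t => ?_)
        rw [ENNReal.ofReal_mul (Real.rpow_nonneg (abs_nonneg _) _)]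
      · exact hg.comp hmp.measurable
    refine ne_top_of_le_ne_top ?_ (ENNReal.tsum_le_tsum hterm)
    rw [ENNReal.tsum_mul_right]
    refine ENNReal.mul_ne_top ?_ hI.ne
    exact (Real.summable_abs_int_rpow (by linarith : 1 < 1 + s/2)).tsum_ofReal_ne_top
  have := ae_lt_top (Measurable.tsum hmeas) key
  filter_upwards [this] with t ht
  refine pointwise_summable s hs hs1 _ (fun n => norm_nonneg _) ?_
  have h3 := ENNReal.summable_toReal ht.ne
  refine h3.congr fun n => ?_
  rw [ENNReal.toReal_ofReal]
  exact mul_nonneg (Real.rpow_nonneg (abs_nonneg _) _) (Real.rpow_nonneg (norm_nonneg _) _)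

lemma geom_bound_s13 (α x₀ : ℝ) (n : ℤ) (h : n • (α : UnitAddCircle) ≠ 0) (N : ℕ) :
    ‖∑ k ∈ Finset.range N, fourier n (((k:ℝ) * α + x₀ : ℝ) : UnitAddCircle)‖
      ≤ ‖n • (α : UnitAddCircle)‖⁻¹ := by
  set z : ℂ := fourier n (α : UnitAddCircle) with hz
  have hzn : ‖z‖ = 1 := by rw [hz, fourier_apply, Circle.norm_coe]
  have hterm : ∀ k : ℕ, fourier n (((k:ℝ) * α + x₀ : ℝ) : UnitAddCircle)
      = z ^ k * fourier n (x₀ : UnitAddCircle) := by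
    intro k
    rw [hz, AddCircle.coe_add, fourier_apply, smul_add, AddCircle.toCircle_add, fourier_apply,
      fourier_apply, Circle.coe_mul, ← Circle.coe_pow, ← AddCircle.toCircle_nsmul]
    congr 3
    rw [smul_comm, ← AddCircle.coe_nsmul, nsmul_eq_mul]
  simp_rw [hterm]
  rw [← Finset.sum_mul, norm_mul]
  have h1 : ‖fourier n (x₀ : UnitAddCircle)‖ = 1 := by rw [fourier_apply, Circle.norm_coe]
  rw [h1, mul_one]
  have hnp : 0 < ‖n • (α : UnitAddCircle)‖ := norm_pos_iff.2 h
  have hlow : 4 * ‖n • (α : UnitAddCircle)‖ ≤ ‖z - 1‖ := by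
    set y : ℝ := n * α - round (n * α) with hy
    have hyc : n • (α : UnitAddCircle) = (y : UnitAddCircle) := by
      rw [hy, ← AddCircle.coe_zsmul, zsmul_eq_mul, AddCircle.coe_sub]
      have : ((round (n * α) : ℝ) : UnitAddCircle) = 0 := by
        have := AddCircle.coe_zsmul 1 (x := (1:ℝ)) (n := round (n*α))
        simpa using this
      rw [this, sub_zero]
    have hy2 : |y| ≤ 1/2 := abs_sub_round _
    have hny : ‖n • (α : UnitAddCircle)‖ = |y| := by
      rw [hyc, AddCircle.norm_coe_eq_abs_iff 1 one_ne_zero]; simpa using hy2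
    have hze : z = Complex.exp (Complex.I * ((2 * Real.pi * y : ℝ) : ℂ)) := by
      rw [hz, fourier_apply, hyc, AddCircle.toCircle_apply_mk, Circle.coe_exp]
      congr 1
      push_cast
      ring
    rw [hny, hze, Complex.norm_exp_I_mul_ofReal_sub_one, norm_mul, Real.norm_eq_abs,
      Real.norm_eq_abs]
    have hpi := Real.pi_pos
    have e : 2 * Real.pi * y / 2 = Real.pi * y := by ring
    have := Real.mul_abs_le_abs_sin (x := Real.pi * y) (by
      rw [abs_mul, abs_of_pos hpi]; nlinarith)
    rw [abs_mul, abs_of_pos hpi] at this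
    have e2 : 2 / Real.pi * (Real.pi * |y|) = 2 * |y| := by field_simp
    rw [e, abs_of_pos (by norm_num : (0:ℝ) < 2)]
    linarith
  have hz1 : z ≠ 1 := by
    intro hh
    rw [hh, sub_self, norm_zero] at hlow
    linarith
  rw [geom_sum_eq hz1, norm_div, ← one_div, div_le_div_iff₀ (by linarith) hnp]
  have : ‖z ^ N - 1‖ ≤ 2 := by
    refine (norm_sub_le _ _).trans ?_
    rw [norm_pow, hzn]; norm_num
  nlinarith

lemma fourier_translate (f : ℝ → ℂ) (h w : ℝ) (hh : ((Real.fourierChar (h * w) : Circle) : ℂ) = -1) :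
    ∫ v : ℝ, (Real.fourierChar (-(v * w)) : Circle) • f (v + h) =
      - ∫ v : ℝ, (Real.fourierChar (-(v * w)) : Circle) • f v := by
  have : (fun v : ℝ => (Real.fourierChar (-(v * w)) : Circle) • f (v + h)) =
      fun v : ℝ => (fun x : ℝ => -((Real.fourierChar (-(x * w)) : Circle) • f x)) (v + h) := by
    ext1 v
    have e : -(v * w) = -((v + h) * w) + h * w := by ring
    simp only [e, AddChar.map_add_eq_mul, Circle.smul_def, Circle.coe_mul, hh, smul_eq_mul]
    ring
  rw [this, integral_add_right_eq_self (fun x : ℝ => -((Real.fourierChar (-(x * w)) : Circle) • f x)) h,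
    integral_neg]

lemma integral_secondDiff (T : ℝ → ℝ) (B s c : ℝ) (hs : 0 < s) (hc : 0 ≤ c)
    (hint : Integrable T)
    (hnn : ∀ x, 0 ≤ T x) (h0 : ∀ x < 0, T x = 0) (hB : ∀ x, B < x → T x = 0)
    (hconc : ConcaveOn ℝ (Set.Ioo 0 B) T)
    (hl : ∀ x, T x ≤ c * |x| ^ s) (hr : ∀ x, T (B - x) ≤ c * |x| ^ s) (h : ℝ) (hh : 0 < h) :
    ∫ x, |T (x + h) + T (x + -h) - 2 * T x| ≤ 16 * c * h * (2 * h) ^ s := by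
  set D : ℝ → ℝ := fun x => T (x + h) + T (x + -h) - 2 * T x with hD
  have i1 := hint.comp_add_right h
  have i2 := hint.comp_add_right (-h)
  have hDi : Integrable D := (i1.add i2).sub (hint.const_mul 2)
  have hD0 : ∫ x, D x = 0 := by
    have i12 : Integrable (fun x => T (x + h) + T (x + -h)) := i1.add i2
    simp only [hD]
    rw [integral_sub i12 (hint.const_mul 2), integral_add i1 i2,
      integral_add_right_eq_self, integral_add_right_eq_self, integral_const_mul]
    ring
  set K := 2 * c * (2 * h) ^ s with hK
  have hK0 : 0 ≤ K := by positivity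
  set E : ℝ → ℝ := fun x => (Set.Icc (-h) h).indicator (fun _ => K) x +
    (Set.Icc (B - h) (B + h)).indicator (fun _ => K) x with hE
  have iE1 : Integrable ((Set.Icc (-h) h).indicator (fun _ => K)) :=
    (integrable_indicator_iff measurableSet_Icc).2 (by simp)
  have iE2 : Integrable ((Set.Icc (B - h) (B + h)).indicator (fun _ => K)) :=
    (integrable_indicator_iff measurableSet_Icc).2 (by simp)
  have hEi : Integrable E := iE1.add iE2
  have hEv : ∫ x, E x = 4 * h * K := by
    simp only [hE]
    rw [integral_add iE1 iE2, integral_indicator measurableSet_Icc,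
      integral_indicator measurableSet_Icc]
    simp only [setIntegral_const, measureReal_def, Real.volume_Icc, smul_eq_mul]
    rw [ENNReal.toReal_ofReal (by linarith), ENNReal.toReal_ofReal (by linarith)]
    ring
  have hi1 : ∀ x, 0 ≤ (Set.Icc (-h) h).indicator (fun _ => K) x := fun x =>
    Set.indicator_nonneg (fun _ _ => hK0) x
  have hi2 : ∀ x, 0 ≤ (Set.Icc (B - h) (B + h)).indicator (fun _ => K) x := fun x =>
    Set.indicator_nonneg (fun _ _ => hK0) x
  have hbl : ∀ y, |y| ≤ 2 * h → T y ≤ c * (2 * h) ^ s := fun y hy =>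
    (hl y).trans (by gcongr)
  have hbr : ∀ y, |y| ≤ 2 * h → T (B - y) ≤ c * (2 * h) ^ s := fun y hy =>
    (hr y).trans (by gcongr)
  have hDE : ∀ x, D x ≤ E x := by
    intro x
    by_cases hx1 : x ∈ Set.Icc (-h) h
    · have hb1 := hbl (x + h) (abs_le.2 ⟨by linarith [hx1.1], by linarith [hx1.2]⟩)
      have hb2 := hbl (x + -h) (abs_le.2 ⟨by linarith [hx1.1], by linarith [hx1.2]⟩)
      have := hi2 x
      simp only [hE, hD, Set.indicator_of_mem hx1]
      linarith [hnn x]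
    by_cases hx2 : x ∈ Set.Icc (B - h) (B + h)
    · have hb1 := hbr (B - (x + h)) (abs_le.2 ⟨by linarith [hx2.2], by linarith [hx2.1]⟩)
      have hb2 := hbr (B - (x + -h)) (abs_le.2 ⟨by linarith [hx2.2], by linarith [hx2.1]⟩)
      rw [sub_sub_cancel] at hb1 hb2
      have := hi1 x
      simp only [hE, hD, Set.indicator_of_mem hx2]
      linarith [hnn x]
    have hE0 : 0 ≤ E x := add_nonneg (hi1 x) (hi2 x)
    refine le_trans ?_ hE0
    simp only [Set.mem_Icc, not_and_or, not_le] at hx1 hx2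
    rcases hx1 with hx1 | hx1
    · simp only [hD]
      rw [h0 (x + h) (by linarith), h0 (x + -h) (by linarith)]
      linarith [hnn x]
    rcases hx2 with hx2 | hx2
    · have := hconc.2 (show x + h ∈ Set.Ioo 0 B from ⟨by linarith, by linarith⟩)
        (show x + -h ∈ Set.Ioo 0 B from ⟨by linarith, by linarith⟩) (show (0:ℝ) ≤ 1/2 by norm_num)
        (show (0:ℝ) ≤ 1/2 by norm_num) (by norm_num)
      simp only [smul_eq_mul] at this
      have e : 1 / 2 * (x + h) + 1 / 2 * (x + -h) = x := by ring
      rw [e] at this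
      simp only [hD]
      linarith
    · simp only [hD]
      rw [hB (x + h) (by linarith), hB (x + -h) (by linarith)]
      linarith [hnn x]
  have habs : ∀ x, |D x| ≤ 2 * E x - D x := by
    intro x
    have hE0 : 0 ≤ E x := add_nonneg (hi1 x) (hi2 x)
    rw [abs_le]
    constructor <;> linarith [hDE x]
  calc ∫ x, |D x| ≤ ∫ x, (2 * E x - D x) :=
        integral_mono hDi.abs ((hEi.const_mul 2).sub hDi) habs
    _ = 16 * c * h * (2 * h) ^ s := by
        rw [integral_sub (hEi.const_mul 2) hDi, integral_const_mul, hEv, hD0, hK]; ring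

open FourierTransform in
lemma fourier_decay (T : ℝ → ℝ) (B s c : ℝ) (hs : 0 < s) (hc : 0 ≤ c)
    (hint : Integrable T)
    (hnn : ∀ x, 0 ≤ T x) (h0 : ∀ x < 0, T x = 0) (hB : ∀ x, B < x → T x = 0)
    (hconc : ConcaveOn ℝ (Set.Ioo 0 B) T)
    (hl : ∀ x, T x ≤ c * |x| ^ s) (hr : ∀ x, T (B - x) ≤ c * |x| ^ s) (n : ℤ) (hn : n ≠ 0) :
    ‖𝓕 (fun x : ℝ => (T x : ℂ)) (n : ℝ)‖ ≤ 2 * c * |(n:ℝ)| ^ (-(1 + s)) := by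
  set w : ℝ := (n : ℝ) with hw
  have hw0 : w ≠ 0 := by rw [hw]; exact_mod_cast hn
  have hwp : 0 < |w| := abs_pos.2 hw0
  set h : ℝ := 1 / (2 * |w|) with hh
  have hhp : 0 < h := by positivity
  set f : ℝ → ℂ := fun x => (T x : ℂ) with hf
  have hfi : Integrable f := hint.ofReal
  have ch : ((Real.fourierChar (1/2 : ℝ) : Circle) : ℂ) = -1 := by
    rw [Real.fourierChar_apply]
    rw [← Complex.exp_pi_mul_I]; congr 1; push_cast; ring
  have ch' : ((Real.fourierChar (-(1/2) : ℝ) : Circle) : ℂ) = -1 := by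
    rw [Real.fourierChar_apply, ← inv_inj, ← Complex.exp_neg, inv_neg, inv_one,
      ← Complex.exp_pi_mul_I]; congr 1; push_cast; ring
  have hch : ((Real.fourierChar (h * w) : Circle) : ℂ) = -1 ∧
      ((Real.fourierChar (-h * w) : Circle) : ℂ) = -1 := by
    rcases abs_cases w with ⟨e, _⟩ | ⟨e, _⟩
    · have e1 : h * w = 1/2 := by rw [hh, e]; field_simp
      have e2 : -h * w = -(1/2) := by rw [neg_mul, e1]
      rw [e1, e2]; exact ⟨ch, ch'⟩
    · have e1 : h * w = -(1/2) := by rw [hh, e]; field_simp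
      have e2 : -h * w = 1/2 := by rw [neg_mul, e1, neg_neg]
      rw [e1, e2]; exact ⟨ch', ch⟩
  have conv : ∀ g : ℝ → ℂ, Integrable g →
      Integrable (fun v : ℝ => (Real.fourierChar (-(v * w)) : Circle) • g v) := by
    intro g hg
    have := (Real.fourierIntegral_convergent_iff (μ := volume) (f := g) w).2 hg
    simpa [mul_comm] using this
  have key : ∫ v : ℝ, (Real.fourierChar (-(v * w)) : Circle) •
      ((T (v + h) + T (v + -h) - 2 * T v : ℝ) : ℂ) = -4 * 𝓕 f w := by
    have e : ∀ v : ℝ, (Real.fourierChar (-(v * w)) : Circle) •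
      ((T (v + h) + T (v + -h) - 2 * T v : ℝ) : ℂ) =
      (Real.fourierChar (-(v * w)) : Circle) • f (v + h) +
      (Real.fourierChar (-(v * w)) : Circle) • f (v + -h) -
      2 * ((Real.fourierChar (-(v * w)) : Circle) • f v) := by
      intro v
      simp only [Circle.smul_def, hf, smul_eq_mul]
      push_cast; ring
    simp_rw [e]
    have j1 := conv _ (hfi.comp_add_right h)
    have j2 := conv _ (hfi.comp_add_right (-h))
    have j12 : Integrable (fun v : ℝ => (Real.fourierChar (-(v * w)) : Circle) • f (v + h) +
      (Real.fourierChar (-(v * w)) : Circle) • f (v + -h)) := j1.add j2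
    rw [integral_sub j12 ((conv _ hfi).const_mul 2), integral_add j1 j2,
      fourier_translate f h w hch.1, fourier_translate f (-h) w hch.2, integral_const_mul,
      Real.fourier_real_eq]
    ring
  have b1 : ‖-4 * 𝓕 f w‖ ≤ ∫ x, |T (x + h) + T (x + -h) - 2 * T x| := by
    rw [← key]
    refine (norm_integral_le_integral_norm _).trans (le_of_eq ?_)
    refine integral_congr_ae (Filter.Eventually.of_forall fun v => ?_)
    simp only [Circle.norm_smul, Complex.norm_real, Real.norm_eq_abs]
  have b2 := integral_secondDiff T B s c hs hc hint hnn h0 hB hconc hl hr h hhp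
  rw [norm_mul] at b1
  have e4 : ‖(-4 : ℂ)‖ = 4 := by simp
  rw [e4] at b1
  have e5 : 16 * c * h * (2 * h) ^ s = 8 * c * |w| ^ (-(1 + s)) := by
    have : 2 * h = |w|⁻¹ := by rw [hh]; field_simp
    rw [this, Real.inv_rpow hwp.le, ← Real.rpow_neg hwp.le, neg_add, Real.rpow_add hwp,
      Real.rpow_neg_one, ← this]
    ring
  linarith

lemma integral_fourier_zero (n : ℤ) (hn : n ≠ 0) :
    ∫ x in (0:ℝ)..1, fourier n (x : UnitAddCircle) = 0 := by
  have e : ∀ x : ℝ, fourier n (x : UnitAddCircle) =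
      Complex.exp ((2 * Real.pi * Complex.I * n) * x) := by
    intro x; rw [fourier_coe_apply]; simp
  simp_rw [e]
  have hne : (2 * Real.pi * Complex.I * n : ℂ) ≠ 0 := by
    simp [Real.pi_ne_zero, hn]
  rw [integral_exp_mul_complex hne]
  have : Complex.exp ((2 * Real.pi * Complex.I * n) * (1:ℝ)) = 1 := by
    rw [Complex.exp_eq_one_iff]; exact ⟨n, by push_cast; ring⟩
  rw [this]; simp

open FourierTransform in
lemma core (T : ℝ → ℝ) (B s c : ℝ) (hs : 0 < s) (hs1 : s ≤ 1) (hc : 0 ≤ c)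
    (hcont : Continuous T)
    (hnn : ∀ x, 0 ≤ T x) (h0 : ∀ x < 0, T x = 0) (hB : ∀ x, B < x → T x = 0)
    (hconc : ConcaveOn ℝ (Set.Ioo 0 B) T)
    (hl : ∀ x, T x ≤ c * |x| ^ s) (hr : ∀ x, T (B - x) ≤ c * |x| ^ s) :
    ∀ᵐ α : ℝ ∂volume, Irrational α →
      ∃ C : ℝ, ∀ N : ℕ, 1 ≤ N → ∀ x₀ : ℝ,
        |(∑ k ∈ Finset.range N, ∑' m : ℤ, T ((k : ℝ) * α + x₀ + (m : ℝ))) -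
          (N : ℝ) * ∫ x in (0:ℝ)..1, ∑' m : ℤ, T (x + (m : ℝ))| ≤ C := by
  have hcs : HasCompactSupport T := by
    refine HasCompactSupport.of_support_subset_isCompact (isCompact_Icc (a := (0:ℝ)) (b := B)) ?_
    intro x hx
    by_contra hx'
    rw [Set.mem_Icc, not_and_or, not_le, not_le] at hx'
    exact hx (hx'.elim (h0 x) (hB x))
  have hint : Integrable T := hcont.integrable_of_hasCompactSupport hcs
  set f : ℝ → ℂ := fun x => (T x : ℂ) with hf
  have hfc : Continuous f := Complex.continuous_ofReal.comp hcont
  have hfO : f =O[Filter.cocompact ℝ] fun x : ℝ => |x| ^ (-(2:ℝ)) := by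
    have h1 : T =ᶠ[Filter.cocompact ℝ] 0 := by
      rw [← Filter.coclosedCompact_eq_cocompact]
      exact hasCompactSupport_iff_eventuallyEq.1 hcs
    refine Filter.EventuallyEq.trans_isBigO (f₂ := fun _ => (0:ℂ)) ?_ (Asymptotics.isBigO_zero _ _)
    filter_upwards [h1] with x hx
    simp [hf, hx]
  set F : ℤ → ℂ := fun n => 𝓕 f (n : ℝ) with hF
  have hdec : ∀ n : ℤ, n ≠ 0 → ‖F n‖ ≤ 2 * c * |(n:ℝ)| ^ (-(1 + s)) := fun n hn =>
    fourier_decay T B s c hs hc hint hnn h0 hB hconc hl hr n hn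
  have hsumn : Summable (fun n : ℤ => ‖F n‖) := by
    have h1 : Summable (fun n : ℤ => 2 * c * |(n:ℝ)| ^ (-(1 + s))) :=
      (Real.summable_abs_int_rpow (by linarith)).mul_left _
    have h2 : Summable (fun n : ℤ => if n = 0 then ‖F n‖ else 0) :=
      (hasSum_ite_eq (0:ℤ) ‖F 0‖).summable.congr (fun n => by
        split_ifs with h
        · rw [h]
        · rfl)
    refine Summable.of_nonneg_of_le (fun n => norm_nonneg _) (fun n => ?_) (h1.add h2)
    rcases eq_or_ne n 0 with rfl | hn
    · simp only [if_true]
      have : 0 ≤ 2 * c * |((0:ℤ):ℝ)| ^ (-(1 + s)) := by positivity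
      linarith
    · simp only [if_neg hn, add_zero]
      exact hdec n hn
  have hsum : Summable F := hsumn.of_norm
  have poisson : ∀ x : ℝ, ((∑' m : ℤ, T (x + (m:ℝ)) : ℝ) : ℂ) =
      ∑' n : ℤ, F n * fourier n (x : UnitAddCircle) := by
    intro x
    rw [Complex.ofReal_tsum]
    exact Real.tsum_eq_tsum_fourier_of_rpow_decay_of_summable hfc one_lt_two hfO hsum x
  have hfn : ∀ (n : ℤ) (x : ℝ), ‖fourier n (x : UnitAddCircle)‖ = 1 := fun n x => by
    rw [fourier_apply, Circle.norm_coe]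
  have hsx : ∀ x : ℝ, Summable (fun n : ℤ => F n * fourier n (x : UnitAddCircle)) := by
    intro x
    refine Summable.of_norm ?_
    simpa only [norm_mul, hfn, mul_one] using hsumn
  have hI : ((∫ x in (0:ℝ)..1, ∑' m : ℤ, T (x + (m : ℝ)) : ℝ) : ℂ) = F 0 := by
    rw [← intervalIntegral.integral_ofReal]
    simp_rw [poisson]
    have hcf : ∀ n : ℤ, Continuous (fun x : ℝ => fourier n (x : UnitAddCircle)) := fun n =>
      (fourier n).continuous.comp (AddCircle.continuous_mk' 1)
    have hs := intervalIntegral.hasSum_integral_of_dominated_convergence (μ := volume)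
      (a := (0:ℝ)) (b := 1)
      (F := fun (n : ℤ) (x : ℝ) => F n * fourier n (x : UnitAddCircle))
      (f := fun x : ℝ => ∑' n : ℤ, F n * fourier n (x : UnitAddCircle))
      (fun n _ => ‖F n‖)
      (fun n => (continuous_const.mul (hcf n)).aestronglyMeasurable)
      (fun n => Filter.Eventually.of_forall fun x _ => by rw [norm_mul, hfn, mul_one])
      (Filter.Eventually.of_forall fun x _ => hsumn)
      (by simp)
      (Filter.Eventually.of_forall fun x _ => (hsx x).hasSum)
    rw [← hs.tsum_eq, tsum_eq_single 0]
    · simp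
    · intro n hn
      rw [intervalIntegral.integral_const_mul, integral_fourier_zero n hn, mul_zero]
  filter_upwards [ae_summable s hs hs1] with α hα hirr
  refine ⟨∑' n : ℤ, 2 * c * (|(n:ℝ)| ^ (-(1 + s)) * ‖n • (α : UnitAddCircle)‖⁻¹), ?_⟩
  intro N _ x₀
  have hnz : ∀ n : ℤ, n ≠ 0 → n • (α : UnitAddCircle) ≠ 0 := by
    intro n hn h
    rw [← AddCircle.coe_zsmul, AddCircle.coe_eq_zero_iff] at h
    obtain ⟨m, hm⟩ := h
    simp only [zsmul_eq_mul, mul_one] at hm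
    refine (hirr.intCast_mul hn).ne_int m hm.symm
  rw [← Real.norm_eq_abs, ← Complex.norm_real]
  push_cast [hI]
  have e1 : ∀ k : ℕ, (∑' m : ℤ, ((T ((k : ℝ) * α + x₀ + (m : ℝ)) : ℝ) : ℂ)) =
      ∑' n : ℤ, F n * fourier n (((k : ℝ) * α + x₀ : ℝ) : UnitAddCircle) := by
    intro k
    rw [← poisson, Complex.ofReal_tsum]
  simp_rw [e1]
  have hS : Summable (fun n : ℤ => ∑ k ∈ Finset.range N,
      F n * fourier n (((k : ℝ) * α + x₀ : ℝ) : UnitAddCircle)) :=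
    summable_sum fun k _ => hsx _
  rw [← Summable.tsum_finsetSum (fun k _ => hsx _), hS.tsum_eq_add_tsum_ite 0]
  have e2 : ∑ k ∈ Finset.range N, F 0 * fourier 0 (((k : ℝ) * α + x₀ : ℝ) : UnitAddCircle)
      = N * F 0 := by simp
  rw [e2, add_sub_cancel_left]
  refine tsum_of_norm_bounded (hα.mul_left (2 * c)).hasSum ?_
  intro n
  by_cases hn : n = 0
  · rw [if_pos hn, norm_zero]; positivity
  · rw [if_neg hn, ← Finset.mul_sum, norm_mul, ← mul_assoc]
    exact mul_le_mul (hdec n hn) (geom_bound_s13 α x₀ n (hnz n hn) N) (norm_nonneg _) (by positivity)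

lemma holder_extend (g : ℝ → ℝ) (M ε m c : ℝ) (hM : ∀ x, g x ≤ M) (hM0 : 0 ≤ M) (hε : 0 < ε)
    (hm : 0 < m) (hc : 0 < c) (h0 : ∀ x < 0, g x = 0)
    (h : ∀ x : ℝ, 0 ≤ x → x < ε → g x ≤ c * x ^ ((1:ℝ) / m)) (x : ℝ) :
    g x ≤ (c + M * (min ε 1) ^ (-(min (1 / m) 1))) * |x| ^ (min (1 / m) 1) := by
  set s := min (1 / m) 1 with hs
  set d := min ε 1 with hd
  have hs0 : 0 < s := lt_min (by positivity) one_pos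
  have hd0 : 0 < d := lt_min hε one_pos
  have hds : 0 < d ^ (-s) := Real.rpow_pos_of_pos hd0 _
  have hxs : 0 ≤ |x| ^ s := Real.rpow_nonneg (abs_nonneg _) _
  rcases lt_or_ge x 0 with hx | hx
  · rw [h0 x hx]; positivity
  rw [abs_of_nonneg hx] at hxs ⊢
  rcases lt_or_ge x d with hxd | hxd
  · have h1 := h x hx (hxd.trans_le (min_le_left _ _))
    have h2 : x ^ ((1:ℝ) / m) ≤ x ^ s :=
      Real.rpow_le_rpow_of_exponent_ge_of_imp hx (hxd.le.trans (min_le_right _ _)) (min_le_left _ _)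
        (fun _ h => absurd h (by positivity))
    have h3 : 0 ≤ M * d ^ (-s) * x ^ s := by positivity
    nlinarith
  · have h1 : 1 ≤ d ^ (-s) * x ^ s := by
      rw [Real.rpow_neg hd0.le, ← div_eq_inv_mul, one_le_div (Real.rpow_pos_of_pos hd0 _)]
      exact Real.rpow_le_rpow hd0.le hxd hs0.le
    have h2 : M ≤ M * (d ^ (-s) * x ^ s) := le_mul_of_one_le_right hM0 h1
    have h3 : 0 ≤ c * x ^ s := by positivity
    have := hM x
    nlinarith

theorem statement13 (T : ℝ → ℝ) (hT : IsHatFunction T ∨ IsDomeFunction T) :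
    ∀ᵐ α : ℝ ∂volume, Irrational α →
      ∃ C : ℝ, ∀ N : ℕ, 1 ≤ N → ∀ x₀ : ℝ,
        |(∑ k ∈ Finset.range N, ∑' m : ℤ, T ((k : ℝ) * α + x₀ + (m : ℝ))) -
          (N : ℝ) * ∫ x in (0:ℝ)..1, ∑' m : ℤ, T (x + (m : ℝ))| ≤ C := by
  rcases hT with h | h
  · obtain ⟨a, b, H, ha, hab, hH, h1, h2, h3, h4⟩ := h
    have hp : 0 < H / a := by positivity
    have hba : 0 < b - a := by linarith
    have hq : 0 < H / (b - a) := by positivity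
    set p := H / a with hpd
    set q := H / (b - a) with hqd
    have hpa : p * a = H := by rw [hpd]; field_simp
    have hqb : q * (b - a) = H := by rw [hqd]; field_simp
    have hTe : T = fun x => max 0 (min (p * x) (-q * (x - b))) := by
      ext x
      rcases lt_or_ge x 0 with hx | hx
      · rw [h1 x hx, max_eq_left]
        exact (min_le_left _ _).trans (by nlinarith)
      rcases le_or_gt x a with hxa | hxa
      · rw [h3 x hx hxa, min_eq_left (by nlinarith), max_eq_right (by positivity)]
      rcases le_or_gt x b with hxb | hxb
      · rw [h4 x hxa hxb, min_eq_right (by nlinarith), max_eq_right (by nlinarith)]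
      · rw [h2 x hxb, max_eq_left]
        exact (min_le_right _ _).trans (by nlinarith)
    refine core T b 1 (p + q) one_pos le_rfl (by positivity) ?_ ?_ h1 h2 ?_ ?_ ?_
    · rw [hTe]; fun_prop
    · intro x; rw [hTe]; exact le_max_left _ _
    · refine ⟨convex_Ioo _ _, ?_⟩
      intro x hx y hy u v hu hv huv
      have lin : ∀ z, T z = max 0 (min (p * z) (-q * (z - b))) := fun z => by rw [hTe]
      have hpos : ∀ z ∈ Set.Ioo 0 b, T z = min (p * z) (-q * (z - b)) := by
        intro z hz
        rw [lin z, max_eq_right]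
        exact le_min (mul_nonneg hp.le hz.1.le) (by nlinarith [hz.2])
      rw [hpos x hx, hpos y hy, lin]
      refine le_trans ?_ (le_max_right _ _)
      simp only [smul_eq_mul]
      have a1 := mul_le_mul_of_nonneg_left (min_le_left (p * x) (-q * (x - b))) hu
      have a2 := mul_le_mul_of_nonneg_left (min_le_right (p * x) (-q * (x - b))) hu
      have a3 := mul_le_mul_of_nonneg_left (min_le_left (p * y) (-q * (y - b))) hv
      have a4 := mul_le_mul_of_nonneg_left (min_le_right (p * y) (-q * (y - b))) hv
      refine le_min ?_ ?_
      · linarith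
      · have : -q * (u * x + v * y - b) = u * (-q * (x - b)) + v * (-q * (y - b)) := by
          have : b = (u + v) * b := by rw [huv, one_mul]
          linear_combination q * this
        linarith
    · intro x
      rw [hTe, Real.rpow_one]
      refine max_le (by positivity) ((min_le_left _ _).trans ?_)
      nlinarith [le_abs_self x, abs_nonneg x]
    · intro x
      rw [hTe, Real.rpow_one]
      refine max_le (by positivity) ((min_le_right _ _).trans ?_)
      nlinarith [le_abs_self x, abs_nonneg x]
  · obtain ⟨B, hB, hcont, hnn, h1, h2, hconc, -, -, ε, m, c, hε, hm, hc, h3, h4⟩ := h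
    have hcs : HasCompactSupport T := by
      refine HasCompactSupport.of_support_subset_isCompact (isCompact_Icc (a := (0:ℝ)) (b := B)) ?_
      intro x hx
      by_contra hx'
      rw [Set.mem_Icc, not_and_or, not_le, not_le] at hx'
      exact hx (hx'.elim (h1 x) (h2 x))
    obtain ⟨M, hM⟩ := hcs.exists_bound_of_continuous hcont
    have hM' : ∀ x, T x ≤ M := fun x => (le_abs_self _).trans (hM x)
    have hM0 : 0 ≤ M := (norm_nonneg _).trans (hM 0)
    have hd : 0 < min ε 1 := lt_min hε one_pos
    refine core T B (min (1 / m) 1) (c + M * (min ε 1) ^ (-(min (1 / m) 1)))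
      (lt_min (by positivity) one_pos) (min_le_right _ _)
      (add_nonneg hc.le (mul_nonneg hM0 (Real.rpow_nonneg hd.le _))) hcont hnn h1 h2 hconc ?_ ?_
    · exact holder_extend T M ε m c hM' hM0 hε hm hc h1 h3
    · exact holder_extend (fun x => T (B - x)) M ε m c (fun x => hM' _) hM0 hε hm hc
        (fun x hx => h2 _ (by linarith)) h4
end

section
/- Let f : ℝ → [0,∞) be a dome function supported on [0, B], with parameters ε, m, c as in the definition, and let q be a real number with q > 2/B and q > 1/ε. Define f_q' : ℝ → ℝ by f_q'(x) = f'(x) for 1/q ≤ x ≤ B − 1/q and f_q'(x) = 0 otherwise. Then the total variation of f_q' over [0,1] satisfies V_{[0,1]}(f_q') ≤ 4c·q^{1 − 1/m}. -/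
open MeasureTheory

/-- `f` is a dome function with support `[0, B]` and growth parameters `ε, m, c`:
continuous, nonnegative, supported on `[0, B]` with `B > 0`, concave and twice
differentiable on `(0, B)`, and `f(x) ≤ c x^{1/m}`, `f(B - x) ≤ c x^{1/m}` for
`0 ≤ x < ε`. -/
def IsDomeFunctionWith (f : ℝ → ℝ) (B ε m c : ℝ) : Prop :=
  0 < B ∧ Continuous f ∧ (∀ x : ℝ, 0 ≤ f x) ∧
  (∀ x : ℝ, x < 0 → f x = 0) ∧
  (∀ x : ℝ, B < x → f x = 0) ∧
  ConcaveOn ℝ (Set.Ioo 0 B) f ∧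
  (∀ x ∈ Set.Ioo (0:ℝ) B, DifferentiableAt ℝ f x) ∧
  (∀ x ∈ Set.Ioo (0:ℝ) B, DifferentiableAt ℝ (deriv f) x) ∧
  0 < ε ∧ 0 < m ∧ 0 < c ∧
  (∀ x : ℝ, 0 ≤ x → x < ε → f x ≤ c * x ^ ((1:ℝ) / m)) ∧
  (∀ x : ℝ, 0 ≤ x → x < ε → f (B - x) ≤ c * x ^ ((1:ℝ) / m))

lemma evar_mono_Icc {g : ℝ → ℝ} {a b M : ℝ} (hab : a ≤ b) (h : MonotoneOn g (Set.Icc a b))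
    (hM : g b - g a ≤ M) : eVariationOn g (Set.Icc a b) ≤ ENNReal.ofReal M := by
  have h1 := h.eVariationOn_eq (Set.left_mem_Icc.2 hab) (Set.right_mem_Icc.2 hab)
  rw [Set.inter_self] at h1
  rw [h1]
  exact ENNReal.ofReal_le_ofReal hM

lemma evar_anti_Icc {g : ℝ → ℝ} {a b M : ℝ} (hab : a ≤ b) (h : AntitoneOn g (Set.Icc a b))
    (hM : g a - g b ≤ M) : eVariationOn g (Set.Icc a b) ≤ ENNReal.ofReal M := by
  have h1 : eVariationOn g (Set.Icc a b) = eVariationOn (fun x => - g x) (Set.Icc a b) := by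
    simp [eVariationOn, edist_neg_neg]
  rw [h1]
  exact evar_mono_Icc hab (fun x hx y hy hxy => neg_le_neg (h hx hy hxy)) (by linarith)

lemma evar_bump {d : ℝ → ℝ} {a b M : ℝ} (ha : 0 < a) (hab : a ≤ b)
    (hd : AntitoneOn d (Set.Icc a b)) (h1 : d a ≤ M) (h2 : -M ≤ d b) :
    eVariationOn (fun x => if a ≤ x ∧ x ≤ b then d x else 0) (Set.Icc 0 1) ≤
      ENNReal.ofReal (4 * M) := by
  have hdab : d b ≤ d a := hd ⟨le_rfl, hab⟩ ⟨hab, le_rfl⟩ hab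
  have hM : 0 ≤ M := by linarith
  set g : ℝ → ℝ := fun x => if a ≤ x ∧ x ≤ b then d x else 0 with hg
  have ga : g a = d a := by simp [hg, hab]
  have gb : g b = d b := by simp [hg, hab]
  have gl : ∀ x, x < a → g x = 0 := fun x hx => if_neg (fun h => absurd h.1 (not_le.2 hx))
  have gr : ∀ x, b < x → g x = 0 := fun x hx => if_neg (fun h => absurd h.2 (not_le.2 hx))
  have gm : ∀ x, a ≤ x → x ≤ b → g x = d x := fun x h h' => if_pos ⟨h, h'⟩
  set R := max 1 (b + 1) with hR
  have hbR : b < R := lt_of_lt_of_le (by linarith) (le_max_right _ _)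
  have p1 : eVariationOn g (Set.Icc 0 a) ≤ ENNReal.ofReal M := by
    rcases le_total 0 (d a) with h | h
    · refine evar_mono_Icc ha.le ?_ (by rw [ga, gl 0 ha]; linarith)
      intro x hx y hy hxy
      rcases hy.2.lt_or_eq with hy' | rfl
      · rw [gl x (by linarith), gl y hy']
      · rcases hx.2.lt_or_eq with hx' | rfl
        · rw [gl x hx', ga]; exact h
        · exact le_rfl
    · refine evar_anti_Icc ha.le ?_ (by rw [ga, gl 0 ha]; linarith)
      intro x hx y hy hxy
      rcases hy.2.lt_or_eq with hy' | rfl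
      · rw [gl x (by linarith), gl y hy']
      · rcases hx.2.lt_or_eq with hx' | rfl
        · rw [gl x hx', ga]; exact h
        · exact le_rfl
  have p2 : eVariationOn g (Set.Icc a b) ≤ ENNReal.ofReal (2 * M) := by
    refine evar_anti_Icc hab ?_ (by rw [ga, gb]; linarith)
    intro x hx y hy hxy
    rw [gm x hx.1 hx.2, gm y hy.1 hy.2]
    exact hd hx hy hxy
  have p3 : eVariationOn g (Set.Icc b R) ≤ ENNReal.ofReal M := by
    rcases le_total 0 (d b) with h | h
    · refine evar_anti_Icc hbR.le ?_ (by rw [gb, gr R hbR]; linarith)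
      intro x hx y hy hxy
      rcases hx.1.lt_or_eq with hx' | rfl
      · rw [gr x hx', gr y (by linarith)]
      · rcases hy.1.lt_or_eq with hy' | rfl
        · rw [gr y hy', gb]; exact h
        · exact le_rfl
    · refine evar_mono_Icc hbR.le ?_ (by rw [gb, gr R hbR]; linarith)
      intro x hx y hy hxy
      rcases hx.1.lt_or_eq with hx' | rfl
      · rw [gr x hx', gr y (by linarith)]
      · rcases hy.1.lt_or_eq with hy' | rfl
        · rw [gr y hy', gb]; exact h
        · exact le_rfl
  have e1 := eVariationOn.Icc_add_Icc g (s := Set.univ) ha.le hab (Set.mem_univ _)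
  have e2 := eVariationOn.Icc_add_Icc g (s := Set.univ) (ha.le.trans hab) hbR.le (Set.mem_univ _)
  simp only [Set.univ_inter] at e1 e2
  calc eVariationOn g (Set.Icc 0 1) ≤ eVariationOn g (Set.Icc 0 R) :=
        eVariationOn.mono g (Set.Icc_subset_Icc_right (le_max_left _ _))
    _ ≤ ENNReal.ofReal M + ENNReal.ofReal (2 * M) + ENNReal.ofReal M := by
        rw [← e2, ← e1]
        gcongr
    _ = ENNReal.ofReal (4 * M) := by
        rw [← ENNReal.ofReal_add hM (by linarith), ← ENNReal.ofReal_add (by linarith) hM]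
        congr 1; ring

theorem statement15 (f : ℝ → ℝ) (B ε m c q : ℝ)
    (hf : IsDomeFunctionWith f B ε m c)
    (hq1 : 2 / B < q) (hq2 : 1 / ε < q) :
    eVariationOn
      (fun x => if 1 / q ≤ x ∧ x ≤ B - 1 / q then deriv f x else 0)
      (Set.Icc (0:ℝ) 1) ≤ ENNReal.ofReal (4 * c * q ^ (1 - 1 / m)) := by
  obtain ⟨hB, hcont, hpos, -, -, hconc, hdiff, -, hε, hm, hc, hl, hr⟩ := hf
  have hq : 0 < q := lt_trans (by positivity) hq1
  have ha : 0 < 1 / q := by positivity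
  have haε : 1 / q < ε := by
    rw [div_lt_iff₀ hε] at hq2
    rw [div_lt_iff₀ hq]; linarith
  have haB : 2 * (1 / q) < B := by
    rw [div_lt_iff₀ hB] at hq1
    rw [mul_one_div, div_lt_iff₀ hq]; linarith
  have hM : c * q ^ (1 - 1 / m) = c * (1 / q) ^ ((1:ℝ) / m) / (1 / q) := by
    rw [Real.rpow_sub hq, Real.rpow_one, one_div q, Real.inv_rpow hq.le]
    field_simp
  have hanti := hconc.antitoneOn_deriv hdiff
  rw [mul_assoc]
  refine evar_bump ha (by linarith) (hanti.mono fun x hx => ?_) ?_ ?_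
  · exact ⟨by linarith [hx.1], by linarith [hx.2]⟩
  · obtain ⟨ξ, hξ, he⟩ := exists_deriv_eq_slope f ha hcont.continuousOn
      (fun x hx => (hdiff x ⟨hx.1, by linarith [hx.2]⟩).differentiableWithinAt)
    have h1 : deriv f (1 / q) ≤ deriv f ξ :=
      hanti ⟨hξ.1, by linarith [hξ.2]⟩ ⟨ha, by linarith⟩ hξ.2.le
    refine h1.trans ?_
    rw [he, hM, sub_zero]
    gcongr
    linarith [hpos 0, hl (1 / q) ha.le haε]
  · obtain ⟨ξ, hξ, he⟩ := exists_deriv_eq_slope f (show B - 1 / q < B by linarith)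
      hcont.continuousOn
      (fun x hx => (hdiff x ⟨by linarith [hx.1], hx.2⟩).differentiableWithinAt)
    have h1 : deriv f ξ ≤ deriv f (B - 1 / q) :=
      hanti ⟨by linarith, by linarith⟩ ⟨by linarith [hξ.1], hξ.2⟩ hξ.1.le
    refine le_trans ?_ h1
    rw [he, hM, sub_sub_cancel, ← neg_div]
    gcongr
    linarith [hpos B, hr (1 / q) ha.le haε]
end

section
/- Let α ∈ (0,1) be irrational and let p ∈ (0,1) with α + p < 1 and p ∉ ℤα + ℤ. Let S be the parallelogram in [0,1)² with vertices (0,0), (1,α), (1,α+p), (0,p), i.e. S = {(u,v) ∈ [0,1)² : αu ≤ v < αu + p}. Then |∫₀^T χ_S({t}, {αt}) dt − ∑_{n=1}^{⌊T⌋} χ_{[0,p)}({nα})| ≤ 1 for all T > 0, and consequently S is not a bounded remainder set for the continuous irrational rotation with slope α and starting point (0,0): the quantity |∫₀^T χ_S({t}, {αt}) dt − p·T| is unbounded as T → ∞. -/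
open MeasureTheory

noncomputable def chiK (p : ℝ) (x : UnitAddCircle) : ℝ :=
  Set.indicator (Set.Ico (0:ℝ) p) (fun _ => (1:ℝ)) (AddCircle.equivIco (1:ℝ) 0 x : ℝ)

lemma chiK_coe (p y : ℝ) : chiK p (y : UnitAddCircle) =
    Set.indicator (Set.Ico (0:ℝ) p) (fun _ => (1:ℝ)) (Int.fract y) := by
  unfold chiK
  rw [AddCircle.coe_equivIco_mk_apply]
  simp

lemma chiK_meas (p : ℝ) : Measurable (chiK p) := by
  have h : Measurable (AddCircle.equivIco (1:ℝ) 0) := (AddCircle.measurableEquivIco (1:ℝ) 0).measurable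
  exact (measurable_const.indicator measurableSet_Ico).comp (measurable_subtype_coe.comp h)

lemma chiK_zero_or_one (p : ℝ) (x : UnitAddCircle) : chiK p x = 0 ∨ chiK p x = 1 := by
  unfold chiK
  exact Set.indicator_eq_zero_or_self _ _ _

lemma chiK_right (p y : ℝ) : ∀ᶠ δ in nhdsWithin (0:ℝ) (Set.Ioi 0),
    chiK p ((y + δ : ℝ) : UnitAddCircle) = chiK p (y : UnitAddCircle) := by
  have h1 : Int.fract y < 1 := Int.fract_lt_one y
  have h0 : 0 ≤ Int.fract y := Int.fract_nonneg y
  have key : ∀ δ : ℝ, 0 < δ → δ < 1 - Int.fract y → Int.fract (y + δ) = Int.fract y + δ := by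
    intro δ hδ hδ1
    rw [Int.fract_eq_iff]
    refine ⟨by linarith, by linarith, ⌊y⌋, ?_⟩
    have := Int.floor_add_fract y
    linarith
  by_cases hy : Int.fract y < p
  · have : Set.Ioo (0:ℝ) (min (1 - Int.fract y) (p - Int.fract y)) ∈ nhdsWithin (0:ℝ) (Set.Ioi 0) :=
      Ioo_mem_nhdsGT (lt_min (by linarith) (by linarith))
    filter_upwards [this] with δ hδ
    have := lt_min_iff.1 hδ.2
    rw [chiK_coe, chiK_coe, key δ hδ.1 this.1, Set.indicator_of_mem, Set.indicator_of_mem]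
    · exact ⟨h0, hy⟩
    · exact ⟨by linarith [hδ.1], by linarith⟩
  · have : Set.Ioo (0:ℝ) (1 - Int.fract y) ∈ nhdsWithin (0:ℝ) (Set.Ioi 0) :=
      Ioo_mem_nhdsGT (by linarith)
    filter_upwards [this] with δ hδ
    rw [chiK_coe, chiK_coe, key δ hδ.1 hδ.2, Set.indicator_of_notMem, Set.indicator_of_notMem]
    · exact fun h => hy h.2
    · exact fun h => hy (by linarith [h.2, hδ.1])

/-- Birkhoff sums. -/
noncomputable def SK (α p : ℝ) (N : ℕ) (x : UnitAddCircle) : ℝ :=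
  ∑ n ∈ Finset.range N, (chiK p (x + n • (α : UnitAddCircle)) - p)

lemma SK_bdd (α p C : ℝ) (hirr : Irrational α) (h : ∀ N, |SK α p N 0| ≤ C)
    (N : ℕ) (x : UnitAddCircle) : |SK α p N x| ≤ 2 * C := by
  obtain ⟨y, rfl⟩ := QuotientAddGroup.mk_surjective x
  change |SK α p N (y : UnitAddCircle)| ≤ 2 * C
  have hev : ∀ᶠ δ in nhdsWithin (0:ℝ) (Set.Ioi 0), ∀ n ∈ Finset.range N,
      chiK p (((y + n • α) + δ : ℝ) : UnitAddCircle) = chiK p ((y + n • α : ℝ) : UnitAddCircle) := by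
    rw [Filter.eventually_all_finset]
    exact fun n _ => chiK_right p _
  obtain ⟨ε, hε, hsub⟩ := (mem_nhdsGT_iff_exists_Ioo_subset).1 hev
  have hd : DenseRange (fun k : ℕ => k • (α : UnitAddCircle)) := by
    rw [← denseRange_zsmul_iff_nsmul]
    exact AddCircle.denseRange_zsmul_coe_iff.2 (by simpa using hirr)
  have hopen : IsOpen ((fun t : ℝ => (t : UnitAddCircle)) '' Set.Ioo y (y + ε)) :=
    QuotientAddGroup.isOpenMap_coe _ isOpen_Ioo
  have hε' : (0:ℝ) < ε := hε
  obtain ⟨k, t, ht, hk⟩ := hd.exists_mem_open hopen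
    (Set.Nonempty.image _ (Set.nonempty_Ioo.2 (by linarith)))
  have hS : SK α p N (y : UnitAddCircle) = SK α p N (k • (α : UnitAddCircle)) := by
    unfold SK
    refine Finset.sum_congr rfl fun n hn => ?_
    have := hsub (show t - y ∈ Set.Ioo 0 ε from ⟨by linarith [ht.1], by linarith [ht.2]⟩) n hn
    rw [← hk]
    have e1 : ((y + n • α : ℝ) : UnitAddCircle) = (y : UnitAddCircle) + n • (α : UnitAddCircle) := by
      push_cast; rfl
    have e2 : (((y + n • α) + (t - y) : ℝ) : UnitAddCircle) = (t : UnitAddCircle) + n • (α : UnitAddCircle) := by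
      rw [show (y + n • α) + (t - y) = t + n • α by ring]
      push_cast; rfl
    rw [e1, e2] at this
    simp only [this]
  have hadd : SK α p (k + N) 0 = SK α p k 0 + SK α p N (k • (α : UnitAddCircle)) := by
    unfold SK
    rw [Finset.sum_range_add]
    simp [add_smul]
  have a1 := abs_le.1 (h (k + N))
  have a2 := abs_le.1 (h k)
  rw [hS, abs_le]
  constructor <;> linarith

lemma kesten (α p : ℝ) (hirr : Irrational α)
    (hpnot : ¬ ∃ m n : ℤ, p = (m : ℝ) * α + (n : ℝ)) (C : ℝ) : ¬ ∀ N, |SK α p N 0| ≤ C := by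
  intro h0
  have hb := SK_bdd α p C hirr h0
  let g : UnitAddCircle → ℝ := fun x => Filter.limsup (fun N => SK α p N x) Filter.atTop
  have hgm : Measurable g := by
    refine Measurable.limsup fun N => ?_
    unfold SK
    refine Finset.measurable_sum _ fun n _ => ?_
    exact ((chiK_meas p).comp (measurable_add_const _)).sub_const _
  have hg : ∀ x, g x = (chiK p x - p) + g (x + (α : UnitAddCircle)) := by
    intro x
    have bd : Bornology.IsBounded (Set.range fun N => SK α p N (x + (α : UnitAddCircle))) := by
      refine (Metric.isBounded_closedBall (x := (0:ℝ)) (r := 2 * C)).subset ?_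
      rintro _ ⟨N, rfl⟩
      simpa using hb N _
    have ba : Filter.IsBoundedUnder (· ≤ ·) Filter.atTop fun N => SK α p N (x + (α : UnitAddCircle)) :=
      bd.bddAbove.isBoundedUnder_of_range
    have bb : Filter.IsBoundedUnder (· ≥ ·) Filter.atTop fun N => SK α p N (x + (α : UnitAddCircle)) :=
      bd.bddBelow.isBoundedUnder_of_range
    change Filter.limsup (fun N => SK α p N x) Filter.atTop = _ +
      Filter.limsup (fun N => SK α p N (x + (α : UnitAddCircle))) Filter.atTop
    rw [← Filter.limsup_nat_add (fun N => SK α p N x) 1,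
      ← limsup_const_add _ _ _ ba bb.isCoboundedUnder_le]
    congr 1
    funext N
    unfold SK
    rw [Finset.sum_range_succ']
    simp [add_smul, add_assoc, add_comm, add_left_comm]
  let e : UnitAddCircle → ℂ := fun x => Complex.exp (2 * Real.pi * Complex.I * (g x : ℂ))
  have hem : Measurable e := by
    exact Complex.measurable_exp.comp ((Complex.measurable_ofReal.comp hgm).const_mul _)
  have hnorm : ∀ x, ‖e x‖ = 1 := by
    intro x
    have : 2 * Real.pi * Complex.I * (g x : ℂ) = ((2 * Real.pi * g x : ℝ) : ℂ) * Complex.I := by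
      push_cast; ring
    simp only [e]
    rw [this, Complex.norm_exp_ofReal_mul_I]
  have he : ∀ x, e (x + (α : UnitAddCircle)) = Complex.exp (2 * Real.pi * Complex.I * p) * e x := by
    intro x
    simp only [e]
    rw [← Complex.exp_add, hg x]
    rcases chiK_zero_or_one p x with h | h <;> rw [h]
    · congr 1; push_cast; ring
    · rw [← Complex.exp_periodic]
      congr 1; push_cast; ring
  have hcoef : ∀ n : ℤ, fourierCoeff e n = 0 := by
    intro n
    have h1 : fourierCoeff e n = (fourier (-n) (α : UnitAddCircle) * Complex.exp (2 * Real.pi * Complex.I * p)) *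
        fourierCoeff e n := by
      conv_lhs => unfold fourierCoeff
      rw [← integral_add_right_eq_self _ (α : UnitAddCircle)]
      unfold fourierCoeff
      rw [← integral_const_mul]
      congr 1
      funext t
      rw [he]
      have : (fourier (-n) (t + (α : UnitAddCircle)) : ℂ) = fourier (-n) t * fourier (-n) (α : UnitAddCircle) := by
        simp [fourier_apply, smul_add, AddCircle.toCircle_add]
      rw [this]
      simp only [smul_eq_mul]
      ring
    by_contra hne
    have h2 : fourier (-n) (α : UnitAddCircle) * Complex.exp (2 * Real.pi * Complex.I * p) = 1 := by
      have : (fourier (-n) (α : UnitAddCircle) * Complex.exp (2 * Real.pi * Complex.I * p) - 1) * fourierCoeff e n = 0 := by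
        rw [sub_mul, ← h1]; ring
      rcases mul_eq_zero.1 this with h | h
      · exact sub_eq_zero.1 h
      · exact absurd h hne
    rw [fourier_coe_apply, ← Complex.exp_add, Complex.exp_eq_one_iff] at h2
    obtain ⟨m, hm⟩ := h2
    apply hpnot
    refine ⟨n, m, ?_⟩
    have hpi : (2 * Real.pi * Complex.I : ℂ) ≠ 0 := Complex.two_pi_I_ne_zero
    have : (2 * Real.pi * Complex.I : ℂ) * (p : ℂ) = (2 * Real.pi * Complex.I : ℂ) * (n * α + m) := by
      push_cast at hm
      linear_combination hm
    have := mul_left_cancel₀ hpi this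
    exact_mod_cast this
  have hL : MemLp e 2 (AddCircle.haarAddCircle (T := (1:ℝ))) :=
    MemLp.of_bound hem.aestronglyMeasurable 1 (Filter.Eventually.of_forall fun x => (hnorm x).le)
  have hP := tsum_sq_fourierCoeff (hL.toLp e)
  have hc : ∀ n, fourierCoeff (hL.toLp e) n = 0 := by
    intro n
    rw [← hcoef n]
    unfold fourierCoeff
    apply integral_congr_ae
    filter_upwards [hL.coeFn_toLp] with x hx
    rw [hx]
  have hi : ∫ t : UnitAddCircle, ‖hL.toLp e t‖ ^ 2 ∂AddCircle.haarAddCircle = 1 := by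
    have h1 : ∫ t : UnitAddCircle, (1:ℝ) ∂AddCircle.haarAddCircle = 1 := by simp
    refine Eq.trans ?_ h1
    apply integral_congr_ae
    filter_upwards [hL.coeFn_toLp] with x hx
    rw [hx, hnorm]; norm_num
  rw [hi] at hP
  simp [hc] at hP


lemma S_pt (α p : ℝ) (hα : α ∈ Set.Ioo (0:ℝ) 1)
    (hap : α + p < 1) (S : Set (ℝ × ℝ))
    (hS : S = {y : ℝ × ℝ | y ∈ Set.Ico (0:ℝ) 1 ×ˢ Set.Ico (0:ℝ) 1 ∧
      α * y.1 ≤ y.2 ∧ y.2 < α * y.1 + p}) (n : ℕ) (t : ℝ) (h1 : n ≤ t) (h2 : t < n + 1) :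
    Set.indicator S (fun _ => (1:ℝ)) (Int.fract t, Int.fract (α * t)) =
    Set.indicator (Set.Ico (0:ℝ) p) (fun _ => (1:ℝ)) (Int.fract ((n : ℝ) * α)) := by
  obtain ⟨ha0, ha1⟩ := hα
  have ht : Int.fract t = t - n := by
    rw [Int.fract_eq_iff]
    exact ⟨by linarith, by linarith, n, by simp⟩
  have f0 := Int.fract_nonneg ((n:ℝ) * α)
  have f1 := Int.fract_lt_one ((n:ℝ) * α)
  have f2 := Int.floor_add_fract ((n:ℝ) * α)
  have u0 : 0 ≤ α * (t - n) := mul_nonneg ha0.le (by linarith)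
  have u1 : α * (t - n) < α := by nlinarith
  have hiff : (Int.fract t, Int.fract (α * t)) ∈ S ↔ Int.fract ((n : ℝ) * α) ∈ Set.Ico 0 p := by
    rw [hS]
    simp only [Set.mem_setOf_eq, Set.mem_prod, Set.mem_Ico, Int.fract_nonneg, Int.fract_lt_one, true_and, and_true, ht]
    by_cases hc : Int.fract ((n:ℝ) * α) + α * (t - n) < 1
    · have : Int.fract (α * t) = Int.fract ((n:ℝ) * α) + α * (t - n) := by
        rw [Int.fract_eq_iff]
        exact ⟨by linarith, hc, ⌊(n:ℝ) * α⌋, by linarith⟩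
      rw [this]
      constructor
      · intro h; linarith [h.2.2]
      · intro h; exact ⟨⟨by linarith, by linarith⟩, by linarith, by linarith⟩
    · have : Int.fract (α * t) = Int.fract ((n:ℝ) * α) + α * (t - n) - 1 := by
        rw [Int.fract_eq_iff]
        exact ⟨by linarith, by linarith, ⌊(n:ℝ) * α⌋ + 1, by push_cast; linarith⟩
      rw [this]
      constructor
      · intro h; linarith [h.2.1]
      · intro h; linarith
  by_cases h : Int.fract ((n : ℝ) * α) ∈ Set.Ico 0 p
  · rw [Set.indicator_of_mem h, Set.indicator_of_mem (hiff.2 h)]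
  · rw [Set.indicator_of_notMem h, Set.indicator_of_notMem (fun h' => h (hiff.1 h'))]

lemma S_int (α p : ℝ) (hα : α ∈ Set.Ioo (0:ℝ) 1)
    (hap : α + p < 1) (S : Set (ℝ × ℝ))
    (hS : S = {y : ℝ × ℝ | y ∈ Set.Ico (0:ℝ) 1 ×ˢ Set.Ico (0:ℝ) 1 ∧
      α * y.1 ≤ y.2 ∧ y.2 < α * y.1 + p}) (n : ℕ) (s : ℝ) (h1 : n ≤ s) (h2 : s ≤ n + 1) :
    IntervalIntegrable (fun t => Set.indicator S (fun _ => (1:ℝ)) (Int.fract t, Int.fract (α * t)))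
      volume n s ∧
    ∫ t in (n:ℝ)..s, Set.indicator S (fun _ => (1:ℝ)) (Int.fract t, Int.fract (α * t)) =
    (s - n) * Set.indicator (Set.Ico (0:ℝ) p) (fun _ => (1:ℝ)) (Int.fract ((n : ℝ) * α)) := by
  have hae : ∀ t ∈ Set.uIoo (n:ℝ) s, (fun t => Set.indicator S (fun _ => (1:ℝ)) (Int.fract t, Int.fract (α * t))) t =
      (fun _ => Set.indicator (Set.Ico (0:ℝ) p) (fun _ => (1:ℝ)) (Int.fract ((n : ℝ) * α))) t := by
    intro t ht
    rw [Set.uIoo_of_le h1] at ht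
    exact S_pt α p hα hap S hS n t ht.1.le (by linarith [ht.2])
  constructor
  · exact (intervalIntegrable_const (μ := volume) (a := (n:ℝ)) (b := s)).congr_uIoo (fun t ht => (hae t ht).symm)
  · rw [intervalIntegral.integral_congr_uIoo hae]
    simp

lemma S_full (α p : ℝ) (hα : α ∈ Set.Ioo (0:ℝ) 1)
    (hap : α + p < 1) (S : Set (ℝ × ℝ))
    (hS : S = {y : ℝ × ℝ | y ∈ Set.Ico (0:ℝ) 1 ×ˢ Set.Ico (0:ℝ) 1 ∧
      α * y.1 ≤ y.2 ∧ y.2 < α * y.1 + p}) (n : ℕ) (s : ℝ) (h1 : n ≤ s) (h2 : s ≤ n + 1) :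
    ∫ t in (0:ℝ)..s, Set.indicator S (fun _ => (1:ℝ)) (Int.fract t, Int.fract (α * t)) =
    ∑ k ∈ Finset.range n, Set.indicator (Set.Ico (0:ℝ) p) (fun _ => (1:ℝ)) (Int.fract ((k : ℝ) * α)) +
    (s - n) * Set.indicator (Set.Ico (0:ℝ) p) (fun _ => (1:ℝ)) (Int.fract ((n : ℝ) * α)) := by
  have hk := fun k : ℕ => S_int α p hα hap S hS k ((k + 1 : ℕ):ℝ) (by simp) (by simp)
  have hii : ∀ k < n, IntervalIntegrable (fun t => Set.indicator S (fun _ => (1:ℝ)) (Int.fract t, Int.fract (α * t)))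
      volume ((fun k : ℕ => (k:ℝ)) k) ((fun k : ℕ => (k:ℝ)) (k+1)) := fun k _ => (hk k).1
  have hsum := intervalIntegral.sum_integral_adjacent_intervals hii
  have hint := IntervalIntegrable.trans_iterate hii
  have hlast := S_int α p hα hap S hS n s h1 h2
  simp only [Nat.cast_zero] at hsum hint
  rw [← intervalIntegral.integral_add_adjacent_intervals hint hlast.1, ← hsum, hlast.2]
  congr 1
  refine Finset.sum_congr rfl fun k _ => ?_
  rw [(hk k).2]
  simp

theorem statement17 (α p : ℝ) (hα : α ∈ Set.Ioo (0:ℝ) 1) (hirr : Irrational α)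
    (hp : 0 < p) (hp1 : p < 1) (hap : α + p < 1)
    -- `p ∉ ℤα + ℤ`
    (hpnot : ¬ ∃ m n : ℤ, p = (m : ℝ) * α + (n : ℝ))
    (S : Set (ℝ × ℝ))
    (hS : S = {y : ℝ × ℝ | y ∈ Set.Ico (0:ℝ) 1 ×ˢ Set.Ico (0:ℝ) 1 ∧
      α * y.1 ≤ y.2 ∧ y.2 < α * y.1 + p}) :
    (∀ T : ℝ, 0 < T →
      |(∫ t in (0:ℝ)..T,
          Set.indicator S (fun _ => (1:ℝ)) (Int.fract t, Int.fract (α * t))) -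
        ∑ n ∈ Finset.Icc 1 (⌊T⌋.toNat),
          Set.indicator (Set.Ico (0:ℝ) p) (fun _ => (1:ℝ)) (Int.fract ((n : ℝ) * α))|
        ≤ 1) ∧
    ∀ C : ℝ, ∃ T : ℝ, 0 < T ∧
      C < |(∫ t in (0:ℝ)..T,
          Set.indicator S (fun _ => (1:ℝ)) (Int.fract t, Int.fract (α * t))) - p * T| := by
  constructor
  · intro T hT
    have hN : (⌊T⌋.toNat) = ⌊T⌋₊ := rfl
    rw [hN]
    have h1 := Nat.floor_le hT.le
    have h2 := Nat.lt_floor_add_one T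
    rw [S_full α p hα hap S hS ⌊T⌋₊ T h1 h2.le]
    set N := ⌊T⌋₊
    set c : ℕ → ℝ := fun n => Set.indicator (Set.Ico (0:ℝ) p) (fun _ => (1:ℝ)) (Int.fract ((n : ℝ) * α)) with hc
    change |∑ k ∈ Finset.range N, c k + (T - N) * c N - ∑ n ∈ Finset.Icc 1 N, c n| ≤ 1
    have c0 : c 0 = 1 := by simp [hc, hp]
    have cN : c N = 0 ∨ c N = 1 := Set.indicator_eq_zero_or_self _ _ _
    have hs : ∑ n ∈ Finset.Icc 1 N, c n + c 0 = ∑ k ∈ Finset.range N, c k + c N := by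
      rw [← Finset.sum_range_succ, Finset.sum_range_succ']
      congr 1
      rw [Finset.range_eq_Ico, Finset.sum_Ico_add' c 0 N 1]; rfl
    have : ∑ k ∈ Finset.range N, c k + (T - N) * c N - ∑ n ∈ Finset.Icc 1 N, c n = 1 - c N + (T - N) * c N := by
      linarith
    rw [this, abs_le]
    rcases cN with h | h <;> rw [h] <;> constructor <;> linarith
  · intro C
    by_contra hcon
    push Not at hcon
    refine kesten α p hirr hpnot (max C 0) fun N => ?_
    rcases Nat.eq_zero_or_pos N with rfl | hN
    · simp [SK]
    · refine le_trans ?_ (le_max_left _ _)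
      have h := hcon N (by exact_mod_cast hN)
      rw [S_full α p hα hap S hS N N le_rfl (by simp)] at h
      convert h using 2
      unfold SK
      rw [Finset.sum_sub_distrib]
      congr 1
      · simp only [sub_self, zero_mul, add_zero, zero_add]
        refine Finset.sum_congr rfl fun k _ => ?_
        rw [← chiK_coe, ← nsmul_eq_mul]
        rfl
      · simp [mul_comm]
end
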